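/- Let G be a finite simple graph on [n] without isolated vertices and I(G) its edge ideal in S = k[x_1,…,x_n]. Then S/I(G)^2 is generalized Cohen-Macaulay if and only if G is unmixed and, for every vertex i ∈ [n], the graph G_i = G \ ({i} ∪ N(i)) is special Cohen-Macaulay and contains no triangle. -/

import Mathlib

open MvPolynomial CategoryTheory CategoryTheory.Limits

noncomputable section

/-- A simplicial complex on a vertex set `V`: a collection of finite subsets of `V`
closed under taking subsets. -/
def IsSimplicialComplex {V : Type} (Δ : Set (Finset V)) : Prop :=
  ∀ F ∈ Δ, ∀ G : Finset V, G ⊆ F → G ∈ Δ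

/-- The dimension of a simplicial complex: `max {|F| - 1 : F ∈ Δ}`. -/
def complexDim {V : Type} (Δ : Set (Finset V)) : ℤ :=
  sSup ((fun F : Finset V => (F.card : ℤ) - 1) '' Δ)

/-- The star of a face: `st_Δ(F) = {H ∈ Δ : H ∪ F ∈ Δ}`. -/
def complexStar {V : Type} [DecidableEq V] (Δ : Set (Finset V)) (F : Finset V) :
    Set (Finset V) :=
  {H | H ∈ Δ ∧ H ∪ F ∈ Δ}

/-- The facets (maximal faces) of a simplicial complex. -/
def facets {V : Type} (Δ : Set (Finset V)) : Set (Finset V) :=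
  {F | F ∈ Δ ∧ ∀ G ∈ Δ, F ⊆ G → F = G}

/-- The Stanley–Reisner ideal of a simplicial complex `Δ`:
generated by the squarefree monomials `∏_{i ∈ F} x_i` with `F ∉ Δ`. -/
def srIdeal (k : Type) [Field k] {V : Type} (Δ : Set (Finset V)) :
    Ideal (MvPolynomial V k) :=
  Ideal.span {m | ∃ F : Finset V, F ∉ Δ ∧ m = ∏ i ∈ F, X i}

/-- The face prime `P_F = (x_j : j ∉ F)`. -/
def facePrime (k : Type) [Field k] {V : Type} (F : Finset V) :
    Ideal (MvPolynomial V k) :=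
  Ideal.span ((X : V → MvPolynomial V k) '' {j | j ∉ F})

/-- The `m`-th symbolic power of the Stanley–Reisner ideal:
`I_Δ^{(m)} = ⋂_{F facet of Δ} P_F^m`. -/
def symbolicPower (k : Type) [Field k] {V : Type} (Δ : Set (Finset V)) (m : ℕ) :
    Ideal (MvPolynomial V k) :=
  ⨅ F ∈ facets Δ, (facePrime k F) ^ m

/-- The homogeneous maximal ideal `m = (x_1, …, x_n)` of the polynomial ring. -/
def maxIdeal (k : Type) [Field k] (V : Type) : Ideal (MvPolynomial V k) :=
  Ideal.span (Set.range (X : V → MvPolynomial V k))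

/-- The `i`-th local cohomology module `H^i_m(S/I)`. -/
def locCoh (k : Type) [Field k] (V : Type) (I : Ideal (MvPolynomial V k)) (i : ℕ) :
    ModuleCat (MvPolynomial V k) :=
  (localCohomology (maxIdeal k V) i).obj
    (ModuleCat.of (MvPolynomial V k) (MvPolynomial V k ⧸ I))

/-- `S/I` is Cohen–Macaulay: `H^i_m(S/I) = 0` for all `i < dim S/I`. -/
def quotCM (k : Type) [Field k] (V : Type) (I : Ideal (MvPolynomial V k)) : Prop :=
  ∀ i : ℕ, (i : WithBot (WithTop ℕ)) < ringKrullDim (MvPolynomial V k ⧸ I) →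
    Subsingleton (locCoh k V I i)

/-- `S/I` is generalized Cohen–Macaulay: `H^i_m(S/I)` has finite length for all
`i < dim S/I`. -/
def quotGCM (k : Type) [Field k] (V : Type) (I : Ideal (MvPolynomial V k)) : Prop :=
  ∀ i : ℕ, (i : WithBot (WithTop ℕ)) < ringKrullDim (MvPolynomial V k ⧸ I) →
    IsFiniteLength (MvPolynomial V k) (locCoh k V I i)

/-- `S/I` is `r`-Buchsbaum: `m^r · H^i_m(S/I) = 0` for all `i < dim S/I`. -/
def quotKBuchsbaum (k : Type) [Field k] (V : Type) (I : Ideal (MvPolynomial V k))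
    (r : ℕ) : Prop :=
  ∀ i : ℕ, (i : WithBot (WithTop ℕ)) < ringKrullDim (MvPolynomial V k ⧸ I) →
    ∀ x ∈ (maxIdeal k V) ^ r, ∀ y : locCoh k V I i, x • y = 0

/-- The canonical map `Ext^i_S(S/m, S/I) → H^i_m(S/I)`, realized as the colimit
injection at the first power of `m` in the direct system defining local cohomology. -/
def canonicalExtToLocCoh (k : Type) [Field k] (V : Type) (I : Ideal (MvPolynomial V k))
    (i : ℕ) :
    ((localCohomology.diagram (localCohomology.idealPowersDiagram (maxIdeal k V)) i).obj
        (Opposite.op (Opposite.op (1 : ℕ)))).obj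
      (ModuleCat.of (MvPolynomial V k) (MvPolynomial V k ⧸ I)) ⟶ locCoh k V I i :=
  letI := localCohomology.hasColimitDiagram.{0,0}
    (localCohomology.idealPowersDiagram (maxIdeal k V)) i
  (colimit.ι (localCohomology.diagram (localCohomology.idealPowersDiagram (maxIdeal k V)) i)
    (Opposite.op (Opposite.op (1 : ℕ)))).app (ModuleCat.of (MvPolynomial V k) (MvPolynomial V k ⧸ I))

/-- `S/I` is Buchsbaum: the canonical map `Ext^i_S(S/m, S/I) → H^i_m(S/I)` is
surjective for all `i < dim S/I`. -/
def quotBuchsbaum (k : Type) [Field k] (V : Type) (I : Ideal (MvPolynomial V k)) : Prop :=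
  ∀ i : ℕ, (i : WithBot (WithTop ℕ)) < ringKrullDim (MvPolynomial V k ⧸ I) →
    Function.Surjective (canonicalExtToLocCoh k V I i)

/-- A simplicial complex is Cohen–Macaulay if its Stanley–Reisner ring is
Cohen–Macaulay over every field. -/
def complexCM {V : Type} (Δ : Set (Finset V)) : Prop :=
  ∀ (k : Type) [Field k], quotCM k V (srIdeal k Δ)

/-- A simplicial complex is Buchsbaum if its Stanley–Reisner ring is Buchsbaum over
every field. -/
def complexBuchsbaum {V : Type} (Δ : Set (Finset V)) : Prop :=
  ∀ (k : Type) [Field k], quotBuchsbaum k V (srIdeal k Δ)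

/-- The independence complex of a graph: faces are the independent sets. -/
def indepComplex {V : Type} (G : SimpleGraph V) : Set (Finset V) :=
  {F | ∀ i ∈ F, ∀ j ∈ F, ¬ G.Adj i j}

/-- The edge ideal `I(G) = (x_i x_j : ij ∈ E(G))`. -/
def edgeIdeal (k : Type) [Field k] {V : Type} (G : SimpleGraph V) :
    Ideal (MvPolynomial V k) :=
  Ideal.span {m | ∃ i j : V, G.Adj i j ∧ m = X i * X j}

/-- The independence number `α(G)`. -/
def indepNumber {V : Type} (G : SimpleGraph V) : ℕ :=
  sSup {c | ∃ F ∈ indepComplex G, F.card = c}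

/-- A graph is Cohen–Macaulay if its independence complex is. -/
def graphCM {V : Type} (G : SimpleGraph V) : Prop :=
  complexCM (indepComplex G)

/-- The vertex set of the localization `G_{pq} = G \ (N(p) ∪ N(q))` of `G` at an
edge `pq`. -/
def edgeLocSet {V : Type} (G : SimpleGraph V) (p q : V) : Set V :=
  {v | v ∉ G.neighborSet p ∪ G.neighborSet q}

/-- The localization of `G` at an edge `pq`: the induced subgraph on the vertices not
adjacent to `p` or `q` (this removes `p` and `q` as well). -/
def edgeLoc {V : Type} (G : SimpleGraph V) (p q : V) :
    SimpleGraph (edgeLocSet G p q) :=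
  G.induce (edgeLocSet G p q)

/-- `G` is special Cohen–Macaulay: `G` is Cohen–Macaulay and for every edge `pq`,
`G_{pq}` is Cohen–Macaulay with `α(G_{pq}) = α(G) - 1`. -/
def specialCM {V : Type} (G : SimpleGraph V) : Prop :=
  graphCM G ∧ ∀ p q : V, G.Adj p q →
    graphCM (edgeLoc G p q) ∧ indepNumber (edgeLoc G p q) + 1 = indepNumber G

/-- The vertex set of `G_i = G \ ({i} ∪ N(i))`. -/
def vertexLocSet {V : Type} (G : SimpleGraph V) (i : V) : Set V :=
  {v | v ≠ i ∧ v ∉ G.neighborSet i}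

/-- `G_i = G \ ({i} ∪ N(i))`: the induced subgraph obtained by deleting `i` and all
its neighbors. -/
def vertexLoc {V : Type} (G : SimpleGraph V) (i : V) :
    SimpleGraph (vertexLocSet G i) :=
  G.induce (vertexLocSet G i)

/-- A graph is unmixed if all its maximal independent sets have the same cardinality. -/
def graphUnmixed {V : Type} (G : SimpleGraph V) : Prop :=
  ∀ F ∈ facets (indepComplex G), ∀ F' ∈ facets (indepComplex G), F.card = F'.card

/-- `G` has no isolated vertices. -/
def noIsolated {V : Type} (G : SimpleGraph V) : Prop :=
  ∀ v : V, ∃ w : V, G.Adj v w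

end

section ExtRep

variable {R : Type} [CommRing R]

/-- The complex of modules of homomorphisms from a projective resolution to `M`, in the
opposite category. -/
noncomputable abbrev homComplexOp {X : ModuleCat.{0} R} (P : ProjectiveResolution X)
    (M : ModuleCat.{0} R) : ChainComplex (ModuleCat.{0} R)ᵒᵖ ℕ :=
  (((linearYoneda R (ModuleCat.{0} R)).obj M).rightOp.mapHomologicalComplex _).obj P.complex

/-- The identification of `Ext` with the homology of the complex of homomorphisms. -/
noncomputable def extHomologyMap {X : ModuleCat.{0} R} (P : ProjectiveResolution X)
    (M : ModuleCat.{0} R) (n : ℕ) :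
    ((homComplexOp P M).homology n).unop ⟶
      ((Ext R (ModuleCat.{0} R) n).obj (Opposite.op X)).obj M :=
  (P.isoLeftDerivedObj ((linearYoneda R (ModuleCat.{0} R)).obj M).rightOp n).hom.unop

instance {X : ModuleCat.{0} R} (P : ProjectiveResolution X) (M : ModuleCat.{0} R) (n : ℕ) :
    IsIso (extHomologyMap P M n) := by
  let e := (P.isoLeftDerivedObj ((linearYoneda R (ModuleCat.{0} R)).obj M).rightOp n).unop
  exact (inferInstance : IsIso e.hom)

/-- The cocycle `z` on a projective resolution of `X` represents the class `h` of `Ext`. -/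
def ExtRep {X : ModuleCat.{0} R} (P : ProjectiveResolution X) (M : ModuleCat.{0} R) (n : ℕ)
    (z : P.complex.X n ⟶ M)
    (h : ((Ext R (ModuleCat.{0} R) n).obj (Opposite.op X)).obj M) : Prop :=
  ∃ o : ((homComplexOp P M).opcycles n).unop,
    ((homComplexOp P M).pOpcycles n).unop o = z ∧
    (((homComplexOp P M).homologyι n).unop ≫ extHomologyMap P M n) o = h

variable {X : ModuleCat.{0} R} {P : ProjectiveResolution X} {M : ModuleCat.{0} R} {n : ℕ}

lemma ExtRep.add {z z' : P.complex.X n ⟶ M} {h h'} (H : ExtRep P M n z h)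
    (H' : ExtRep P M n z' h') : ExtRep P M n (z + z') (h + h') := by
  obtain ⟨o, rfl, rfl⟩ := H
  obtain ⟨o', rfl, rfl⟩ := H'
  exact ⟨o + o', map_add _ _ _, map_add _ _ _⟩

lemma ExtRep.smul {z : P.complex.X n ⟶ M} {h} (r : R) (H : ExtRep P M n z h) :
    ExtRep P M n (r • z) (r • h) := by
  obtain ⟨o, rfl, rfl⟩ := H
  exact ⟨r • o, map_smul _ _ _, map_smul _ _ _⟩

lemma ExtRep.exists_rep (P : ProjectiveResolution X)
    (h : ((Ext R (ModuleCat.{0} R) n).obj (Opposite.op X)).obj M) :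
    ∃ z : P.complex.X n ⟶ M, ExtRep P M n z h := by
  have h1 : Function.Surjective
      (((homComplexOp P M).homologyι n).unop ≫ extHomologyMap P M n) :=
    (ModuleCat.epi_iff_surjective _).1 inferInstance
  obtain ⟨o, rfl⟩ := h1 h
  exact ⟨_, o, rfl, rfl⟩

lemma ExtRep.cocycle {z : P.complex.X n ⟶ M} {h} (H : ExtRep P M n z h) (m : ℕ) :
    P.complex.d m n ≫ z = 0 := by
  obtain ⟨o, rfl, rfl⟩ := H
  have := congrArg Quiver.Hom.unop ((homComplexOp P M).d_pOpcycles m n)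
  exact ConcreteCategory.congr_hom this o

lemma ExtRep.of_cocycle {z : P.complex.X n ⟶ M} (hz : P.complex.d (n + 1) n ≫ z = 0) :
    ∃ h, ExtRep P M n z h := by
  let K := homComplexOp P M
  have hex : (ShortComplex.mk (K.d (n+1) n) (K.pOpcycles n) (K.d_pOpcycles _ _)).Exact :=
    ShortComplex.exact_of_g_is_cokernel _ (K.opcyclesIsCokernel (n+1) n (by simp))
  have := hex.unop
  rw [ShortComplex.moduleCat_exact_iff] at this
  obtain ⟨o, ho⟩ := this z hz
  exact ⟨_, o, ho, rfl⟩

lemma ExtRep.eq_zero_iff {z : P.complex.X n ⟶ M} {h} (H : ExtRep P M n z h) :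
    h = 0 ↔ ∃ w : P.complex.X (n - 1) ⟶ M, z = P.complex.d n (n - 1) ≫ w := by
  let K := homComplexOp P M
  obtain ⟨o, rfl, rfl⟩ := H
  have h2 : Function.Injective (extHomologyMap P M n) :=
    (ModuleCat.mono_iff_injective _).1 inferInstance
  have h3 : Function.Injective (K.pOpcycles n).unop :=
    (ModuleCat.mono_iff_injective _).1 inferInstance
  rw [ConcreteCategory.comp_apply, map_eq_zero_iff _ h2]
  have hn : (ComplexShape.down ℕ).next n = n - 1 := by
    cases n with
    | zero => simp
    | succ n => simp
  have hex : (ShortComplex.mk (K.homologyι n) (K.fromOpcycles n (n-1))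
      (K.homologyι_comp_fromOpcycles _ _)).Exact :=
    ShortComplex.exact_of_f_is_kernel _ (K.homologyIsKernel n (n-1) hn)
  have hex := hex.unop
  rw [ShortComplex.moduleCat_exact_iff] at hex
  have hp := congrArg Quiver.Hom.unop (K.p_fromOpcycles n (n-1))
  constructor
  · intro h0
    obtain ⟨w, hw⟩ := hex o h0
    refine ⟨w, ?_⟩
    have := ConcreteCategory.congr_hom hp w
    rw [← hw]
    exact this
  · rintro ⟨w, hw⟩
    have := ConcreteCategory.congr_hom hp w
    have h4 : o = (K.fromOpcycles n (n-1)).unop w := h3 (hw.trans this.symm)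
    rw [h4]
    have h5 := congrArg Quiver.Hom.unop (K.homologyι_comp_fromOpcycles n (n-1))
    exact ConcreteCategory.congr_hom h5 w

lemma ExtRep.map {M' : ModuleCat.{0} R} (f : M ⟶ M') {z : P.complex.X n ⟶ M} {h}
    (H : ExtRep P M n z h) :
    ExtRep P M' n (z ≫ f) ((((Ext R (ModuleCat.{0} R) n).obj (Opposite.op X)).map f) h) := by
  obtain ⟨o, rfl, rfl⟩ := H
  let α := NatTrans.rightOp ((linearYoneda R (ModuleCat.{0} R)).map f)
  let φ := ((NatTrans.mapHomologicalComplex α (ComplexShape.down ℕ)).app P.complex)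
  refine ⟨(HomologicalComplex.opcyclesMap φ n).unop o, ?_, ?_⟩
  · have := congrArg Quiver.Hom.unop (HomologicalComplex.p_opcyclesMap φ n)
    exact ConcreteCategory.congr_hom this o
  · have h1 := congrArg Quiver.Hom.unop (HomologicalComplex.homologyι_naturality φ n)
    have h2 := P.leftDerived_app_eq α n
    have h3 : (NatTrans.leftDerived α n).app X ≫ (P.isoLeftDerivedObj
        ((linearYoneda R (ModuleCat.{0} R)).obj M).rightOp n).hom =
      (P.isoLeftDerivedObj ((linearYoneda R (ModuleCat.{0} R)).obj M').rightOp n).hom ≫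
        HomologicalComplex.homologyMap φ n := by
      rw [h2, Category.assoc, Category.assoc, Iso.inv_hom_id, Category.comp_id]
      rfl
    have h4 : extHomologyMap P M n ≫ ((Ext R (ModuleCat.{0} R) n).obj (Opposite.op X)).map f =
      (HomologicalComplex.homologyMap φ n).unop ≫ extHomologyMap P M' n :=
      congrArg Quiver.Hom.unop h3
    have h5 : (HomologicalComplex.opcyclesMap φ n).unop ≫
        ((homComplexOp P M').homologyι n).unop ≫ extHomologyMap P M' n =
        (((homComplexOp P M).homologyι n).unop ≫ extHomologyMap P M n) ≫
          ((Ext R (ModuleCat.{0} R) n).obj (Opposite.op X)).map f := by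
      rw [Category.assoc, h4, ← Category.assoc, ← Category.assoc]
      congr 1
      exact h1.symm
    exact ConcreteCategory.congr_hom h5 o

lemma ExtRep.pullback {Y : ModuleCat.{0} R} {Q : ProjectiveResolution Y} (f : Y ⟶ X)
    (φ : Q.complex ⟶ P.complex) (comm : φ.f 0 ≫ P.π.f 0 = Q.π.f 0 ≫ f)
    {z : P.complex.X n ⟶ M} {h} (H : ExtRep P M n z h) :
    ExtRep Q M n (φ.f n ≫ z)
      ((((Ext R (ModuleCat.{0} R) n).map f.op).app M) h) := by
  obtain ⟨o, rfl, rfl⟩ := H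
  let F := ((linearYoneda R (ModuleCat.{0} R)).obj M).rightOp
  let ψ := (F.mapHomologicalComplex (ComplexShape.down ℕ)).map φ
  refine ⟨(HomologicalComplex.opcyclesMap ψ n).unop o, ?_, ?_⟩
  · have := congrArg Quiver.Hom.unop (HomologicalComplex.p_opcyclesMap ψ n)
    exact ConcreteCategory.congr_hom this o
  · have h1 := congrArg Quiver.Hom.unop (HomologicalComplex.homologyι_naturality ψ n)
    have h2 := ProjectiveResolution.isoLeftDerivedObj_hom_naturality f Q P φ comm F n
    have h4 : extHomologyMap P M n ≫ ((Ext R (ModuleCat.{0} R) n).map f.op).app M =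
      (HomologicalComplex.homologyMap ψ n).unop ≫ extHomologyMap Q M n :=
      congrArg Quiver.Hom.unop h2
    have h5 : (HomologicalComplex.opcyclesMap ψ n).unop ≫
        ((homComplexOp Q M).homologyι n).unop ≫ extHomologyMap Q M n =
        (((homComplexOp P M).homologyι n).unop ≫ extHomologyMap P M n) ≫
          ((Ext R (ModuleCat.{0} R) n).map f.op).app M := by
      rw [Category.assoc, h4, ← Category.assoc, ← Category.assoc]
      congr 1
      exact h1.symm
    exact ConcreteCategory.congr_hom h5 o

lemma ExtRep.smul_eq_zero {r : R} (hr : ∀ x : X, r • x = 0)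
    (h : ((Ext R (ModuleCat.{0} R) n).obj (Opposite.op X)).obj M) : r • h = 0 := by
  let P := projectiveResolution X
  obtain ⟨z, hz⟩ := ExtRep.exists_rep P h
  have hX : r • 𝟙 X = 0 := by
    ext x
    exact hr x
  let hto : Homotopy (r • 𝟙 P.complex) 0 :=
    ProjectiveResolution.liftHomotopyZero (P := P) (Q := P) (r • 𝟙 P.complex) (by
      have : (r • 𝟙 P.complex) ≫ P.π = P.π ≫ (ChainComplex.single₀ _).map (r • 𝟙 X) := by
        ext : 1
        simp only [HomologicalComplex.comp_f, HomologicalComplex.smul_f_apply,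
          Linear.smul_comp, Category.id_comp,
          ChainComplex.single₀_map_f_zero]
        exact ((Linear.comp_smul _ _ _ _ _ _).trans
          (congrArg (r • ·) (Category.comp_id (P.π.f 0)))).symm
      rw [this, hX]
      simp)
  have := hto.comm n
  refine (ExtRep.eq_zero_iff (ExtRep.smul r hz)).2 ⟨hto.hom (n-1) n ≫ z, ?_⟩
  have h3 : r • z = (r • 𝟙 P.complex : P.complex ⟶ P.complex).f n ≫ z := by simp
  rw [h3, this]
  have hn : (ComplexShape.down ℕ).next n = n - 1 := by
    cases n with
    | zero => simp
    | succ n => simp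
  have h4 := hz.cocycle ((ComplexShape.down ℕ).prev n)
  simp [dNext, prevD, h4]
  rw [hn]
end ExtRep

section LocCoh

variable {R : Type} [CommRing R] (J : Ideal R)

/-- The Ext modules whose colimit is local cohomology. -/
noncomputable abbrev extPow (i t : ℕ) (M : ModuleCat.{0} R) : ModuleCat.{0} R :=
  ((Ext R (ModuleCat.{0} R) i).obj (Opposite.op (ModuleCat.of R (R ⧸ J ^ t)))).obj M

/-- The quotient maps between quotients by powers of an ideal. -/
def quotPowMap {s t : ℕ} (h : t ≤ s) :
    ModuleCat.of R (R ⧸ J ^ s) ⟶ ModuleCat.of R (R ⧸ J ^ t) :=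
  (localCohomology.ringModIdeals (localCohomology.idealPowersDiagram J)).map (homOfLE h).op

/-- The transition maps of the system defining local cohomology. -/
noncomputable def extPowMap (i : ℕ) {s t : ℕ} (h : t ≤ s) (M : ModuleCat.{0} R) :
    extPow J i t M ⟶ extPow J i s M :=
  ((Ext R (ModuleCat.{0} R) i).map (quotPowMap J h).op).app M

/-- The colimit injections of local cohomology. -/
noncomputable def lcι (i t : ℕ) (M : ModuleCat.{0} R) :
    extPow J i t M ⟶ (localCohomology J i).obj M :=
  letI := localCohomology.hasColimitDiagram.{0,0} (localCohomology.idealPowersDiagram J) i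
  (colimit.ι (localCohomology.diagram (localCohomology.idealPowersDiagram J) i)
    (Opposite.op (Opposite.op t))).app M

lemma lcι_naturality (i t : ℕ) {M M' : ModuleCat.{0} R} (f : M ⟶ M') :
    ((Ext R (ModuleCat.{0} R) i).obj (Opposite.op (ModuleCat.of R (R ⧸ J ^ t)))).map f ≫
      lcι J i t M' = lcι J i t M ≫ (localCohomology J i).map f :=
  letI := localCohomology.hasColimitDiagram.{0,0} (localCohomology.idealPowersDiagram J) i
  (colimit.ι (localCohomology.diagram (localCohomology.idealPowersDiagram J) i)
    (Opposite.op (Opposite.op t))).naturality f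

lemma extPowMap_lcι (i : ℕ) {s t : ℕ} (h : t ≤ s) (M : ModuleCat.{0} R) :
    extPowMap J i h M ≫ lcι J i s M = lcι J i t M :=
  letI := localCohomology.hasColimitDiagram.{0,0} (localCohomology.idealPowersDiagram J) i
  congrArg (fun α => NatTrans.app α M)
    (colimit.w (localCohomology.diagram (localCohomology.idealPowersDiagram J) i)
      (homOfLE h).op.op)

/-- Local cohomology of a module as the evaluation of a colimit of functors. -/
noncomputable def lcIsColimit (i : ℕ) (M : ModuleCat.{0} R) :
    IsColimit (((evaluation _ _).obj M).mapCocone (colimit.cocone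
      (localCohomology.diagram (localCohomology.idealPowersDiagram J) i))) :=
  isColimitOfPreserves _ (colimit.isColimit _)

instance : IsFiltered (ℕᵒᵖ)ᵒᵖ := inferInstance

lemma lc_exists_rep {i : ℕ} {M : ModuleCat.{0} R} (h : (localCohomology J i).obj M) :
    ∃ t, ∃ e : extPow J i t M, lcι J i t M e = h := by
  obtain ⟨j, e, he⟩ := Concrete.isColimit_exists_rep _ (lcIsColimit J i M) h
  exact ⟨j.unop.unop, e, he⟩

lemma lcι_eq_zero {i t : ℕ} {M : ModuleCat.{0} R} {e : extPow J i t M}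
    (he : lcι J i t M e = 0) : ∃ s, ∃ h : t ≤ s, extPowMap J i h M e = 0 := by
  have := (Concrete.isColimit_rep_eq_iff_exists _ (lcIsColimit J i M)
    (i := Opposite.op (Opposite.op t)) (j := Opposite.op (Opposite.op t)) e 0).1
    (he.trans (map_zero (lcι J i t M).hom).symm)
  obtain ⟨s, f, g, hfg⟩ := this
  refine ⟨s.unop.unop, leOfHom f.unop.unop, ?_⟩
  have h0 : ((localCohomology.diagram (localCohomology.idealPowersDiagram J) i ⋙
    (evaluation _ _).obj M).map g).hom 0 = 0 := map_zero _
  exact hfg.trans h0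

end LocCoh

section LcRep

variable {R : Type} [CommRing R] (J : Ideal R)

/-- Local cohomology of an unbundled module. -/
noncomputable abbrev LC (i : ℕ) (M : Type) [AddCommGroup M] [Module R M] : Type :=
  (localCohomology J i).obj (ModuleCat.of R M)

/-- The map on local cohomology induced by a linear map. -/
noncomputable def LC.map (i : ℕ) {M N : Type} [AddCommGroup M] [Module R M] [AddCommGroup N]
    [Module R N] (f : M →ₗ[R] N) : LC J i M →ₗ[R] LC J i N :=
  ((localCohomology J i).map (ModuleCat.ofHom f)).hom

/-- A chosen projective resolution of a quotient by a power of an ideal. -/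
noncomputable def powRes (t : ℕ) : ProjectiveResolution (ModuleCat.of R (R ⧸ J ^ t)) :=
  projectiveResolution _

/-- The terms of the chosen projective resolution. -/
noncomputable abbrev PX (t i : ℕ) : Type := (powRes J t).complex.X i

/-- The differentials of the chosen projective resolution. -/
noncomputable def pd (t i j : ℕ) : PX J t i →ₗ[R] PX J t j := ((powRes J t).complex.d i j).hom

/-- The augmentation of the chosen projective resolution. -/
noncomputable def paug (t : ℕ) : PX J t 0 →ₗ[R] R ⧸ J ^ t := ((powRes J t).π.f 0).hom

/-- A lift of the quotient map to the chosen projective resolutions. -/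
noncomputable def plift {s t : ℕ} (h : t ≤ s) (i : ℕ) : PX J s i →ₗ[R] PX J t i :=
  ((ProjectiveResolution.lift (quotPowMap J h) (powRes J s) (powRes J t)).f i).hom

variable {J}

instance (t i : ℕ) : Module.Projective R (PX J t i) :=
  (IsProjective.iff_projective _).2 ((powRes J t).projective i)

lemma pd_pd (t i j l : ℕ) : pd J t j l ∘ₗ pd J t i j = 0 :=
  congrArg ModuleCat.Hom.hom ((powRes J t).complex.d_comp_d i j l)

lemma pd_zero (t : ℕ) (j : ℕ) : pd J t 0 j = 0 :=
  congrArg ModuleCat.Hom.hom ((powRes J t).complex.shape 0 j (by simp))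

lemma plift_pd {s t : ℕ} (h : t ≤ s) (i j : ℕ) :
    pd J t i j ∘ₗ plift J h i = plift J h j ∘ₗ pd J s i j :=
  congrArg ModuleCat.Hom.hom
    ((ProjectiveResolution.lift (quotPowMap J h) (powRes J s) (powRes J t)).comm i j)

lemma pd_exact (t i : ℕ) {x : PX J t (i + 1)} (hx : pd J t (i + 1) i x = 0) :
    ∃ y, pd J t (i + 2) (i + 1) y = x := by
  have h := (powRes J t).exact_succ i
  rw [ShortComplex.moduleCat_exact_iff] at h
  exact h x hx

lemma paug_surjective (t : ℕ) : Function.Surjective (paug J t) :=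
  (ModuleCat.epi_iff_surjective _).1 (inferInstanceAs (Epi ((powRes J t).π.f 0)))

lemma paug_pd (t : ℕ) (x : PX J t 1) : paug J t (pd J t 1 0 x) = 0 :=
  ConcreteCategory.congr_hom (powRes J t).complex_d_comp_π_f_zero x

lemma paug_exact (t : ℕ) {x : PX J t 0} (hx : paug J t x = 0) :
    ∃ y, pd J t 1 0 y = x := by
  have h := (powRes J t).exact₀
  rw [ShortComplex.moduleCat_exact_iff] at h
  exact h x hx

variable {M N : Type} [AddCommGroup M] [Module R M] [AddCommGroup N] [Module R N]

/-- The cocycle `z` represents the class `h` in local cohomology. -/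
def LcRep (i t : ℕ) (z : PX J t i →ₗ[R] M) (h : LC J i M) : Prop :=
  ∃ e, ExtRep (powRes J t) (ModuleCat.of R M) i (ModuleCat.ofHom z) e ∧
    lcι J i t (ModuleCat.of R M) e = h

variable {i t : ℕ}

lemma LcRep.add {z z' : PX J t i →ₗ[R] M} {h h'} (H : LcRep i t z h) (H' : LcRep i t z' h') :
    LcRep i t (z + z') (h + h') := by
  obtain ⟨e, he, rfl⟩ := H
  obtain ⟨e', he', rfl⟩ := H'
  exact ⟨e + e', he.add he', map_add _ _ _⟩

lemma LcRep.smul {z : PX J t i →ₗ[R] M} {h} (r : R) (H : LcRep i t z h) :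
    LcRep i t (r • z) (r • h) := by
  obtain ⟨e, he, rfl⟩ := H
  exact ⟨r • e, he.smul r, map_smul _ _ _⟩

lemma LcRep.map (f : M →ₗ[R] N) {z : PX J t i →ₗ[R] M} {h} (H : LcRep i t z h) :
    LcRep i t (f ∘ₗ z) (LC.map J i f h) := by
  obtain ⟨e, he, rfl⟩ := H
  exact ⟨_, he.map (ModuleCat.ofHom f),
    ConcreteCategory.congr_hom (lcι_naturality J i t (ModuleCat.ofHom f)) e⟩

lemma LcRep.lift {z : PX J t i →ₗ[R] M} {h} (H : LcRep i t z h) {s : ℕ} (hs : t ≤ s) :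
    LcRep i s (z ∘ₗ plift J hs i) h := by
  obtain ⟨e, he, rfl⟩ := H
  refine ⟨extPowMap J i hs _ e, ?_, ConcreteCategory.congr_hom (extPowMap_lcι J i hs _) e⟩
  exact he.pullback (quotPowMap J hs)
    (ProjectiveResolution.lift (quotPowMap J hs) (powRes J s) (powRes J t))
    (ProjectiveResolution.lift_commutes_zero _ _ _)

lemma LcRep.exists_rep (h : LC J i M) : ∃ t, ∃ z : PX J t i →ₗ[R] M, LcRep i t z h := by
  obtain ⟨t, e, rfl⟩ := lc_exists_rep J h
  obtain ⟨z, hz⟩ := ExtRep.exists_rep (powRes J t) e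
  exact ⟨t, z.hom, e, hz, rfl⟩

lemma LcRep.cocycle {z : PX J t i →ₗ[R] M} {h} (H : LcRep i t z h) (m : ℕ) :
    z ∘ₗ pd J t m i = 0 := by
  obtain ⟨e, he, rfl⟩ := H
  exact congrArg ModuleCat.Hom.hom (he.cocycle m)

lemma LcRep.of_cocycle {z : PX J t i →ₗ[R] M} (hz : z ∘ₗ pd J t (i + 1) i = 0) :
    ∃ h, LcRep i t z h := by
  obtain ⟨e, he⟩ := ExtRep.of_cocycle (P := powRes J t) (M := ModuleCat.of R M)
    (z := ModuleCat.ofHom z) (ModuleCat.hom_ext hz)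
  exact ⟨_, e, he, rfl⟩

lemma LcRep.eq_zero {z : PX J t i →ₗ[R] M} {h} (H : LcRep i t z h) {w : PX J t (i - 1) →ₗ[R] M}
    (hw : z = w ∘ₗ pd J t i (i - 1)) : h = 0 := by
  obtain ⟨e, he, rfl⟩ := H
  rw [he.eq_zero_iff.2 ⟨ModuleCat.ofHom w, ModuleCat.hom_ext hw⟩, map_zero]

lemma LcRep.exists_of_eq_zero {z : PX J t i →ₗ[R] M} {h} (H : LcRep i t z h) (h0 : h = 0) :
    ∃ s, ∃ hs : t ≤ s, ∃ w : PX J s (i - 1) →ₗ[R] M,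
      z ∘ₗ plift J hs i = w ∘ₗ pd J s i (i - 1) := by
  obtain ⟨e, he, rfl⟩ := H
  obtain ⟨s, hs, h1⟩ := lcι_eq_zero J h0
  have h2 := he.pullback (quotPowMap J hs)
    (ProjectiveResolution.lift (quotPowMap J hs) (powRes J s) (powRes J t))
    (ProjectiveResolution.lift_commutes_zero _ _ _)
  obtain ⟨w, hw⟩ := h2.eq_zero_iff.1 h1
  exact ⟨s, hs, w.hom, congrArg ModuleCat.Hom.hom hw⟩

lemma LcRep.unique {z : PX J t i →ₗ[R] M} {h h'} (H : LcRep i t z h) (H' : LcRep i t z h') :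
    h = h' := by
  have h1 := H.add (H'.smul (-1))
  have h2 := h1.eq_zero (w := 0) (by simp)
  rw [neg_one_smul, ← sub_eq_add_neg, sub_eq_zero] at h2
  exact h2

lemma LC.torsion (h : LC J i M) : ∃ N, ∀ r ∈ J ^ N, r • h = 0 := by
  obtain ⟨t, e, rfl⟩ := lc_exists_rep J h
  refine ⟨t, fun r hr => ?_⟩
  rw [← map_smul, ExtRep.smul_eq_zero, map_zero]
  intro x
  obtain ⟨x, rfl⟩ := Ideal.Quotient.mk_surjective x
  change Ideal.Quotient.mk (J ^ t) (r * x) = 0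
  exact Ideal.Quotient.eq_zero_iff_mem.2 (Ideal.mul_mem_right _ _ hr)

lemma LC.map_comp {K : Type} [AddCommGroup K] [Module R K] (f : M →ₗ[R] N) (g : N →ₗ[R] K) :
    LC.map J i (g ∘ₗ f) = LC.map J i g ∘ₗ LC.map J i f :=
  congrArg ModuleCat.Hom.hom ((localCohomology J i).map_comp (ModuleCat.ofHom f) (ModuleCat.ofHom g))

lemma LC.map_id : LC.map J i (LinearMap.id : M →ₗ[R] M) = LinearMap.id :=
  congrArg ModuleCat.Hom.hom ((localCohomology J i).map_id (ModuleCat.of R M))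

lemma LC.map_smul_id (r : R) (f : M →ₗ[R] N) : LC.map J i (r • f) = r • LC.map J i f := by
  ext h
  obtain ⟨t, z, hz⟩ := LcRep.exists_rep h
  exact (hz.map (r • f)).unique ((hz.map f).smul r)

/-- Isomorphic modules have isomorphic local cohomology. -/
noncomputable def LC.congr (e : M ≃ₗ[R] N) : LC J i M ≃ₗ[R] LC J i N :=
  LinearEquiv.ofLinearMap (LC.map J i e) (LC.map J i e.symm)
    (by rw [← LC.map_comp]; simp [LC.map_id]) (by rw [← LC.map_comp]; simp [LC.map_id])

end LcRep

lemma exists_linearMap_of_rel {R X Y : Type} [CommRing R] [AddCommGroup X] [Module R X]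
    [AddCommGroup Y] [Module R Y] (Rel : X → Y → Prop) (htot : ∀ x, ∃ y, Rel x y)
    (hadd : ∀ x y x' y', Rel x y → Rel x' y' → Rel (x + x') (y + y'))
    (hsmul : ∀ (r : R) x y, Rel x y → Rel (r • x) (r • y))
    (hzero : ∀ y, Rel 0 y → y = 0) :
    ∃ f : X →ₗ[R] Y, ∀ x y, Rel x y ↔ f x = y := by
  have huniq : ∀ x y y', Rel x y → Rel x y' → y = y' := by
    intro x y y' h h'
    have := hadd _ _ _ _ h (hsmul (-1) _ _ h')
    rw [neg_one_smul, neg_one_smul, add_neg_cancel, ← sub_eq_add_neg] at this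
    exact sub_eq_zero.1 (hzero _ this)
  choose f hf using htot
  refine ⟨⟨⟨f, fun x x' => huniq _ _ _ (hf _) (hadd _ _ _ _ (hf x) (hf x'))⟩,
    fun r x => huniq _ _ _ (hf _) (hsmul r _ _ (hf x))⟩, fun x y => ⟨fun h => huniq _ _ _ (hf x) h, ?_⟩⟩
  rintro rfl
  exact hf x

section LES

variable {R : Type} [CommRing R] {J : Ideal R} {A B C : Type} [AddCommGroup A] [Module R A]
  [AddCommGroup B] [Module R B] [AddCommGroup C] [Module R C]

lemma exists_lift_of_exact {P : Type} [AddCommGroup P] [Module R P] [Module.Projective R P]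
    {f : A →ₗ[R] B} {g : B →ₗ[R] C} (hf : Function.Injective f)
    (hfg : Function.Exact f g) (z : P →ₗ[R] B) (hz : g ∘ₗ z = 0) : ∃ w, f ∘ₗ w = z := by
  have h : ∀ x, z x ∈ LinearMap.range f := fun x => (hfg _).1 (LinearMap.congr_fun hz x)
  refine ⟨(LinearEquiv.ofInjective f hf).symm ∘ₗ z.codRestrict _ h, ?_⟩
  ext x
  have := (LinearEquiv.ofInjective f hf).apply_symm_apply (z.codRestrict _ h x)
  exact congrArg Subtype.val this

lemma LC.map_zero_injective {f : A →ₗ[R] B} (hf : Function.Injective f) :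
    Function.Injective (LC.map J 0 f) := by
  rw [injective_iff_map_eq_zero]
  intro a ha
  obtain ⟨t, z, hz⟩ := LcRep.exists_rep a
  obtain ⟨s, hs, w, hw⟩ := (hz.map f).exists_of_eq_zero ha
  refine (hz.lift hs).eq_zero (w := 0) ?_
  ext x
  apply hf
  have := LinearMap.congr_fun hw x
  simpa [pd_zero] using this

/-- The long exact sequence of local cohomology, as the existence of connecting maps. -/
theorem LC.exists_delta {f : A →ₗ[R] B} {g : B →ₗ[R] C} (hf : Function.Injective f)
    (hg : Function.Surjective g) (hfg : Function.Exact f g) (i : ℕ) :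
    Function.Exact (LC.map J i f) (LC.map J i g) ∧
    ∃ δ : LC J i C →ₗ[R] LC J (i + 1) A,
      Function.Exact (LC.map J i g) δ ∧ Function.Exact δ (LC.map J (i + 1) f) := by
  have hgf : g ∘ₗ f = 0 := by
    ext x
    exact (hfg _).2 ⟨x, rfl⟩
  constructor
  · intro b
    constructor
    · intro hb
      obtain ⟨t, z, hz⟩ := LcRep.exists_rep b
      obtain ⟨s, hs, u, hu⟩ := (hz.map g).exists_of_eq_zero hb
      obtain ⟨u', rfl⟩ := Module.projective_lifting_property g u hg
      obtain ⟨v, hv⟩ := exists_lift_of_exact hf hfg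
        (z ∘ₗ plift J hs i - u' ∘ₗ pd J s i (i - 1)) (by
          rw [LinearMap.comp_sub, ← LinearMap.comp_assoc, hu, LinearMap.comp_assoc, sub_self])
      have hvc : v ∘ₗ pd J s (i + 1) i = 0 := by
        ext x
        apply hf
        have h1 := LinearMap.congr_fun hv (pd J s (i + 1) i x)
        have h2 := LinearMap.congr_fun ((hz.lift hs).cocycle (i + 1)) x
        have h3 := LinearMap.congr_fun (pd_pd (J := J) s (i + 1) i (i - 1)) x
        simp only [LinearMap.comp_apply, LinearMap.sub_apply, LinearMap.zero_apply] at *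
        rw [h1, h2, h3, map_zero, map_zero, sub_zero]
      obtain ⟨a, ha⟩ := LcRep.of_cocycle hvc
      refine ⟨a, ?_⟩
      have h4 := (ha.map f).add ((hz.lift hs).smul (-1))
      have h5 := h4.eq_zero (w := -u') (by
        rw [hv]
        ext x
        simp
        abel)
      rw [neg_one_smul, ← sub_eq_add_neg] at h5
      exact sub_eq_zero.1 h5
    · rintro ⟨a, rfl⟩
      obtain ⟨t, z, hz⟩ := LcRep.exists_rep a
      refine ((hz.map f).map g).eq_zero (w := 0) ?_
      rw [← LinearMap.comp_assoc, hgf]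
      simp
  · let Rel : LC J i C → LC J (i + 1) A → Prop := fun c a =>
      ∃ t, ∃ (z : PX J t i →ₗ[R] B) (w : PX J t (i + 1) →ₗ[R] A),
        LcRep i t (g ∘ₗ z) c ∧ LcRep (i + 1) t w a ∧ f ∘ₗ w = z ∘ₗ pd J t (i + 1) i
    have hlift : ∀ {t : ℕ} {c a} {z : PX J t i →ₗ[R] B} {w : PX J t (i + 1) →ₗ[R] A},
        LcRep i t (g ∘ₗ z) c → LcRep (i + 1) t w a → f ∘ₗ w = z ∘ₗ pd J t (i + 1) i →
        ∀ {s : ℕ} (hs : t ≤ s), LcRep i s (g ∘ₗ (z ∘ₗ plift J hs i)) c ∧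
          LcRep (i + 1) s (w ∘ₗ plift J hs (i + 1)) a ∧
          f ∘ₗ (w ∘ₗ plift J hs (i + 1)) = (z ∘ₗ plift J hs i) ∘ₗ pd J s (i + 1) i := by
      intro t c a z w h1 h2 h3 s hs
      refine ⟨h1.lift hs, h2.lift hs, ?_⟩
      rw [← LinearMap.comp_assoc, h3, LinearMap.comp_assoc, LinearMap.comp_assoc, plift_pd]
    obtain ⟨δ, hδ⟩ := exists_linearMap_of_rel (R := R) Rel (by
        intro c
        obtain ⟨t, z, hz⟩ := LcRep.exists_rep c
        obtain ⟨z', rfl⟩ := Module.projective_lifting_property g z hg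
        obtain ⟨w, hw⟩ := exists_lift_of_exact hf hfg (z' ∘ₗ pd J t (i + 1) i) (by
          rw [← LinearMap.comp_assoc]
          exact hz.cocycle _)
        have hwc : w ∘ₗ pd J t (i + 1 + 1) (i + 1) = 0 := by
          ext x
          apply hf
          have h1 := LinearMap.congr_fun hw (pd J t (i + 1 + 1) (i + 1) x)
          have h3 := LinearMap.congr_fun (pd_pd (J := J) t (i + 1 + 1) (i + 1) i) x
          simp only [LinearMap.comp_apply, LinearMap.zero_apply] at *
          rw [h1, h3, map_zero, map_zero]
        obtain ⟨a, ha⟩ := LcRep.of_cocycle hwc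
        exact ⟨a, t, z', w, hz, ha, hw⟩) (by
        rintro c a c' a' ⟨t, z, w, h1, h2, h3⟩ ⟨t', z', w', h1', h2', h3'⟩
        obtain ⟨k1, k2, k3⟩ := hlift h1 h2 h3 (le_max_left t t')
        obtain ⟨k1', k2', k3'⟩ := hlift h1' h2' h3' (le_max_right t t')
        refine ⟨_, z ∘ₗ plift J (le_max_left t t') i + z' ∘ₗ plift J (le_max_right t t') i,
          _, ?_, k2.add k2', ?_⟩
        · rw [LinearMap.comp_add]
          exact k1.add k1'
        · rw [LinearMap.comp_add, k3, k3', LinearMap.add_comp]) (by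
        rintro r c a ⟨t, z, w, h1, h2, h3⟩
        refine ⟨t, r • z, r • w, ?_, h2.smul r, ?_⟩
        · rw [LinearMap.comp_smul]
          exact h1.smul r
        · rw [LinearMap.comp_smul, h3, LinearMap.smul_comp]) (by
        rintro a ⟨t, z, w, h1, h2, h3⟩
        obtain ⟨s, hs, u, hu⟩ := h1.exists_of_eq_zero rfl
        obtain ⟨k1, k2, k3⟩ := hlift h1 h2 h3 hs
        obtain ⟨u', rfl⟩ := Module.projective_lifting_property g u hg
        obtain ⟨v, hv⟩ := exists_lift_of_exact hf hfg
          (z ∘ₗ plift J hs i - u' ∘ₗ pd J s i (i - 1)) (by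
            rw [LinearMap.comp_sub, ← LinearMap.comp_assoc, hu, LinearMap.comp_assoc, sub_self])
        refine k2.eq_zero (w := v) ?_
        ext x
        apply hf
        have h1 := LinearMap.congr_fun k3 x
        have h2 := LinearMap.congr_fun hv (pd J s (i + 1) i x)
        have h3 := LinearMap.congr_fun (pd_pd (J := J) s (i + 1) i (i - 1)) x
        change f (w (plift J hs (i + 1) x)) = f (v (pd J s (i + 1) i x))
        simp only [LinearMap.comp_apply, LinearMap.sub_apply, LinearMap.zero_apply] at *
        rw [h1, h2, h3, map_zero, sub_zero])
    refine ⟨δ, fun c => ⟨fun hc => ?_, ?_⟩, fun a => ⟨fun ha => ?_, ?_⟩⟩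
    · obtain ⟨t, z, w, h1, h2, h3⟩ := (hδ c 0).2 hc
      obtain ⟨s, hs, v, hv⟩ := h2.exists_of_eq_zero rfl
      obtain ⟨k1, k2, k3⟩ := hlift h1 h2 h3 hs
      change PX J s i →ₗ[R] A at v
      change w ∘ₗ plift J hs (i + 1) = v ∘ₗ pd J s (i + 1) i at hv
      obtain ⟨b, hb⟩ := LcRep.of_cocycle (J := J) (i := i) (t := s)
        (z := z ∘ₗ plift J hs i - f ∘ₗ v) (by
          rw [LinearMap.sub_comp, ← k3, hv, LinearMap.comp_assoc, sub_self])
      refine ⟨b, ?_⟩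
      have := hb.map g
      rw [LinearMap.comp_sub, ← LinearMap.comp_assoc (f := v), hgf, LinearMap.zero_comp,
        sub_zero] at this
      exact this.unique k1
    · rintro ⟨b, rfl⟩
      obtain ⟨t, z, hz⟩ := LcRep.exists_rep b
      refine (hδ _ _).1 ⟨t, z, 0, hz.map g, ?_, ?_⟩
      · obtain ⟨h, hh⟩ := LcRep.of_cocycle (J := J) (i := i + 1) (t := t) (M := A) (z := 0)
          (by simp)
        rwa [hh.eq_zero (w := 0) (by simp)] at hh
      · rw [hz.cocycle]
        simp
    · obtain ⟨t, w, hw⟩ := LcRep.exists_rep a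
      obtain ⟨s, hs, z, hz⟩ := (hw.map f).exists_of_eq_zero ha
      change PX J s i →ₗ[R] B at z
      change (f ∘ₗ w) ∘ₗ plift J hs (i + 1) = z ∘ₗ pd J s (i + 1) i at hz
      obtain ⟨c, hc⟩ := LcRep.of_cocycle (J := J) (i := i) (t := s) (z := g ∘ₗ z) (by
        rw [LinearMap.comp_assoc, ← hz, ← LinearMap.comp_assoc, ← LinearMap.comp_assoc, hgf]
        simp)
      exact ⟨c, (hδ _ _).1 ⟨s, z, _, hc, hw.lift hs, by rw [← hz, LinearMap.comp_assoc]⟩⟩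
    · rintro ⟨c, rfl⟩
      obtain ⟨t, z, w, h1, h2, h3⟩ := (hδ c _).2 rfl
      exact (h2.map f).eq_zero (w := z) h3

end LES

section Torsion

variable {R : Type} [CommRing R] (J : Ideal R) (M : Type) [AddCommGroup M] [Module R M]
  {N : Type} [AddCommGroup N] [Module R N]

/-- The submodule of elements annihilated by a power of an ideal. -/
def powTorsion : Submodule R M where
  carrier := {x | ∃ n, ∀ r ∈ J ^ n, r • x = 0}
  zero_mem' := ⟨0, fun r _ => smul_zero r⟩
  add_mem' := by
    rintro x y ⟨n, hn⟩ ⟨m, hm⟩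
    refine ⟨max n m, fun r hr => ?_⟩
    rw [smul_add, hn r (Ideal.pow_le_pow_right (le_max_left _ _) hr),
      hm r (Ideal.pow_le_pow_right (le_max_right _ _) hr), add_zero]
  smul_mem' := by
    rintro c x ⟨n, hn⟩
    exact ⟨n, fun r hr => by rw [smul_comm, hn r hr, smul_zero]⟩

variable {J M}

lemma cocycle_eq_of_paug {t : ℕ} {z : PX J t 0 →ₗ[R] M} (hz : z ∘ₗ pd J t 1 0 = 0)
    {y y' : PX J t 0} (h : paug J t y = paug J t y') : z y = z y' := by
  obtain ⟨u, hu⟩ := paug_exact t (x := y - y') (by rw [map_sub, h, sub_self])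
  have := LinearMap.congr_fun hz u
  rw [LinearMap.comp_apply, hu, map_sub] at this
  exact sub_eq_zero.1 this

lemma paug_plift {s t : ℕ} (h : t ≤ s) {y : PX J s 0} {r : R}
    (hy : paug J s y = Ideal.Quotient.mk _ r) :
    paug J t (plift J h 0 y) = Ideal.Quotient.mk _ r := by
  have h1 := congrArg ModuleCat.Hom.hom
    (ProjectiveResolution.lift_commutes_zero (quotPowMap J h) (powRes J s) (powRes J t))
  have h2 := LinearMap.congr_fun h1 y
  refine h2.trans ?_
  change (quotPowMap J h).hom (paug J s y) = _
  rw [hy]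
  rfl

lemma LC.exists_toModule : ∃ θ : LC J 0 M →ₗ[R] M, ∀ t (z : PX J t 0 →ₗ[R] M) h y,
    LcRep 0 t z h → paug J t y = Ideal.Quotient.mk _ (1 : R) → θ h = z y := by
  obtain ⟨θ, hθ⟩ := exists_linearMap_of_rel (R := R)
    (fun (h : LC J 0 M) (x : M) => ∃ t, ∃ (z : PX J t 0 →ₗ[R] M) (y : _),
      LcRep 0 t z h ∧ paug J t y = Ideal.Quotient.mk _ (1 : R) ∧ z y = x)
    (by
      intro h
      obtain ⟨t, z, hz⟩ := LcRep.exists_rep h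
      obtain ⟨y, hy⟩ := paug_surjective (J := J) t (Ideal.Quotient.mk _ (1 : R))
      exact ⟨z y, t, z, y, hz, hy, rfl⟩)
    (by
      rintro h x h' x' ⟨t, z, y, h1, h2, rfl⟩ ⟨t', z', y', h1', h2', rfl⟩
      obtain ⟨u, hu⟩ := paug_surjective (J := J) (max t t') (Ideal.Quotient.mk _ (1 : R))
      refine ⟨_, _, u, (h1.lift (le_max_left t t')).add (h1'.lift (le_max_right t t')), hu, ?_⟩
      rw [LinearMap.add_apply, LinearMap.comp_apply, LinearMap.comp_apply]
      congr 1
      · exact cocycle_eq_of_paug (h1.cocycle 1) ((paug_plift _ hu).trans h2.symm)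
      · exact cocycle_eq_of_paug (h1'.cocycle 1) ((paug_plift _ hu).trans h2'.symm))
    (by
      rintro r h x ⟨t, z, y, h1, h2, rfl⟩
      exact ⟨t, r • z, y, h1.smul r, h2, rfl⟩)
    (by
      rintro x ⟨t, z, y, h1, h2, rfl⟩
      obtain ⟨s, hs, w, hw⟩ := h1.exists_of_eq_zero rfl
      obtain ⟨u, hu⟩ := paug_surjective (J := J) s (Ideal.Quotient.mk _ (1 : R))
      rw [cocycle_eq_of_paug (h1.cocycle 1) (h2.trans (paug_plift hs hu).symm)]
      have := LinearMap.congr_fun hw u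
      simpa [pd_zero] using this)
  exact ⟨θ, fun t z h y h1 h2 => (hθ _ _).1 ⟨t, z, y, h1, h2, rfl⟩⟩

/-- The comparison of the zeroth local cohomology with the module. -/
noncomputable def LC.toModule : LC J 0 M →ₗ[R] M := LC.exists_toModule.choose

lemma LC.toModule_spec {t} {z : PX J t 0 →ₗ[R] M} {h y} (H : LcRep 0 t z h)
    (hy : paug J t y = Ideal.Quotient.mk _ 1) : LC.toModule h = z y :=
  LC.exists_toModule.choose_spec t z h y H hy

lemma LC.toModule_map (f : M →ₗ[R] N) (h : LC J 0 M) :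
    LC.toModule (LC.map J 0 f h) = f (LC.toModule h) := by
  obtain ⟨t, z, hz⟩ := LcRep.exists_rep h
  obtain ⟨y, hy⟩ := paug_surjective (J := J) t (Ideal.Quotient.mk _ (1 : R))
  rw [LC.toModule_spec hz hy, LC.toModule_spec (hz.map f) hy]
  rfl

lemma LC.toModule_injective : Function.Injective (LC.toModule : LC J 0 M →ₗ[R] M) := by
  rw [injective_iff_map_eq_zero]
  intro h h0
  obtain ⟨t, z, hz⟩ := LcRep.exists_rep h
  obtain ⟨y, hy⟩ := paug_surjective (J := J) t (Ideal.Quotient.mk _ (1 : R))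
  rw [LC.toModule_spec hz hy] at h0
  refine hz.eq_zero (w := 0) ?_
  ext x
  obtain ⟨r, hr⟩ := Ideal.Quotient.mk_surjective (paug J t x)
  have h1 : paug J t (r • y) = paug J t x := by
    rw [map_smul, hy, ← hr, ← mul_one r, map_mul, mul_one]
    rfl
  rw [← cocycle_eq_of_paug (hz.cocycle 1) h1, map_smul, h0, smul_zero]
  rfl

lemma LC.toModule_mem (h : LC J 0 M) : LC.toModule h ∈ powTorsion J M := by
  obtain ⟨n, hn⟩ := LC.torsion h
  exact ⟨n, fun r hr => by rw [← map_smul, hn r hr, map_zero]⟩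

lemma LC.exists_toModule_eq {x : M} (hx : x ∈ powTorsion J M) :
    ∃ h : LC J 0 M, LC.toModule h = x := by
  obtain ⟨n, hn⟩ := hx
  let f : (R ⧸ J ^ n) →ₗ[R] M := (J ^ n).liftQ (LinearMap.toSpanSingleton R M x) hn
  obtain ⟨h, hh⟩ := LcRep.of_cocycle (J := J) (i := 0) (t := n) (z := f ∘ₗ paug J n) (by
    ext u
    simp [paug_pd])
  obtain ⟨y, hy⟩ := paug_surjective (J := J) n (Ideal.Quotient.mk _ (1 : R))
  refine ⟨h, ?_⟩
  rw [LC.toModule_spec hh hy, LinearMap.comp_apply, hy]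
  exact one_smul R x

lemma LC.subsingleton_of_injective [Module.Injective R M] (i : ℕ) :
    Subsingleton (LC J (i + 1) M) := by
  refine subsingleton_of_forall_eq 0 fun h => ?_
  obtain ⟨t, z, hz⟩ := LcRep.exists_rep h
  let d := pd J t (i + 1) i
  have hk : LinearMap.ker d ≤ LinearMap.ker z := by
    intro x hx
    obtain ⟨y, rfl⟩ := pd_exact t i hx
    exact LinearMap.congr_fun (hz.cocycle (i + 2)) y
  obtain ⟨w, hw⟩ := Module.Injective.out (R := R) (Q := M) ((LinearMap.ker d).liftQ d le_rfl)
    (by rw [← LinearMap.ker_eq_bot, Submodule.ker_liftQ_eq_bot _ _ _ le_rfl])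
    ((LinearMap.ker d).liftQ z hk)
  refine hz.eq_zero (w := w) ?_
  ext x
  exact (hw (Submodule.Quotient.mk x)).symm

lemma powTorsion_injective [IsNoetherianRing R] [Module.Injective R M] :
    Module.Injective R (powTorsion J M) := by
  refine Module.Baer.injective fun I f => ?_
  obtain ⟨n, hn⟩ : ∃ n, ∀ r ∈ J ^ n, ∀ x, r • f x = 0 := by
    obtain ⟨S, hS⟩ : (⊤ : Submodule R I).FG := Module.Finite.fg_top
    choose n hn using fun x : I => (f x).2
    refine ⟨S.sup n, fun r hr => ?_⟩
    have : (⊤ : Submodule R I) ≤ LinearMap.ker (r • f) := by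
      rw [← hS, Submodule.span_le]
      intro x hx
      exact Subtype.ext (hn x r (Ideal.pow_le_pow_right (Finset.le_sup hx) hr))
    exact fun x => this (Submodule.mem_top (x := x))
  obtain ⟨k, hk⟩ := Ideal.exists_pow_inf_eq_pow_smul J (I : Submodule R R)
  have hle : J ^ (n + k) ⊓ I ≤ J ^ n * I := by
    have := hk (n + k) (Nat.le_add_left _ _)
    rw [Nat.add_sub_cancel, smul_eq_mul, Ideal.mul_top] at this
    rw [this]
    exact Ideal.mul_mono_right inf_le_right
  let L : Submodule R I := Submodule.comap I.subtype (J ^ (n + k))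
  have hL : L ≤ LinearMap.ker ((powTorsion J M).subtype ∘ₗ f) := by
    rintro ⟨x, hx⟩ hxL
    have hx2 : x ∈ J ^ n * I := hle ⟨hxL, hx⟩
    have : J ^ n * I ≤ Submodule.map I.subtype (LinearMap.ker f) := by
      rw [Ideal.mul_le]
      intro r hr y hy
      exact ⟨r • ⟨y, hy⟩, (map_smul f r ⟨y, hy⟩).trans (hn r hr _), rfl⟩
    obtain ⟨y, hy, hyx⟩ := this hx2
    have : y = ⟨x, hx⟩ := Subtype.ext hyx
    rw [← this]
    have h0 : f y = 0 := hy
    simp [h0]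
  obtain ⟨g, hg⟩ := Module.Injective.out (R := R) (Q := M)
    (Submodule.mapQ L (J ^ (n + k)) I.subtype le_rfl)
    (by
      rw [← LinearMap.ker_eq_bot, Submodule.mapQ, Submodule.ker_liftQ_eq_bot]
      rw [LinearMap.ker_comp, Submodule.ker_mkQ]) (L.liftQ _ hL)
  have hmem : ∀ r : R, g (Submodule.Quotient.mk r) ∈ powTorsion J M := by
    intro r
    refine ⟨n + k, fun s hs => ?_⟩
    rw [← map_smul, ← Submodule.Quotient.mk_smul, (Submodule.Quotient.mk_eq_zero _).2, map_zero]
    exact Ideal.mul_mem_right _ _ hs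
  refine ⟨(g ∘ₗ Submodule.mkQ _).codRestrict _ hmem, fun x hx => Subtype.ext ?_⟩
  exact hg (Submodule.Quotient.mk ⟨x, hx⟩)

lemma exists_injective_embedding (K : Type) [AddCommGroup K] [Module R K] :
    ∃ (E : Type) (_ : AddCommGroup E) (_ : Module R E) (_ : Module.Injective R E)
      (f : K →ₗ[R] E), Function.Injective f := by
  obtain ⟨E, hE, f, hf⟩ := EnoughInjectives.presentation (ModuleCat.of R K)
  exact ⟨E, inferInstance, inferInstance, (Module.injective_iff_injective_object R E).2 hE, f.hom,
    (ModuleCat.mono_iff_injective f).1 hf⟩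

/-- Torsion modules have no higher local cohomology. -/
theorem LC.subsingleton_of_torsion [IsNoetherianRing R] (i : ℕ) :
    ∀ (K : Type) [AddCommGroup K] [Module R K], powTorsion J K = ⊤ →
      Subsingleton (LC J (i + 1) K) := by
  have main : ∀ (K : Type) [AddCommGroup K] [Module R K], powTorsion J K = ⊤ →
      ∃ (E Q : Type) (_ : AddCommGroup E) (_ : Module R E) (_ : AddCommGroup Q) (_ : Module R Q)
        (f : K →ₗ[R] E) (g : E →ₗ[R] Q), Function.Injective f ∧ Function.Surjective g ∧
        Function.Exact f g ∧ powTorsion J E = ⊤ ∧ powTorsion J Q = ⊤ ∧ Module.Injective R E := by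
    intro K _ _ hK
    obtain ⟨E, _, _, _, f, hf⟩ := exists_injective_embedding (R := R) K
    have hf' : ∀ x, f x ∈ powTorsion J E := by
      intro x
      obtain ⟨n, hn⟩ : x ∈ powTorsion J K := hK ▸ Submodule.mem_top
      exact ⟨n, fun r hr => by rw [← map_smul, hn r hr, map_zero]⟩
    let f' : K →ₗ[R] powTorsion J E := f.codRestrict _ hf'
    have htop : ∀ x : powTorsion J E, ∃ n, ∀ r ∈ J ^ n, r • x = 0 := fun x => by
      obtain ⟨n, hn⟩ := x.2
      exact ⟨n, fun r hr => Subtype.ext (hn r hr)⟩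
    refine ⟨powTorsion J E, powTorsion J E ⧸ LinearMap.range f', inferInstance, inferInstance,
      inferInstance, inferInstance, f', Submodule.mkQ _, ?_, Submodule.mkQ_surjective _,
      LinearMap.exact_map_mkQ_range _, ?_, ?_, powTorsion_injective⟩
    · intro x y hxy
      exact hf (congrArg Subtype.val hxy)
    · rw [eq_top_iff]
      exact fun x _ => htop x
    · rw [eq_top_iff]
      intro x _
      obtain ⟨x, rfl⟩ := Submodule.mkQ_surjective _ x
      obtain ⟨n, hn⟩ := htop x
      exact ⟨n, fun r hr => by rw [← map_smul, hn r hr, map_zero]⟩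
  induction i with
  | zero =>
    intro K _ _ hK
    obtain ⟨E, Q, _, _, _, _, f, g, hf, hg, hfg, hE, hQ, _⟩ := main K hK
    obtain ⟨-, δ, h1, h2⟩ := LC.exists_delta (J := J) hf hg hfg 0
    refine subsingleton_of_forall_eq 0 fun x => ?_
    have := LC.subsingleton_of_injective (J := J) (M := E) 0
    obtain ⟨q, rfl⟩ := (h2 x).1 (Subsingleton.elim _ _)
    obtain ⟨e, he⟩ := hg (LC.toModule q)
    obtain ⟨y, rfl⟩ := LC.exists_toModule_eq (J := J) (x := e) (hE ▸ Submodule.mem_top)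
    rw [← LC.toModule_map] at he
    exact (h1 q).2 ⟨y, LC.toModule_injective he⟩
  | succ i ih =>
    intro K _ _ hK
    obtain ⟨E, Q, _, _, _, _, f, g, hf, hg, hfg, hE, hQ, _⟩ := main K hK
    obtain ⟨-, δ, h1, h2⟩ := LC.exists_delta (J := J) hf hg hfg (i + 1)
    refine subsingleton_of_forall_eq 0 fun x => ?_
    have := LC.subsingleton_of_injective (J := J) (M := E) (i + 1)
    have := ih Q hQ
    obtain ⟨q, rfl⟩ := (h2 x).1 (Subsingleton.elim _ _)
    rw [Subsingleton.elim q 0, map_zero]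

/-- If an element of `J` acts injectively on local cohomology, then the latter vanishes. -/
theorem LC.subsingleton_of_smul_injective {x : R} (hx : x ∈ J) {i : ℕ}
    (hinj : ∀ h : LC J i M, x • h = 0 → h = 0) : Subsingleton (LC J i M) := by
  refine subsingleton_of_forall_eq 0 fun h => ?_
  obtain ⟨n, hn⟩ := LC.torsion h
  have h1 := hn (x ^ n) (Ideal.pow_mem_pow hx n)
  clear hn
  induction n with
  | zero => simpa using h1
  | succ n ih =>
    apply ih
    rw [pow_succ', mul_smul] at h1
    exact hinj _ h1

/-- If an element of `J` acts bijectively, then local cohomology vanishes. -/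
theorem LC.subsingleton_of_bijective {x : R} (hx : x ∈ J)
    (hb : Function.Bijective fun m : M => x • m) (i : ℕ) : Subsingleton (LC J i M) := by
  let e : M ≃ₗ[R] M := LinearEquiv.ofBijective (LinearMap.lsmul R M x) hb
  refine LC.subsingleton_of_smul_injective hx fun h h0 => ?_
  have he : (e : M →ₗ[R] M) = x • LinearMap.id := by
    ext m
    rfl
  refine (LC.congr (J := J) (i := i) e).map_eq_zero_iff.1 (Eq.trans ?_ h0)
  change LC.map J i (e : M →ₗ[R] M) h = x • h
  rw [he, LC.map_smul_id, LC.map_id]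
  rfl

end Torsion

section FiniteLength

variable {R : Type} [CommRing R] {J : Ideal R}

lemma isArtinian_of_pow_smul_eq_zero [IsNoetherianRing R] (hJ : J.IsMaximal) (N : ℕ) :
    ∀ (M : Type) [AddCommGroup M] [Module R M] [Module.Finite R M],
      (∀ r ∈ J ^ N, ∀ x : M, r • x = 0) → IsArtinian R M := by
  induction N with
  | zero =>
    intro M _ _ _ h
    have : Subsingleton M := subsingleton_of_forall_eq 0 fun x => by
      simpa using h 1 (by simp) x
    infer_instance
  | succ N ih =>
    intro M _ _ _ h
    have h1 : IsArtinian R (J • (⊤ : Submodule R M) : Submodule R M) := by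
      refine ih _ fun r hr ⟨x, hx⟩ => Subtype.ext ?_
      change r • x = 0
      refine Submodule.smul_induction_on hx ?_ ?_
      · intro s hs m _
        rw [smul_smul]
        exact h _ (by rw [pow_succ]; exact Ideal.mul_mem_mul hr hs) _
      · intro x y hx hy
        rw [smul_add, hx, hy, add_zero]
    have h2 : IsArtinian R (M ⧸ (J • (⊤ : Submodule R M))) := by
      let _ : Field (R ⧸ J) := Ideal.Quotient.field J
      let _ : Module (R ⧸ J) (M ⧸ (J • (⊤ : Submodule R M))) :=
        Module.instQuotientIdealSubmoduleHSMulTop M J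
      have : IsScalarTower R (R ⧸ J) (M ⧸ (J • (⊤ : Submodule R M))) := inferInstance
      have : Module.Finite (R ⧸ J) (M ⧸ (J • (⊤ : Submodule R M))) :=
        Module.Finite.of_restrictScalars_finite R _ _
      have : IsArtinian (R ⧸ J) (M ⧸ (J • (⊤ : Submodule R M))) := inferInstance
      exact isArtinian_of_surjective_algebraMap (S := R) (R := R ⧸ J) Ideal.Quotient.mk_surjective
    exact isArtinian_of_range_eq_ker (J • (⊤ : Submodule R M)).subtype
      (J • (⊤ : Submodule R M)).mkQ (by rw [Submodule.range_subtype, Submodule.ker_mkQ])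

lemma LC.map_mkQ_powTorsion_bijective [IsNoetherianRing R] (M : Type) [AddCommGroup M] [Module R M]
    (i : ℕ) : Function.Bijective (LC.map J (i + 1) (powTorsion J M).mkQ) := by
  have htor : powTorsion J (powTorsion J M) = ⊤ := by
    rw [eq_top_iff]
    rintro ⟨x, n, hn⟩ -
    exact ⟨n, fun r hr => Subtype.ext (hn r hr)⟩
  have hs := fun i => LC.subsingleton_of_torsion (J := J) i _ htor
  obtain ⟨h1, δ, h2, h3⟩ := LC.exists_delta (J := J) (powTorsion J M).subtype_injective
    (powTorsion J M).mkQ_surjective (LinearMap.exact_subtype_mkQ _) (i + 1)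
  constructor
  · rw [injective_iff_map_eq_zero]
    intro x hx
    obtain ⟨y, rfl⟩ := (h1 x).1 hx
    have := hs i
    rw [Subsingleton.elim y 0, map_zero]
  · intro y
    have := hs (i + 1)
    exact (h2 y).1 (Subsingleton.elim _ _)

lemma powTorsion_quotient (J : Ideal R) [IsNoetherianRing R] (M : Type) [AddCommGroup M] [Module R M] :
    powTorsion J (M ⧸ powTorsion J M) = ⊥ := by
  rw [eq_bot_iff]
  intro x hx
  obtain ⟨n, hn⟩ := hx
  obtain ⟨x, rfl⟩ := (powTorsion J M).mkQ_surjective x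
  have h1 : ∀ r ∈ J ^ n, ∃ m, ∀ s ∈ J ^ m, s • r • x = 0 := by
    intro r hr
    have := hn r hr
    rw [← map_smul, Submodule.mkQ_apply, Submodule.Quotient.mk_eq_zero] at this
    exact this
  have h2 : ∀ I : Ideal R, I ≤ J ^ n → I.FG → ∃ m, ∀ s ∈ J ^ m, ∀ r ∈ I, s • r • x = 0 := by
    intro I hI hfg
    revert hI
    refine Submodule.fg_induction (motive := fun I _ => I ≤ J ^ n → ∃ m, ∀ s ∈ J ^ m, ∀ r ∈ I, s • r • x = 0)
      ?_ ?_ I hfg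
    · intro a ha
      obtain ⟨m, hm⟩ := h1 a (ha (Submodule.mem_span_singleton_self a))
      refine ⟨m, fun s hs r hr => ?_⟩
      obtain ⟨c, rfl⟩ := Submodule.mem_span_singleton.1 hr
      rw [smul_assoc, smul_comm, hm s hs, smul_zero]
    · intro I₁ I₂ _ _ h₁ h₂ hle
      obtain ⟨m₁, hm₁⟩ := h₁ (le_sup_left.trans hle)
      obtain ⟨m₂, hm₂⟩ := h₂ (le_sup_right.trans hle)
      refine ⟨max m₁ m₂, fun s hs r hr => ?_⟩
      obtain ⟨a, ha, b, hb, rfl⟩ := Submodule.mem_sup.1 hr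
      rw [add_smul, smul_add, hm₁ s (Ideal.pow_le_pow_right (le_max_left _ _) hs) a ha,
        hm₂ s (Ideal.pow_le_pow_right (le_max_right _ _) hs) b hb, add_zero]
  obtain ⟨m, hm⟩ := h2 _ le_rfl (IsNoetherian.noetherian _)
  rw [Submodule.mem_bot, Submodule.mkQ_apply, Submodule.Quotient.mk_eq_zero]
  refine ⟨m + n, fun r hr => ?_⟩
  rw [pow_add] at hr
  refine Submodule.mul_induction_on hr ?_ ?_
  · intro s hs r hr
    rw [mul_smul, hm s hs r hr]
  · intro a b ha hb
    rw [add_smul, ha, hb, add_zero]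

lemma exists_regular_mem_pow [IsNoetherianRing R] {M : Type} [AddCommGroup M] [Module R M]
    [Module.Finite R M] (h : powTorsion J M = ⊥) (N : ℕ) :
    ∃ y ∈ J ^ N, ∀ x : M, y • x = 0 → x = 0 := by
  by_contra! hcon
  have hfin := associatedPrimes.finite R M
  have hsub : ((J ^ N : Ideal R) : Set R) ⊆ ⋃ p ∈ (↑hfin.toFinset : Set (Ideal R)), (id p : Ideal R) := by
    intro y hy
    obtain ⟨x, hx, hx0⟩ := hcon y hy
    simp only [id]
    rw [Set.Finite.coe_toFinset, biUnion_associatedPrimes_eq_zero_divisors R M]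
    exact ⟨x, hx0, hx⟩
  have h3 := (Ideal.subset_union_prime (f := id) ⊤ ⊤ (fun p hp _ _ =>
    (hfin.mem_toFinset.1 hp).isPrime)).1 hsub
  obtain ⟨p, hp, hle⟩ := h3
  obtain ⟨hpr, x, rfl⟩ := (isAssociatedPrime_iff (R := R)).1 (hfin.mem_toFinset.1 hp)
  have hx : x ∈ powTorsion J M :=
    ⟨N, fun r hr => by simpa using hle hr⟩
  rw [h, Submodule.mem_bot] at hx
  apply hpr.ne_top
  rw [Ideal.eq_top_iff_one, Submodule.mem_colon_singleton, hx, smul_zero]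
  exact Submodule.zero_mem _

theorem LC.isFiniteLength [IsNoetherianRing R] (hJ : J.IsMaximal) (i : ℕ) :
    ∀ (N : ℕ) (M : Type) [AddCommGroup M] [Module R M] [Module.Finite R M],
      (∀ j ≤ i, ∀ r ∈ J ^ N, ∀ h : LC J j M, r • h = 0) → IsFiniteLength R (LC J i M) := by
  induction i with
  | zero =>
    intro N M _ _ _ h
    have : Module.Finite R (LC J 0 M) := Module.Finite.of_injective _ LC.toModule_injective
    exact isFiniteLength_iff_isNoetherian_isArtinian.2
      ⟨inferInstance, isArtinian_of_pow_smul_eq_zero hJ N _ (h 0 le_rfl)⟩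
  | succ i ih =>
    intro N M _ _ _ h
    set Q := M ⧸ powTorsion J M
    have hQ : ∀ j ≤ i + 1, ∀ r ∈ J ^ N, ∀ h : LC J j Q, r • h = 0 := by
      intro j hj r hr x
      cases j with
      | zero =>
        have : x = 0 := by
          apply LC.toModule_injective
          have := LC.toModule_mem x
          rw [powTorsion_quotient] at this
          rw [(Submodule.mem_bot R).1 this, map_zero]
        rw [this, smul_zero]
      | succ j =>
        obtain ⟨y, rfl⟩ := (LC.map_mkQ_powTorsion_bijective M j).2 x
        rw [← map_smul, h _ hj r hr, map_zero]
    obtain ⟨y, hy, hreg⟩ := exists_regular_mem_pow (powTorsion_quotient J M) N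
    let f : Q →ₗ[R] Q := LinearMap.lsmul R Q y
    have hf : Function.Injective f := by
      rw [injective_iff_map_eq_zero]
      exact hreg
    have hfz : ∀ j ≤ i + 1, ∀ x, LC.map J j f x = 0 := by
      intro j hj x
      have : f = y • LinearMap.id := by
        ext
        rfl
      rw [this, LC.map_smul_id, LC.map_id]
      exact hQ j hj y hy x
    have hδ := fun j => LC.exists_delta (J := J) hf (Submodule.mkQ_surjective _)
      (LinearMap.exact_map_mkQ_range f) j
    obtain ⟨-, δ, -, h3⟩ := hδ i
    have hsurj : Function.Surjective δ := fun x => (h3 x).1 (hfz _ le_rfl x)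
    have hlen : IsFiniteLength R (LC J i (Q ⧸ LinearMap.range f)) := by
      refine ih (N + N) _ fun j hj r hr x => ?_
      obtain ⟨-, δ, h2, -⟩ := hδ j
      rw [pow_add] at hr
      refine Submodule.mul_induction_on hr ?_ ?_
      · intro s hs r hr
        have : δ (r • x) = 0 := by
          rw [map_smul, hQ _ (by omega) r hr]
        obtain ⟨z, hz⟩ := (h2 _).1 this
        refine (mul_smul s r x).trans ?_
        rw [← hz, ← map_smul, hQ j (by omega) s hs, map_zero]
      · intro a b ha hb
        rw [add_smul, ha, hb, add_zero]
    have := hlen.of_surjective hsurj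
    exact (LinearEquiv.ofBijective _ (LC.map_mkQ_powTorsion_bijective (J := J) M i)).symm.isFiniteLength this

/-- A local cohomology module of finite length is annihilated by a power of the ideal. -/
lemma LC.exists_pow_smul_eq_zero {M : Type} [AddCommGroup M] [Module R M] {i : ℕ}
    (h : IsFiniteLength R (LC J i M)) : ∃ N, ∀ r ∈ J ^ N, ∀ x : LC J i M, r • x = 0 := by
  have hn := (isFiniteLength_iff_isNoetherian_isArtinian.1 h).1
  have : ∀ P : Submodule R (LC J i M), P.FG → ∃ N, ∀ r ∈ J ^ N, ∀ x ∈ P, r • x = 0 := by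
    intro P hP
    refine Submodule.fg_induction (motive := fun P _ => ∃ N, ∀ r ∈ J ^ N, ∀ x ∈ P, r • x = 0) ?_ ?_ P hP
    · intro a
      obtain ⟨m, hm⟩ := LC.torsion a
      refine ⟨m, fun s hs r hr => ?_⟩
      obtain ⟨c, rfl⟩ := Submodule.mem_span_singleton.1 hr
      rw [smul_comm, hm s hs, smul_zero]
    · rintro I₁ I₂ _ _ ⟨m₁, hm₁⟩ ⟨m₂, hm₂⟩
      refine ⟨max m₁ m₂, fun s hs r hr => ?_⟩
      obtain ⟨a, ha, b, hb, rfl⟩ := Submodule.mem_sup.1 hr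
      rw [smul_add, hm₁ s (Ideal.pow_le_pow_right (le_max_left _ _) hs) a ha,
        hm₂ s (Ideal.pow_le_pow_right (le_max_right _ _) hs) b hb, add_zero]
  obtain ⟨N, hN⟩ := this ⊤ (hn.noetherian ⊤)
  exact ⟨N, fun r hr x => hN r hr x Submodule.mem_top⟩

end FiniteLength

section DegreeModule

open Classical in
/-- Translation by `c` of a function on exponents, cut off outside `E`. -/
noncomputable def cutShift {k : Type} [Field k] {V : Type} (E : Set (V → ℤ)) (c : V → ℤ) :
    ((V → ℤ) → k) →ₗ[k] ((V → ℤ) → k) where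
  toFun f a := if a ∈ E then f (a - c) else 0
  map_add' f g := by
    funext a
    by_cases h : a ∈ E <;> simp [h]
  map_smul' r f := by
    funext a
    by_cases h : a ∈ E <;> simp [h]

/-- Finitely supported functions with support in a given set of exponents. -/
def finSuppIn (k : Type) [Field k] {V : Type} (E : Set (V → ℤ)) : Submodule k ((V → ℤ) → k) where
  carrier := {f | (Function.support f).Finite ∧ Function.support f ⊆ E}
  zero_mem' := by simp
  add_mem' {f g} hf hg := ⟨(hf.1.union hg.1).subset (Function.support_add f g),
    (Function.support_add f g).trans (Set.union_subset hf.2 hg.2)⟩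
  smul_mem' r f hf := ⟨hf.1.subset (Function.support_const_smul_subset r f),
    (Function.support_const_smul_subset r f).trans hf.2⟩

variable (k : Type) [Field k] {V : Type}

lemma cutShift_mem {E : Set (V → ℤ)} (E' : Set (V → ℤ)) (c : V → ℤ) {f : (V → ℤ) → k}
    (hf : f ∈ finSuppIn k E) : cutShift E' c f ∈ finSuppIn k E' := by
  constructor
  · refine (hf.1.image (· + c)).subset fun a ha => ⟨a - c, ?_, sub_add_cancel a c⟩
    intro h
    apply ha
    simp only [cutShift, LinearMap.coe_mk, AddHom.coe_mk]
    simp [h]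
  · intro a ha
    by_contra h
    exact ha (if_neg h)

/-- The module with basis a convex set of exponents, on which variables act by translation. -/
def DM (E : {E : Set (V → ℤ) // E.OrdConnected}) : Type := finSuppIn k E.1

variable {k} {E E' E'' : {E : Set (V → ℤ) // E.OrdConnected}}

noncomputable instance : AddCommGroup (DM k E) := inferInstanceAs (AddCommGroup (finSuppIn k E.1))

noncomputable instance : Module k (DM k E) := inferInstanceAs (Module k (finSuppIn k E.1))

/-- Coefficients of an element of a degree module. -/
def DM.co (x : DM k E) : (V → ℤ) → k := x.1

@[ext] lemma DM.ext {x y : DM k E} (h : ∀ a, x.co a = y.co a) : x = y := Subtype.ext (funext h)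

lemma DM.co_of_notMem (x : DM k E) {a : V → ℤ} (ha : a ∉ E.1) : x.co a = 0 := by
  by_contra h
  exact ha (x.2.2 h)

lemma DM.mem_of_co {x : DM k E} {a : V → ℤ} (ha : x.co a ≠ 0) : a ∈ E.1 := x.2.2 ha

@[simp] lemma DM.co_zero (a : V → ℤ) : (0 : DM k E).co a = 0 := rfl

@[simp] lemma DM.co_ksmul (r : k) (x : DM k E) (a : V → ℤ) : (r • x).co a = r * x.co a := rfl

/-- Coefficients as linear maps. -/
def DM.coL (a : V → ℤ) : DM k E →ₗ[k] k where
  toFun x := x.co a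
  map_add' _ _ := rfl
  map_smul' _ _ := rfl

/-- Cut off translation between degree modules, as a map of vector spaces. -/
noncomputable def DM.shift (E E' : {E : Set (V → ℤ) // E.OrdConnected}) (c : V → ℤ) :
    DM k E →ₗ[k] DM k E' :=
  LinearMap.restrict (cutShift E'.1 c) fun _ hf => cutShift_mem k E'.1 c hf

open Classical in
lemma DM.co_shift (c : V → ℤ) (x : DM k E) (a : V → ℤ) :
    (DM.shift E E' c x).co a = if a ∈ E'.1 then x.co (a - c) else 0 := rfl

/-- Exponents as integer vectors. -/
def expZ (b : V →₀ ℕ) : V → ℤ := fun v => b v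

lemma expZ_nonneg (b : V →₀ ℕ) : 0 ≤ expZ b := fun v => Int.natCast_nonneg (b v)

lemma expZ_add (b c : V →₀ ℕ) : expZ (b + c) = expZ b + expZ c := by
  funext v
  simp [expZ]

@[simp] lemma expZ_zero : expZ (0 : V →₀ ℕ) = 0 := rfl

lemma expZ_injective : Function.Injective (expZ : (V →₀ ℕ) → V → ℤ) := by
  intro b c h
  ext v
  exact Int.ofNat_injective (congrFun h v)

lemma exists_expZ [Finite V] {a : V → ℤ} (ha : 0 ≤ a) : ∃ b, expZ b = a :=
  ⟨Finsupp.equivFunOnFinite.symm fun v => (a v).toNat,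
    funext fun v => Int.toNat_of_nonneg (ha v)⟩

lemma DM.shift_comp {b c : V → ℤ} (hc : ∀ a ∈ E''.1, a - b - c ∈ E.1 → a - b ∈ E'.1)
    (x : DM k E) :
    DM.shift E' E'' b (DM.shift E E' c x) = DM.shift E E'' (c + b) x := by
  ext a
  simp only [DM.co_shift]
  have : a - (c + b) = a - b - c := by abel
  rw [this]
  by_cases h : a ∈ E''.1 <;> by_cases h' : a - b ∈ E'.1 <;> simp only [h, h', if_true, if_false]
  exact (x.co_of_notMem fun h2 => h' (hc a h h2)).symm

/-- The action of monomials on a degree module. -/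
noncomputable def DM.monAct (E : {E : Set (V → ℤ) // E.OrdConnected}) :
    Multiplicative (V →₀ ℕ) →* Module.End k (DM k E) where
  toFun b := DM.shift E E (expZ b.toAdd)
  map_one' := by
    ext x a
    rw [DM.co_shift]
    simp only [toAdd_one, expZ_zero, sub_zero, Module.End.one_apply, ite_eq_left_iff]
    exact fun h => (x.co_of_notMem h).symm
  map_mul' b c := by
    apply LinearMap.ext
    intro x
    rw [Module.End.mul_apply, DM.shift_comp]
    · rw [toAdd_mul, expZ_add, add_comm]
    · intro a ha h
      refine E.2.out h ha ⟨sub_le_self _ (expZ_nonneg _), sub_le_self _ (expZ_nonneg _)⟩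

/-- The action of the polynomial ring on a degree module. -/
noncomputable def DM.act (E : {E : Set (V → ℤ) // E.OrdConnected}) :
    MvPolynomial V k →ₐ[k] Module.End k (DM k E) :=
  AddMonoidAlgebra.lift k _ _ (DM.monAct E)

noncomputable instance : Module (MvPolynomial V k) (DM k E) :=
  Module.compHom (DM k E) (DM.act E : MvPolynomial V k →ₐ[k] Module.End k (DM k E)).toRingHom

lemma DM.smul_def (p : MvPolynomial V k) (x : DM k E) : p • x = DM.act E p x := rfl

lemma DM.monomial_smul (b : V →₀ ℕ) (r : k) (x : DM k E) :
    (monomial b r) • x = r • DM.shift E E (expZ b) x := by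
  rw [DM.smul_def, DM.act]
  have := AddMonoidAlgebra.lift_single (R := k) (DM.monAct (k := k) E) b r
  exact congrArg (fun φ : Module.End k (DM k E) => φ x) this

open Classical in
lemma DM.co_monomial_smul (b : V →₀ ℕ) (r : k) (x : DM k E) (a : V → ℤ) :
    ((monomial b r : MvPolynomial V k) • x).co a =
      r * if a ∈ E.1 then x.co (a - expZ b) else 0 := by
  rw [DM.monomial_smul, DM.co_ksmul, DM.co_shift]

/-- A linear map of degree modules from a map of vector spaces commuting with translations. -/
noncomputable def DM.mkLinear {M N : Type} [AddCommGroup M] [Module k M] [Module (MvPolynomial V k) M]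
    [AddCommGroup N] [Module k N] [Module (MvPolynomial V k) N]
    (φ : M →ₗ[k] N)
    (h : ∀ (b : V →₀ ℕ) (r : k) (x : M), φ ((monomial b r : MvPolynomial V k) • x) = (monomial b r : MvPolynomial V k) • φ x) :
    M →ₗ[MvPolynomial V k] N where
  toFun := φ
  map_add' := φ.map_add
  map_smul' p x := by
    rw [RingHom.id_apply]
    induction p using MvPolynomial.induction_on' with
    | monomial b r => exact h b r x
    | add p q hp hq => rw [add_smul, add_smul, map_add, hp, hq]

/-- The linear map of degree modules `e_a ↦ e_{a+c}` (or zero). -/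
noncomputable def DM.hom (E E' : {E : Set (V → ℤ) // E.OrdConnected}) (c : V → ℤ)
    (h : ∀ a ∈ E'.1, ∀ b, 0 ≤ b → a - b - c ∈ E.1 → (a - c ∈ E.1 ↔ a - b ∈ E'.1)) :
    DM k E →ₗ[MvPolynomial V k] DM k E' :=
  DM.mkLinear (DM.shift E E' c) (fun b r x => by
    rw [DM.monomial_smul, DM.monomial_smul, map_smul]
    congr 1
    ext a
    simp only [DM.co_shift]
    have h1 := fun h' => h a h' (expZ b) (expZ_nonneg b)
    have h2 : a - c - expZ b = a - expZ b - c := by abel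
    rw [h2]
    by_cases h3 : a ∈ E'.1
    · by_cases h4 : a - expZ b - c ∈ E.1
      · have h5 := h1 h3 h4
        by_cases h6 : a - c ∈ E.1
        · rw [if_pos h6, if_pos (h5.1 h6)]
        · rw [if_neg h6, if_neg (h5.not.1 h6)]
      · simp [x.co_of_notMem h4]
    · simp [h3])

open Classical in
lemma DM.co_hom {c : V → ℤ}
    {h : ∀ a ∈ E'.1, ∀ b, 0 ≤ b → a - b - c ∈ E.1 → (a - c ∈ E.1 ↔ a - b ∈ E'.1)} (x : DM k E)
    (a : V → ℤ) : (DM.hom E E' c h x).co a = if a ∈ E'.1 then x.co (a - c) else 0 := rfl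

open Classical in
/-- The basis vector of a degree module (zero if the exponent is not allowed). -/
noncomputable def DM.single (E : {E : Set (V → ℤ) // E.OrdConnected}) (a : V → ℤ) : DM k E :=
  ⟨fun a' => if a' = a ∧ a ∈ E.1 then 1 else 0, by
    constructor
    · refine (Set.finite_singleton a).subset fun a' h => ?_
      by_contra hne
      exact h (if_neg fun h => hne h.1)
    · intro a' h
      by_contra hne
      exact h (if_neg fun ⟨h1, h2⟩ => hne (h1 ▸ h2))⟩

open Classical in
lemma DM.co_single (a a' : V → ℤ) :
    (DM.single E a : DM k E).co a' = if a' = a ∧ a ∈ E.1 then 1 else 0 := rfl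

end DegreeModule

section Vanishing

variable {R : Type} [CommRing R] {J : Ideal R}

/-- Vanishing of local cohomology below degree `r`. -/
def Van (J : Ideal R) (r : ℕ) (M : Type) [AddCommGroup M] [Module R M] : Prop :=
  ∀ i < r, Subsingleton (LC J i M)

variable {A B C : Type} [AddCommGroup A] [Module R A] [AddCommGroup B] [Module R B]
  [AddCommGroup C] [Module R C]

lemma Van.mono {r s : ℕ} (h : Van J s A) (hrs : r ≤ s) : Van J r A :=
  fun i hi => h i (hi.trans_le hrs)

lemma Van.congr {r : ℕ} (h : Van J r A) (e : A ≃ₗ[R] B) : Van J r B := fun i hi => by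
  have := h i hi
  exact (LC.congr (J := J) (i := i) e).symm.injective.subsingleton

lemma Van.mid {f : A →ₗ[R] B} {g : B →ₗ[R] C} (hf : Function.Injective f)
    (hg : Function.Surjective g) (hfg : Function.Exact f g) {r : ℕ} (hA : Van J r A)
    (hC : Van J r C) : Van J r B := by
  intro i hi
  have := hA i hi
  have := hC i hi
  obtain ⟨h, -⟩ := LC.exists_delta (J := J) hf hg hfg i
  refine subsingleton_of_forall_eq 0 fun x => ?_
  obtain ⟨y, rfl⟩ := (h x).1 (Subsingleton.elim _ _)
  rw [Subsingleton.elim y 0, map_zero]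

lemma Van.left {f : A →ₗ[R] B} {g : B →ₗ[R] C} (hf : Function.Injective f)
    (hg : Function.Surjective g) (hfg : Function.Exact f g) {r : ℕ} (hB : Van J (r + 1) B)
    (hC : Van J r C) : Van J (r + 1) A := by
  intro i hi
  have := hB i hi
  cases i with
  | zero => exact (LC.map_zero_injective (J := J) hf).subsingleton
  | succ i =>
    obtain ⟨-, δ, -, h⟩ := LC.exists_delta (J := J) hf hg hfg i
    refine subsingleton_of_forall_eq 0 fun x => ?_
    obtain ⟨y, rfl⟩ := (h x).1 (Subsingleton.elim _ _)
    have := hC i (by omega)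
    rw [Subsingleton.elim y 0, map_zero]

lemma Van.of_regular {x : R} (hx : x ∈ J) {f : A →ₗ[R] A} {g : A →ₗ[R] B}
    (hfx : ∀ a, f a = x • a) (hf : Function.Injective f)
    (hg : Function.Surjective g) (hfg : Function.Exact f g) {r : ℕ} (hB : Van J r B) :
    Van J (r + 1) A := by
  intro i hi
  refine LC.subsingleton_of_smul_injective hx ?_
  have hfx : f = x • LinearMap.id := LinearMap.ext hfx
  have key : Function.Injective (LC.map J i f) := by
    cases i with
    | zero => exact LC.map_zero_injective (J := J) hf
    | succ i =>
      obtain ⟨-, δ, -, h⟩ := LC.exists_delta (J := J) hf hg hfg i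
      rw [injective_iff_map_eq_zero]
      intro y hy
      obtain ⟨z, rfl⟩ := (h y).1 hy
      have := hB i (by omega)
      rw [Subsingleton.elim z 0, map_zero]
  rw [hfx, LC.map_smul_id, LC.map_id] at key
  exact fun h h0 => key (h0.trans (map_zero _).symm)

end Vanishing

section DegreeModuleMaps

variable {k : Type} [Field k] {V : Type} {E E' E₁ E₂ : {E : Set (V → ℤ) // E.OrdConnected}}

/-- The short exact sequence of degree modules attached to an upper subset of exponents. -/
lemma DM.exists_ses (hE : ∀ a, a ∈ E.1 ↔ a ∈ E₁.1 ∨ a ∈ E₂.1) (hd : ∀ a ∈ E₁.1, a ∉ E₂.1)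
    (hup : ∀ a ∈ E₂.1, ∀ b ∈ E₁.1, ¬ a ≤ b) :
    ∃ (f : DM k E₂ →ₗ[MvPolynomial V k] DM k E) (g : DM k E →ₗ[MvPolynomial V k] DM k E₁),
      Function.Injective f ∧ Function.Surjective g ∧ Function.Exact f g ∧
        ∀ x, ∀ a ∈ E₁.1, (g x).co a = x.co a := by
  have hle : ∀ a b : V → ℤ, 0 ≤ b → a - b ≤ a := fun a b hb => sub_le_self a hb
  refine ⟨DM.hom E₂ E 0 ?_, DM.hom E E₁ 0 ?_, ?_, ?_, ?_, ?_⟩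
  · intro a ha b hb h
    rw [sub_zero] at h ⊢
    refine ⟨fun _ => (hE _).2 (Or.inr h), fun _ => ?_⟩
    exact ((hE a).1 ha).resolve_left fun h1 => hup _ h _ h1 (hle a b hb)
  · intro a ha b hb h
    rw [sub_zero] at h ⊢
    refine ⟨fun _ => ?_, fun _ => (hE a).2 (Or.inl ha)⟩
    exact ((hE _).1 h).resolve_right fun h1 => hup _ h1 _ ha (hle a b hb)
  · intro x y hxy
    ext a
    have := congrArg (fun z => DM.co z a) hxy
    simp only [DM.co_hom, sub_zero] at this
    by_cases h : a ∈ E.1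
    · simpa [h] using this
    · have h2 : a ∉ E₂.1 := fun h2 => h ((hE a).2 (Or.inr h2))
      rw [x.co_of_notMem h2, y.co_of_notMem h2]
  · intro y
    refine ⟨DM.shift E₁ E 0 y, ?_⟩
    ext a
    simp only [DM.co_hom, sub_zero, DM.co_shift]
    by_cases h : a ∈ E₁.1
    · rw [if_pos h, if_pos ((hE a).2 (Or.inl h))]
    · rw [if_neg h, y.co_of_notMem h]
  · intro x
    constructor
    · intro hx
      refine ⟨DM.shift E E₂ 0 x, ?_⟩
      ext a
      simp only [DM.co_hom, sub_zero, DM.co_shift]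
      by_cases h : a ∈ E.1
      · rw [if_pos h]
        by_cases h2 : a ∈ E₂.1
        · rw [if_pos h2]
        · have := congrArg (fun z => DM.co z a) hx
          simp only [DM.co_hom, sub_zero, DM.co_zero] at this
          rw [if_pos (((hE a).1 h).resolve_right h2)] at this
          rw [if_neg h2, this]
      · rw [if_neg h, x.co_of_notMem h]
    · rintro ⟨y, rfl⟩
      ext a
      simp only [DM.co_hom, sub_zero, DM.co_zero]
      by_cases h : a ∈ E₁.1
      · rw [if_pos h, y.co_of_notMem (hd a h), ite_self]
      · rw [if_neg h]
  · intro x a ha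
    rw [DM.co_hom, if_pos ha, sub_zero]

/-- Degree modules of translated sets are isomorphic. -/
lemma DM.nonempty_equiv (c : V → ℤ) (h : ∀ a, a ∈ E'.1 ↔ a - c ∈ E.1) :
    Nonempty (DM k E ≃ₗ[MvPolynomial V k] DM k E') := by
  have h' : ∀ a, a ∈ E.1 ↔ a - -c ∈ E'.1 := fun a => by rw [h]; simp
  refine ⟨LinearEquiv.ofLinearMap (DM.hom E E' c ?_) (DM.hom E' E (-c) ?_) ?_ ?_⟩
  · intro a ha b hb h1
    exact ⟨fun _ => (h _).2 h1, fun _ => (h _).1 ha⟩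
  · intro a ha b hb h1
    exact ⟨fun _ => (h' _).2 h1, fun _ => (h' _).1 ha⟩
  · apply LinearMap.ext
    intro x
    ext a
    simp only [LinearMap.comp_apply, DM.co_hom, LinearMap.id_apply]
    by_cases ha : a ∈ E'.1
    · rw [if_pos ha, if_pos ((h a).1 ha)]
      simp
    · rw [if_neg ha, x.co_of_notMem ha]
  · apply LinearMap.ext
    intro x
    ext a
    simp only [LinearMap.comp_apply, DM.co_hom, LinearMap.id_apply]
    by_cases ha : a ∈ E.1
    · rw [if_pos ha, if_pos ((h' a).1 ha)]
      simp
    · rw [if_neg ha, x.co_of_notMem ha]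

lemma X_mem_maxIdeal (v : V) : (X v : MvPolynomial V k) ∈ maxIdeal k V :=
  Ideal.subset_span ⟨v, rfl⟩

variable [DecidableEq V]

/-- The exponent vector with value `s` on `T` and zero elsewhere. -/
def tvec (T : Finset V) (s : ℕ) : V → ℤ := fun v => if v ∈ T then (s : ℤ) else 0

lemma tvec_nonneg (T : Finset V) (s : ℕ) : 0 ≤ tvec T s := by
  intro v
  unfold tvec
  split_ifs <;> simp

/-- A power of a product of variables. -/
noncomputable def xT (k : Type) [Field k] (T : Finset V) (s : ℕ) : MvPolynomial V k :=
  (∏ v ∈ T, X v) ^ s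

lemma xT_eq_monomial (T : Finset V) (s : ℕ) : ∃ b : V →₀ ℕ, expZ b = tvec T s ∧
    xT k T s = monomial b 1 := by
  refine ⟨s • ∑ v ∈ T, Finsupp.single v 1, ?_, ?_⟩
  · funext v
    simp [expZ, tvec, Finsupp.single_apply]
  · have h : (monomial (∑ v ∈ T, Finsupp.single v 1) (1 : k)) ^ s =
        monomial (s • ∑ v ∈ T, Finsupp.single v 1) 1 := by rw [monomial_pow, one_pow]
    rw [xT, ← h, monomial_sum_one]
    rfl

open Classical in
lemma DM.co_xT_smul (T : Finset V) (s : ℕ) (x : DM k E) (a : V → ℤ) :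
    (xT k T s • x).co a = if a ∈ E.1 then x.co (a - tvec T s) else 0 := by
  obtain ⟨b, hb, h⟩ := xT_eq_monomial (k := k) T s
  rw [h, DM.co_monomial_smul, hb, one_mul]

lemma xT_mem {T : Finset V} (hT : T.Nonempty) (s : ℕ) : xT k T s ∈ maxIdeal k V ^ s := by
  obtain ⟨v, hv⟩ := hT
  refine Ideal.pow_mem_pow ?_ s
  rw [← Finset.mul_prod_erase T _ hv]
  exact Ideal.mul_mem_right _ _ (X_mem_maxIdeal v)

/-- Local cohomology vanishes for sets of exponents invariant in one direction. -/
lemma LC.subsingleton_of_invariant (v : V)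
    (h : ∀ a, a ∈ E.1 ↔ a - tvec {v} 1 ∈ E.1) (i : ℕ) :
    Subsingleton (LC (maxIdeal k V) i (DM k E)) := by
  have hx : xT k {v} 1 ∈ maxIdeal k V := by
    simpa using xT_mem (k := k) (Finset.singleton_nonempty v) 1
  have hco : ∀ (x : DM k E) a, (xT k {v} 1 • x).co a = x.co (a - tvec {v} 1) := by
    intro x a
    rw [DM.co_xT_smul]
    by_cases ha : a ∈ E.1
    · rw [if_pos ha]
    · rw [if_neg ha, x.co_of_notMem ((h a).not.1 ha)]
  refine LC.subsingleton_of_bijective hx ⟨fun x y hxy => ?_, fun y => ?_⟩ i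
  · ext a
    have := congrArg (fun z => DM.co z (a + tvec {v} 1)) hxy
    simpa only [hco, add_sub_cancel_right] using this
  · refine ⟨DM.shift E E (-tvec {v} 1) y, ?_⟩
    ext a
    change (xT k {v} 1 • _ : DM k E).co a = _
    rw [hco, DM.co_shift]
    by_cases ha : a ∈ E.1
    · rw [if_pos ((h a).1 ha)]
      simp
    · rw [if_neg ((h a).not.1 ha), y.co_of_notMem ha]

end DegreeModuleMaps

section Quotient

variable {k : Type} [Field k] {V : Type}

lemma DM.coL_apply (E : {E : Set (V → ℤ) // E.OrdConnected}) (a : V → ℤ) (x : DM k E) :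
    DM.coL a x = x.co a := rfl

open Classical in
lemma DM.co_smul (E : {E : Set (V → ℤ) // E.OrdConnected}) (p : MvPolynomial V k) (x : DM k E)
    (a : V → ℤ) : (p • x).co a =
      ∑ b ∈ p.support, p.coeff b * if a ∈ E.1 then x.co (a - expZ b) else 0 := by
  conv_lhs => rw [p.as_sum, Finset.sum_smul]
  rw [← DM.coL_apply, map_sum]
  exact Finset.sum_congr rfl fun b _ => DM.co_monomial_smul _ _ _ _

/-- Exponents of monomials outside a monomial ideal. -/
def outside {J : Set (V → ℤ)} (hJ : IsUpperSet J) : {E : Set (V → ℤ) // E.OrdConnected} :=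
  ⟨{a | 0 ≤ a ∧ a ∉ J}, ⟨fun _ hx _ hy _ hz => ⟨hx.1.trans hz.1, fun h => hy.2 (hJ hz.2 h)⟩⟩⟩

/-- The quotient by a monomial ideal is a degree module. -/
lemma nonempty_quotient_equiv [Finite V] {J : Set (V → ℤ)} (hJ : IsUpperSet J)
    {I : Ideal (MvPolynomial V k)} (hI : ∀ p, p ∈ I ↔ ∀ b ∈ p.support, expZ b ∈ J) :
    Nonempty ((MvPolynomial V k ⧸ I) ≃ₗ[MvPolynomial V k] DM k (outside hJ)) := by
  classical
  let E := outside hJ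
  have key : ∀ (p : MvPolynomial V k) (b : V →₀ ℕ), expZ b ∈ E.1 →
      (p • (DM.single E 0 : DM k E)).co (expZ b) = p.coeff b := by
    intro p b hb
    have h0 : (0 : V → ℤ) ∈ E.1 := ⟨le_rfl, fun h => hb.2 (hJ (expZ_nonneg b) h)⟩
    rw [DM.co_smul, Finset.sum_eq_single b]
    · simp [hb, DM.co_single, h0]
    · intro c _ hc
      rw [if_pos hb, DM.co_single, if_neg, mul_zero]
      rintro ⟨h, -⟩
      exact hc (expZ_injective (sub_eq_zero.1 h)).symm
    · intro h
      rw [notMem_support_iff.1 h, zero_mul]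
  let φ : MvPolynomial V k →ₗ[MvPolynomial V k] DM k E := LinearMap.toSpanSingleton _ _ (DM.single E 0)
  have hφ : ∀ p b, expZ b ∈ E.1 → (φ p).co (expZ b) = p.coeff b := key
  have hker : LinearMap.ker φ = I := by
    ext p
    rw [LinearMap.mem_ker, hI]
    constructor
    · intro h b hb
      by_contra hbJ
      have := hφ p b ⟨expZ_nonneg b, hbJ⟩
      rw [h, DM.co_zero] at this
      exact mem_support_iff.1 hb this.symm
    · intro h
      ext a
      by_cases ha : a ∈ E.1
      · obtain ⟨b, rfl⟩ := exists_expZ ha.1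
        rw [hφ p b ha, DM.co_zero]
        by_contra hb
        exact ha.2 (h b (mem_support_iff.2 hb))
      · rw [DM.co_of_notMem _ ha, DM.co_zero]
  have hsurj : Function.Surjective φ := by
    intro y
    have hfin : (Function.support y.co).Finite := y.2.1
    have hfin' : {b : V →₀ ℕ | y.co (expZ b) ≠ 0}.Finite :=
      hfin.preimage expZ_injective.injOn
    refine ⟨∑ b ∈ hfin'.toFinset, monomial b (y.co (expZ b)), ?_⟩
    ext a
    by_cases ha : a ∈ E.1
    · obtain ⟨b, rfl⟩ := exists_expZ ha.1
      rw [hφ _ b ha, coeff_sum]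
      simp only [coeff_monomial]
      rw [Finset.sum_ite_eq']
      split_ifs with h
      · rfl
      · simpa [eq_comm] using h
    · rw [DM.co_of_notMem _ ha, DM.co_of_notMem _ ha]
  exact ⟨(Submodule.quotEquivOfEq _ _ hker.symm).trans (φ.quotKerEquivOfSurjective hsurj)⟩

end Quotient

section Good

variable {V : Type} [DecidableEq V]

/-- Complexes obtained from arbitrary complexes by well-behaved unions and cones. -/
inductive Good : ℕ → Set (Finset V) → Prop
  | empty {r} : Good r ∅
  | base {X} (hX : IsSimplicialComplex X) : Good 0 X
  | mono {r X} (hX : Good (r + 1) X) : Good r X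
  | union {r X Y} (hX : Good (r + 1) X) (hY : Good (r + 1) Y) (hXY : Good r (X ∩ Y)) :
      Good (r + 1) (X ∪ Y)
  | cone {r X} (v : V) (hv : ∀ F ∈ X, v ∉ F) (hX : Good r X) : Good (r + 1) {F | F.erase v ∈ X}

lemma Good.isSimplicialComplex {r : ℕ} {X : Set (Finset V)} (h : Good r X) :
    IsSimplicialComplex X := by
  induction h with
  | empty => exact fun F hF => absurd hF (Set.notMem_empty F)
  | base hX => exact hX
  | mono _ h => exact h
  | union _ _ _ h1 h2 _ =>
    rintro F (hF | hF) G hG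
    · exact Or.inl (h1 F hF G hG)
    · exact Or.inr (h2 F hF G hG)
  | cone v hv _ h =>
    intro F hF G hG
    exact h _ hF _ (Finset.erase_subset_erase v hG)

lemma Good.of_le {r s : ℕ} {X : Set (Finset V)} (h : Good s X) (hrs : r ≤ s) : Good r X := by
  induction s with
  | zero =>
    obtain rfl : r = 0 := by omega
    exact h
  | succ s ih =>
    rcases hrs.eq_or_lt with rfl | h'
    · exact h
    · exact ih h.mono (by omega)

lemma Good.exists_face {r : ℕ} {X : Set (Finset V)} (h : Good r X) (hne : ∅ ∈ X) :
    ∃ F ∈ X, r ≤ F.card := by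
  induction h with
  | empty => exact absurd hne (Set.notMem_empty _)
  | base hX => exact ⟨∅, hne, Nat.zero_le _⟩
  | mono _ h =>
    obtain ⟨F, hF, hc⟩ := h hne
    exact ⟨F, hF, by omega⟩
  | union _ _ _ h1 h2 _ =>
    rcases hne with h | h
    · obtain ⟨F, hF, hc⟩ := h1 h
      exact ⟨F, Or.inl hF, hc⟩
    · obtain ⟨F, hF, hc⟩ := h2 h
      exact ⟨F, Or.inr hF, hc⟩
  | @cone r X v hv _ h =>
    obtain ⟨F, hF, hc⟩ := h (by
      have hne : Finset.erase ∅ v ∈ X := hne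
      rwa [Finset.erase_empty] at hne)
    refine ⟨insert v F, ?_, ?_⟩
    · change (insert v F).erase v ∈ X
      rwa [Finset.erase_insert (hv F hF)]
    · rw [Finset.card_insert_of_notMem (hv F hF)]
      omega

lemma Good.preimage {W : Type} [DecidableEq W] (ι : W ↪ V) {r : ℕ} {X : Set (Finset V)}
    (h : Good r X) (hr : ∀ F ∈ X, ∀ v ∈ F, v ∈ Set.range ι) : Good r {F | F.map ι ∈ X} := by
  induction h with
  | empty => exact .empty
  | base hX =>
    exact .base fun F hF G hG => hX _ hF _ (Finset.map_subset_map.2 hG)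
  | mono _ h => exact (h hr).mono
  | union _ _ _ h1 h2 h3 =>
    exact .union (h1 fun F hF => hr F (Or.inl hF)) (h2 fun F hF => hr F (Or.inr hF))
      (h3 fun F hF => hr F (Or.inl hF.1))
  | @cone r X v hv hX h =>
    by_cases hv' : v ∈ Set.range ι
    · obtain ⟨w, rfl⟩ := hv'
      have h' := h fun F hF => hr F (by
        change F.erase _ ∈ X
        rwa [Finset.erase_eq_of_notMem (hv F hF)])
      have := Good.cone w (fun F hF hw => hv _ hF (Finset.mem_map_of_mem ι hw)) h'
      have heq : {F : Finset W | F.map ι ∈ {F | F.erase (ι w) ∈ X}} =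
          {F | F.erase w ∈ {F : Finset W | F.map ι ∈ X}} := by
        ext F
        change (F.map ι).erase _ ∈ X ↔ (F.erase w).map ι ∈ X
        rw [Finset.map_erase]
      rw [heq]
      exact this
    · have hempty : X = ∅ := by
        by_contra hne
        obtain ⟨F, hF⟩ := Set.nonempty_iff_ne_empty.2 hne
        apply hv'
        apply hr {v} ?_ v (by simp)
        change Finset.erase {v} v ∈ X
        rw [Finset.erase_singleton]
        exact hX.isSimplicialComplex F hF _ (Finset.empty_subset F)
      subst hempty
      exact .empty

end Good

section GoodVanishing

variable {k : Type} [Field k] {V : Type}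

/-- Exponents of monomials supported on faces of a complex. -/
def cs (X : Set (Finset V)) : {E : Set (V → ℤ) // E.OrdConnected} :=
  ⟨{a | 0 ≤ a ∧ ∃ F ∈ X, ∀ v, 0 < a v → v ∈ F}, ⟨by
    rintro x hx y ⟨-, F, hF, hy⟩ z hz
    exact ⟨hx.1.trans hz.1, F, hF, fun v hv => hy v (hv.trans_le (hz.2 v))⟩⟩⟩

lemma cs_of_le {X : Set (Finset V)} {a b : V → ℤ} (hb : b ∈ (cs X).1) (ha : 0 ≤ a)
    (hab : a ≤ b) : a ∈ (cs X).1 := by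
  obtain ⟨-, F, hF, h⟩ := hb
  exact ⟨ha, F, hF, fun v hv => h v (hv.trans_le (hab v))⟩

lemma Van.of_subsingleton {R M : Type} [CommRing R] {J : Ideal R} [AddCommGroup M] [Module R M]
    [Subsingleton M] (r : ℕ) : Van J r M := fun i _ =>
  LC.subsingleton_of_bijective J.zero_mem
    ⟨fun _ _ _ => Subsingleton.elim _ _, fun y => ⟨y, Subsingleton.elim _ _⟩⟩ i

variable {E E₁ E₂ : {E : Set (V → ℤ) // E.OrdConnected}}

lemma Van.of_invariant [DecidableEq V] (v : V) (hE : ∀ a, a ∈ E.1 ↔ a ∈ E₁.1 ∨ a ∈ E₂.1)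
    (hd : ∀ a ∈ E₁.1, a ∉ E₂.1) (hup : ∀ a ∈ E₂.1, ∀ b ∈ E₁.1, ¬ a ≤ b)
    (ht : ∀ a, a ∈ E₂.1 ↔ a - tvec {v} 1 ∈ E.1) {r : ℕ}
    (h : Van (maxIdeal k V) r (DM k E₁)) : Van (maxIdeal k V) (r + 1) (DM k E) := by
  obtain ⟨-, g, -, hg, -, hco⟩ := DM.exists_ses (k := k) hE hd hup
  have hx : xT k {v} 1 ∈ maxIdeal k V := by
    simpa using xT_mem (k := k) (Finset.singleton_nonempty v) 1
  refine Van.of_regular hx (f := LinearMap.lsmul _ _ (xT k {v} 1)) (fun _ => rfl) ?_ hg ?_ h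
  · intro x y hxy
    ext a
    have := congrArg (fun z => DM.co z (a + tvec {v} 1)) hxy
    simp only [LinearMap.lsmul_apply, DM.co_xT_smul, add_sub_cancel_right] at this
    by_cases ha : a ∈ E.1
    · rwa [if_pos, if_pos] at this <;>
        exact (hE _).2 (Or.inr ((ht _).2 (by rwa [add_sub_cancel_right])))
    · rw [x.co_of_notMem ha, y.co_of_notMem ha]
  · intro y
    constructor
    · intro hy
      refine ⟨DM.shift E E (-tvec {v} 1) y, ?_⟩
      ext a
      rw [LinearMap.lsmul_apply, DM.co_xT_smul, DM.co_shift]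
      by_cases ha : a ∈ E.1
      · rw [if_pos ha]
        by_cases h2 : a - tvec {v} 1 ∈ E.1
        · rw [if_pos h2]
          simp
        · rw [if_neg h2, ← hco y a (((hE a).1 ha).resolve_right ((ht a).not.2 h2)), hy, DM.co_zero]
      · rw [if_neg ha, y.co_of_notMem ha]
    · rintro ⟨x, rfl⟩
      ext a
      by_cases ha : a ∈ E₁.1
      · rw [hco _ a ha, LinearMap.lsmul_apply, DM.co_xT_smul,
          x.co_of_notMem ((ht a).not.1 (hd a ha)), ite_self, DM.co_zero]
      · rw [DM.co_of_notMem _ ha, DM.co_of_notMem _ ha]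

/-- Adding a piece on top of a degree module. -/
lemma Van.of_ses (hE : ∀ a, a ∈ E.1 ↔ a ∈ E₁.1 ∨ a ∈ E₂.1)
    (hd : ∀ a ∈ E₁.1, a ∉ E₂.1) (hup : ∀ a ∈ E₂.1, ∀ b ∈ E₁.1, ¬ a ≤ b) {r : ℕ}
    (h1 : Van (maxIdeal k V) r (DM k E₁)) (h2 : Van (maxIdeal k V) r (DM k E₂)) :
    Van (maxIdeal k V) r (DM k E) := by
  obtain ⟨f, g, hf, hg, hfg, -⟩ := DM.exists_ses (k := k) hE hd hup
  exact Van.mid hf hg hfg h2 h1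

lemma Van.of_ses_top (hE : ∀ a, a ∈ E.1 ↔ a ∈ E₁.1 ∨ a ∈ E₂.1)
    (hd : ∀ a ∈ E₁.1, a ∉ E₂.1) (hup : ∀ a ∈ E₂.1, ∀ b ∈ E₁.1, ¬ a ≤ b) {r : ℕ}
    (h1 : Van (maxIdeal k V) r (DM k E₁)) (h : Van (maxIdeal k V) (r + 1) (DM k E)) :
    Van (maxIdeal k V) (r + 1) (DM k E₂) := by
  obtain ⟨f, g, hf, hg, hfg, -⟩ := DM.exists_ses (k := k) hE hd hup
  exact Van.left hf hg hfg h h1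

/-- The vanishing of local cohomology below `r` for complexes satisfying `Good r`. -/
theorem Good.van [DecidableEq V] {r : ℕ} {X : Set (Finset V)} (h : Good r X) :
    Van (maxIdeal k V) r (DM k (cs X)) := by
  induction h with
  | empty =>
    have : Subsingleton (DM k (cs (∅ : Set (Finset V)))) := ⟨fun x y => by
      ext a
      have ha : a ∉ (cs (∅ : Set (Finset V))).1 := fun ⟨_, F, hF, _⟩ => hF
      rw [x.co_of_notMem ha, y.co_of_notMem ha]⟩
    exact Van.of_subsingleton _
  | base _ => exact fun i hi => absurd hi (Nat.not_lt_zero i)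
  | mono _ h => exact h.mono (Nat.le_succ _)
  | @union r X Y hX hY _ h1 h2 h3 =>
    let E₂ : {E : Set (V → ℤ) // E.OrdConnected} := ⟨(cs Y).1 \ (cs X).1, ⟨by
      intro x hx y hy z hz
      exact ⟨cs_of_le hy.1 (hx.1.1.trans hz.1) hz.2, fun h => hx.2 (cs_of_le h hx.1.1 hz.1)⟩⟩⟩
    have hE₂ : Van (maxIdeal k V) (r + 1) (DM k E₂) := by
      refine Van.of_ses_top (E := cs Y) (E₁ := cs (X ∩ Y)) (fun a => ?_) ?_ ?_ h3 h2
      · constructor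
        · intro ha
          by_cases hX' : a ∈ (cs X).1
          · obtain ⟨h0, F, hF, hFa⟩ := hX'
            obtain ⟨-, F', hF', hFa'⟩ := ha
            exact Or.inl ⟨h0, F ∩ F', ⟨hX.isSimplicialComplex F hF _ Finset.inter_subset_left,
              hY.isSimplicialComplex F' hF' _ Finset.inter_subset_right⟩,
              fun v hv => Finset.mem_inter.2 ⟨hFa v hv, hFa' v hv⟩⟩
          · exact Or.inr ⟨ha, hX'⟩
        · rintro (⟨h0, F, hF, hFa⟩ | ha)
          · exact ⟨h0, F, hF.2, hFa⟩
          · exact ha.1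
      · rintro a ⟨h0, F, hF, hFa⟩ ha
        exact ha.2 ⟨h0, F, hF.1, hFa⟩
      · rintro a ha b ⟨h0, F, hF, hFa⟩ hab
        exact ha.2 (cs_of_le ⟨h0, F, hF.1, hFa⟩ ha.1.1 hab)
    refine Van.of_ses (E₁ := cs X) (E₂ := E₂) (fun a => ?_) ?_ ?_ h1 hE₂
    · constructor
      · rintro ⟨h0, F, hF, hFa⟩
        by_cases hX' : a ∈ (cs X).1
        · exact Or.inl hX'
        · rcases hF with hF | hF
          · exact Or.inl ⟨h0, F, hF, hFa⟩
          · exact Or.inr ⟨⟨h0, F, hF, hFa⟩, hX'⟩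
      · rintro (⟨h0, F, hF, hFa⟩ | ⟨⟨h0, F, hF, hFa⟩, -⟩)
        · exact ⟨h0, F, Or.inl hF, hFa⟩
        · exact ⟨h0, F, Or.inr hF, hFa⟩
    · exact fun a ha ha' => ha'.2 ha
    · exact fun a ha b hb hab => ha.2 (cs_of_le hb ha.1.1 hab)
  | @cone r X v hv hX h =>
    let Y : Set (Finset V) := {F | F.erase v ∈ X}
    let E₂ : {E : Set (V → ℤ) // E.OrdConnected} := ⟨{a | a ∈ (cs Y).1 ∧ 1 ≤ a v}, ⟨by
      intro x hx y hy z hz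
      exact ⟨cs_of_le hy.1 (hx.1.1.trans hz.1) hz.2, hx.2.trans (hz.1 v)⟩⟩⟩
    have hE₁ : ∀ a, a ∈ (cs X).1 → a v ≤ 0 := by
      rintro a ⟨-, F, hF, hFa⟩
      by_contra! hav
      exact hv F hF (hFa v hav)
    refine Van.of_invariant (E := cs Y) (E₁ := cs X) (E₂ := E₂) v (fun a => ?_) ?_ ?_ ?_ h
    · constructor
      · rintro ⟨h0, F, hF, hFa⟩
        by_cases h1 : 1 ≤ a v
        · exact Or.inr ⟨⟨h0, F, hF, hFa⟩, h1⟩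
        · refine Or.inl ⟨h0, F.erase v, hF, fun w hw => Finset.mem_erase.2 ⟨?_, hFa w hw⟩⟩
          rintro rfl
          exact h1 hw
      · rintro (⟨h0, F, hF, hFa⟩ | ha)
        · refine ⟨h0, F, ?_, hFa⟩
          change F.erase v ∈ X
          rwa [Finset.erase_eq_of_notMem (hv F hF)]
        · exact ha.1
    · intro a ha ha'
      have := hE₁ a ha
      have := ha'.2
      omega
    · intro a ha b hb hab
      have h1 := hE₁ b hb
      have h2 : 1 ≤ a v := ha.2
      have h3 : a v ≤ b v := hab v
      omega
    · intro a
      have key : ∀ w, w ≠ v → (a - tvec {v} 1) w = a w := fun w hw => by simp [tvec, hw]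
      have keyv : (a - tvec {v} 1) v = a v - 1 := by simp [tvec]
      constructor
      · rintro ⟨⟨h0, F, hF, hFa⟩, h1⟩
        refine ⟨fun w => ?_, F, hF, fun w hw => hFa w ?_⟩
        · by_cases hw : w = v
          · subst hw
            rw [keyv]
            simpa using h1
          · rw [key w hw]
            exact h0 w
        · refine hw.trans_le ?_
          exact sub_le_self a (tvec_nonneg _ _) w
      · rintro ⟨h0, F, hF, hFa⟩
        have h0v := h0 v
        rw [keyv, Pi.zero_apply] at h0v
        refine ⟨⟨h0.trans (sub_le_self a (tvec_nonneg _ _)), insert v F, ?_, fun w hw => ?_⟩, ?_⟩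
        · change (insert v F).erase v ∈ X
          refine hX.isSimplicialComplex _ hF _ ?_
          rw [Finset.erase_insert_eq_erase]
        · by_cases hw' : w = v
          · exact hw' ▸ Finset.mem_insert_self v F
          · exact Finset.mem_insert_of_mem (hFa w (by rwa [key w hw']))
        · linarith

end GoodVanishing

section Links

variable {V : Type} [DecidableEq V] {G : SimpleGraph V}

omit [DecidableEq V] in
lemma indepComplex_subset {F F' : Finset V} (h : F ∈ indepComplex G) (hF : F' ⊆ F) :
    F' ∈ indepComplex G := fun i hi j hj => h i (hF hi) j (hF hj)

lemma insert_mem_indepComplex {a : V} {F : Finset V} :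
    insert a F ∈ indepComplex G ↔ F ∈ indepComplex G ∧ ∀ x ∈ F, ¬ G.Adj a x := by
  constructor
  · intro h
    exact ⟨indepComplex_subset h (Finset.subset_insert _ _),
      fun x hx => h a (Finset.mem_insert_self _ _) x (Finset.mem_insert_of_mem hx)⟩
  · rintro ⟨h, ha⟩ i hi j hj
    rcases Finset.mem_insert.1 hi with rfl | hi' <;> rcases Finset.mem_insert.1 hj with rfl | hj'
    · exact G.irrefl
    · exact ha j hj'
    · exact fun hij => ha i hi' hij.symm
    · exact h i hi' j hj'

/-- The combinatorial condition controlling the second power of the edge ideal. -/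
structure LocallySpecial (G : SimpleGraph V) (d : ℕ) : Prop where
  card_le : ∀ F ∈ indepComplex G, F.card ≤ d
  exists_insert : ∀ F ∈ indepComplex G, F.card < d → ∃ a ∉ F, insert a F ∈ indepComplex G
  no_triangle : ∀ i p q r, G.Adj p q → G.Adj q r → G.Adj p r → ¬ G.Adj i p → ¬ G.Adj i q →
    ¬ G.Adj i r → False
  edge : ∀ T : Finset V, T.Nonempty → ∀ w f, G.Adj w f → insert w T ∈ indepComplex G →
    insert f T ∈ indepComplex G → ∃ U, T ⊆ U ∧ U.card + 1 = d ∧ insert w U ∈ indepComplex G ∧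
      insert f U ∈ indepComplex G

/-- Every independent set containing `T` and avoiding `b` extends by a neighbour of `b`. -/
def Ess (G : SimpleGraph V) (T : Finset V) (b : V) : Prop :=
  ∀ F, T ⊆ F → F ∈ indepComplex G → b ∉ F → ∃ c, G.Adj c b ∧ insert c F ∈ indepComplex G

lemma Ess.mono {T T' : Finset V} {b : V} (h : Ess G T b) (hT : T ⊆ T') : Ess G T' b :=
  fun F hF => h F (hT.trans hF)

lemma LocallySpecial.ess {d : ℕ} (h : LocallySpecial G d) {T : Finset V} (hT : T.Nonempty)
    {b c₀ : V} (hc₀ : G.Adj c₀ b) (hTc : insert c₀ T ∈ indepComplex G) : Ess G T b := by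
  intro F hTF hF hbF
  by_contra! hfail
  have hadj : ∀ c, G.Adj c b → ∃ x ∈ F, G.Adj c x := by
    intro c hc
    by_contra! hcx
    exact hfail c hc (insert_mem_indepComplex.2 ⟨hF, hcx⟩)
  have hbx : ∀ x ∈ F, ¬ G.Adj b x := fun x hx hadj =>
    hfail x hadj.symm (by rwa [Finset.insert_eq_of_mem hx])
  have hex : ∃ n, ∃ X, T ⊆ X ∧ X ⊆ F ∧ (∀ c, G.Adj c b → ∃ x ∈ X, G.Adj c x) ∧ X.card = n :=
    ⟨_, F, hTF, subset_rfl, hadj, rfl⟩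
  classical
  obtain ⟨X, hTX, hXF, hX, hcard⟩ := Nat.find_spec hex
  have hmin : ∀ Y, T ⊆ Y → Y ⊆ F → (∀ c, G.Adj c b → ∃ x ∈ Y, G.Adj c x) → X.card ≤ Y.card :=
    fun Y h1 h2 h3 => hcard.trans_le (Nat.find_min' hex ⟨Y, h1, h2, h3, rfl⟩)
  obtain ⟨f, hfX, hfT⟩ : ∃ f ∈ X, f ∉ T := by
    obtain ⟨x, hx, hcx⟩ := hX c₀ hc₀
    exact ⟨x, hx, fun hxT => (insert_mem_indepComplex.1 hTc).2 x hxT hcx⟩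
  have hTX' : T ⊆ X.erase f := fun x hx => Finset.mem_erase.2 ⟨fun h => hfT (h ▸ hx), hTX hx⟩
  obtain ⟨w, hwb, hw⟩ : ∃ w, G.Adj w b ∧ ∀ x ∈ X.erase f, ¬ G.Adj w x := by
    by_contra! hcon
    have := hmin (X.erase f) hTX' ((Finset.erase_subset _ _).trans hXF) hcon
    have := Finset.card_erase_lt_of_mem hfX
    omega
  have hwf : G.Adj w f := by
    obtain ⟨x, hx, hwx⟩ := hX w hwb
    by_cases hxf : x = f
    · exact hxf ▸ hwx
    · exact absurd hwx (hw x (Finset.mem_erase.2 ⟨hxf, hx⟩))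
  have hXΔ := indepComplex_subset hF hXF
  obtain ⟨U, hXU, hU, hwU, hfU⟩ := h.edge (X.erase f) (hT.mono hTX') w f hwf
    (insert_mem_indepComplex.2 ⟨indepComplex_subset hXΔ (Finset.erase_subset _ _), hw⟩)
    (by rwa [Finset.insert_erase hfX])
  rw [insert_mem_indepComplex] at hwU
  have hfU' := insert_mem_indepComplex.1 hfU
  have hb : insert b (insert f U) ∈ indepComplex G := by
    refine insert_mem_indepComplex.2 ⟨hfU, fun u hu hbu => ?_⟩
    rcases Finset.mem_insert.1 hu with rfl | hu'
    · exact hbx _ (hXF hfX) hbu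
    · obtain ⟨x, hx, hux⟩ := hX u hbu.symm
      by_cases hxf : x = f
      · subst hxf
        exact hfU'.2 u hu' hux.symm
      · exact hfU'.1 u hu' x (hXU (Finset.mem_erase.2 ⟨hxf, hx⟩)) hux
  have hle := h.card_le _ hb
  rw [Finset.card_insert_of_notMem, Finset.card_insert_of_notMem] at hle
  · omega
  · exact fun hfU => hwU.2 f hfU hwf
  · intro hb
    rcases Finset.mem_insert.1 hb with rfl | hb
    · exact hbF (hXF hfX)
    · exact hwU.2 b hb hwb

/-- Faces of the link of `T` in the independence complex avoiding `B`. -/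
def link (G : SimpleGraph V) (T B : Finset V) : Set (Finset V) :=
  {F | (∀ x ∈ F, x ∉ T ∧ x ∉ B) ∧ F ∪ T ∈ indepComplex G}

lemma link_isSimplicialComplex (T B : Finset V) : IsSimplicialComplex (link G T B) :=
  fun _ hF _ hF' => ⟨fun x hx => hF.1 x (hF' hx),
    indepComplex_subset hF.2 (Finset.union_subset_union hF' subset_rfl)⟩

lemma erase_mem_link {T B F : Finset V} {c : V} (hT : c ∉ T) (hB : c ∉ B) :
    F.erase c ∈ link G (insert c T) B ↔
      (∀ x ∈ F, x ∉ T ∧ x ∉ B) ∧ insert c (F ∪ T) ∈ indepComplex G := by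
  have h : F.erase c ∪ insert c T = insert c (F ∪ T) := by
    ext x
    simp only [Finset.mem_union, Finset.mem_erase, Finset.mem_insert]
    tauto
  change (∀ x ∈ F.erase c, x ∉ insert c T ∧ x ∉ B) ∧ _ ↔ _
  rw [h]
  refine and_congr_left fun _ => ⟨fun h x hx => ?_, fun h x hx => ?_⟩
  · by_cases hxc : x = c
    · exact hxc ▸ ⟨hT, hB⟩
    · have := h x (Finset.mem_erase.2 ⟨hxc, hx⟩)
      exact ⟨fun hxT => this.1 (Finset.mem_insert_of_mem hxT), this.2⟩
  · obtain ⟨hxc, hx⟩ := Finset.mem_erase.1 hx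
    exact ⟨fun h' => (Finset.mem_insert.1 h').elim hxc (h x hx).1, (h x hx).2⟩

/-- Faces of a link avoiding `B` which extend by an element of `N`. -/
def extLink (G : SimpleGraph V) (T B N : Finset V) : Set (Finset V) :=
  {F | (∀ x ∈ F, x ∉ T ∧ x ∉ B) ∧ ∃ c ∈ N, insert c (F ∪ T) ∈ indepComplex G}

variable {d : ℕ}

lemma good_cone_link {T B : Finset V} {c : V} (hT : c ∉ T) (hB : c ∉ B) {r : ℕ}
    (h : Good r (link G (insert c T) B)) :
    Good (r + 1) {F | (∀ x ∈ F, x ∉ T ∧ x ∉ B) ∧ insert c (F ∪ T) ∈ indepComplex G} := by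
  have := Good.cone c (fun F hF hc => (hF.1 c hc).1 (Finset.mem_insert_self _ _)) h
  simpa only [erase_mem_link hT hB] using this

lemma LocallySpecial.good_extLink (h : LocallySpecial G d) {n : ℕ}
    (ih : ∀ T : Finset V, d - T.card < n → T.Nonempty → T ∈ indepComplex G →
      ∀ B ∈ indepComplex G, Disjoint B T → (∀ b ∈ B, Ess G T b) →
        Good (d - T.card) (link G T B)) :
    ∀ N : Finset V, N.Nonempty → ∀ T : Finset V, d - T.card ≤ n → T.Nonempty →
      ∀ B ∈ indepComplex G, Disjoint B T → (∀ b ∈ B, Ess G T b) → N ∪ T ∈ indepComplex G →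
        Disjoint N T → Disjoint N B → Good (d - T.card) (extLink G T B N) := by
  intro N hN
  have hcone : ∀ (N T B : Finset V) (s : V), s ∈ N → d - T.card ≤ n → T.Nonempty →
      B ∈ indepComplex G → Disjoint B T → (∀ b ∈ B, Ess G T b) → N ∪ T ∈ indepComplex G →
      Disjoint N T → Disjoint N B →
      (s ∉ T ∧ s ∉ B ∧ (insert s T).card = T.card + 1 ∧ T.card + 1 ≤ d ∧
        Disjoint B (insert s T)) ∧ Good (d - T.card)
        {F | (∀ x ∈ F, x ∉ T ∧ x ∉ B) ∧ insert s (F ∪ T) ∈ indepComplex G} := by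
    intro N T B s hs hn hT hB hBT hE hNT hdT hdB
    have hsT : s ∉ T := Finset.disjoint_left.1 hdT hs
    have hsB : s ∉ B := Finset.disjoint_left.1 hdB hs
    have hsΔ : insert s T ∈ indepComplex G := indepComplex_subset hNT
      (Finset.insert_subset (Finset.mem_union_left _ hs) Finset.subset_union_right)
    have hcard := Finset.card_insert_of_notMem hsT
    have hle := h.card_le _ hsΔ
    rw [hcard] at hle
    have hdis : Disjoint B (insert s T) := Finset.disjoint_insert_right.2 ⟨hsB, hBT⟩
    have := good_cone_link hsT hsB (ih (insert s T) (by omega) (Finset.insert_nonempty _ _) hsΔ B hB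
      hdis fun b hb => (hE b hb).mono (Finset.subset_insert _ _))
    rw [show d - (insert s T).card + 1 = d - T.card by omega] at this
    exact ⟨⟨hsT, hsB, hcard, hle, hdis⟩, this⟩
  induction hN using Finset.Nonempty.cons_induction with
  | singleton s =>
    intro T hn hT B hB hBT hE hNT hdT hdB
    have := (hcone {s} T B s (by simp) hn hT hB hBT hE hNT hdT hdB).2
    convert this using 1
    ext F
    simp [extLink]
  | cons s N hs hN ihN =>
    intro T hn hT B hB hBT hE hNT hdT hdB
    rw [Finset.cons_eq_insert] at *
    obtain ⟨⟨hsT, hsB, hcard, hle, hdis⟩, hgs⟩ := hcone (insert s N) T B s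
      (Finset.mem_insert_self _ _) hn hT hB hBT hE hNT hdT hdB
    have hNN : N ⊆ insert s N := Finset.subset_insert _ _
    have hgN := ihN T hn hT B hB hBT hE
      (indepComplex_subset hNT (Finset.union_subset_union hNN subset_rfl))
      (hdT.mono_left hNN) (hdB.mono_left hNN)
    have hNT' : N ∪ insert s T ∈ indepComplex G := by
      rwa [Finset.union_insert, ← Finset.insert_union]
    have hgi := ihN (insert s T) (by omega) (Finset.insert_nonempty _ _) B hB hdis
      (fun b hb => (hE b hb).mono (Finset.subset_insert _ _)) hNT'
      (Finset.disjoint_insert_right.2 ⟨hs, hdT.mono_left hNN⟩) (hdB.mono_left hNN)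
    have hgi' := Good.cone s
      (fun F hF hc => (hF.1 s hc).1 (Finset.mem_insert_self _ _)) hgi
    obtain ⟨r, hr⟩ : ∃ r, d - T.card = r + 1 := ⟨d - T.card - 1, by omega⟩
    rw [hr] at hgN hgs ⊢
    have heq : extLink G T B (insert s N) = extLink G T B N ∪
        {F | (∀ x ∈ F, x ∉ T ∧ x ∉ B) ∧ insert s (F ∪ T) ∈ indepComplex G} := by
      ext F
      constructor
      · rintro ⟨h1, c, hc, h2⟩
        rcases Finset.mem_insert.1 hc with rfl | hc
        · exact Or.inr ⟨h1, h2⟩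
        · exact Or.inl ⟨h1, c, hc, h2⟩
      · rintro (⟨h1, c, hc, h2⟩ | ⟨h1, h2⟩)
        · exact ⟨h1, c, Finset.mem_insert_of_mem hc, h2⟩
        · exact ⟨h1, s, Finset.mem_insert_self _ _, h2⟩
    rw [heq]
    refine .union hgN hgs ?_
    refine Good.of_le (s := d - (insert s T).card + 1) ?_ (by omega)
    convert hgi' using 1
    ext F
    constructor
    · rintro ⟨⟨h1, c, hc, h2⟩, -, h3⟩
      have hcs : c ≠ s := fun h => hs (h ▸ hc)
      refine ⟨fun x hx => ?_, c, hc, ?_⟩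
      · obtain ⟨hxs, hx⟩ := Finset.mem_erase.1 hx
        exact ⟨fun h' => (Finset.mem_insert.1 h').elim hxs (h1 x hx).1, (h1 x hx).2⟩
      · have h4 : insert c (insert s (F ∪ T)) ∈ indepComplex G := by
          refine insert_mem_indepComplex.2 ⟨h3, fun x hx => ?_⟩
          rcases Finset.mem_insert.1 hx with rfl | hx
          · exact hNT c (Finset.mem_union_left _ (hNN hc)) _
              (Finset.mem_union_left _ (Finset.mem_insert_self _ _))
          · exact (insert_mem_indepComplex.1 h2).2 x hx
        refine indepComplex_subset h4 fun x => ?_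
        simp only [Finset.mem_insert, Finset.mem_union, Finset.mem_erase]
        tauto
    · rintro ⟨h1, c, hc, h2⟩
      have h1' : ∀ x ∈ F, x ∉ T ∧ x ∉ B := by
        intro x hx
        by_cases hxs : x = s
        · exact hxs ▸ ⟨hsT, hsB⟩
        · have := h1 x (Finset.mem_erase.2 ⟨hxs, hx⟩)
          exact ⟨fun h' => this.1 (Finset.mem_insert_of_mem h'), this.2⟩
      refine ⟨⟨h1', c, hc, indepComplex_subset h2 fun x => ?_⟩,
        ⟨h1', indepComplex_subset h2 fun x => ?_⟩⟩ <;>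
      · simp only [Finset.mem_insert, Finset.mem_union, Finset.mem_erase]
        tauto

/-- Deleting essential vertices from links keeps the vanishing property. -/
theorem LocallySpecial.good_link [Fintype V] (h : LocallySpecial G d) (n : ℕ) :
    ∀ T : Finset V, d - T.card < n → T.Nonempty → T ∈ indepComplex G →
      ∀ B ∈ indepComplex G, Disjoint B T → (∀ b ∈ B, Ess G T b) →
        Good (d - T.card) (link G T B) := by
  induction n with
  | zero => exact fun T hT => absurd hT (Nat.not_lt_zero _)
  | succ n ih =>
    intro T hn hT hTΔ
    have hext := h.good_extLink ih
    have h1 : ∀ B ∈ indepComplex G, Disjoint B T → (∀ b ∈ B, Ess G T b) →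
        ∀ b ∈ B, insert b T ∈ indepComplex G → Good (d - T.card) (link G T B) := by
      intro B hB hBT hE b hb hbT
      classical
      let N : Finset V := Finset.univ.filter fun c => G.Adj c b ∧ insert c T ∈ indepComplex G
      have hN : ∀ c, c ∈ N ↔ G.Adj c b ∧ insert c T ∈ indepComplex G := fun c => by simp [N]
      have hbT' : b ∉ T := Finset.disjoint_left.1 hBT hb
      have hbadj := (insert_mem_indepComplex.1 hbT).2
      obtain ⟨i, hi⟩ := id hT
      have hNT : N ∪ T ∈ indepComplex G := by
        intro x hx y hy hxy
        rcases Finset.mem_union.1 hx with hx' | hx' <;> rcases Finset.mem_union.1 hy with hy' | hy'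
        · obtain ⟨hxb, hxT⟩ := (hN x).1 hx'
          obtain ⟨hyb, hyT⟩ := (hN y).1 hy'
          rw [insert_mem_indepComplex] at hxT hyT
          exact h.no_triangle i x y b hxy hyb hxb (fun h => hxT.2 i hi h.symm)
            (fun h => hyT.2 i hi h.symm) (fun h => hbadj i hi h.symm)
        · exact (insert_mem_indepComplex.1 ((hN x).1 hx').2).2 y hy' hxy
        · exact (insert_mem_indepComplex.1 ((hN y).1 hy').2).2 x hx' hxy.symm
        · exact hTΔ x hx' y hy' hxy
      have hne : N.Nonempty := by
        obtain ⟨c, hc⟩ := hE b hb T subset_rfl hTΔ hbT'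
        exact ⟨c, (hN c).2 hc⟩
      have := hext N hne T (by omega) hT B hB hBT hE hNT
        (Finset.disjoint_left.2 fun c hc hcT => hbadj c hcT ((hN c).1 hc).1.symm)
        (Finset.disjoint_left.2 fun c hc hcB => hB c hcB b hb ((hN c).1 hc).1)
      convert this using 1
      ext F
      constructor
      · rintro ⟨hF1, hF2⟩
        obtain ⟨c, hc, hcF⟩ := hE b hb (F ∪ T) Finset.subset_union_right hF2 (by
          rw [Finset.mem_union, not_or]
          exact ⟨fun hbF => (hF1 b hbF).2 hb, hbT'⟩)
        exact ⟨hF1, c, (hN c).2 ⟨hc, indepComplex_subset hcF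
          (Finset.insert_subset_insert _ Finset.subset_union_right)⟩, hcF⟩
      · rintro ⟨hF1, c, -, hcF⟩
        exact ⟨hF1, indepComplex_subset hcF (Finset.subset_insert _ _)⟩
    have h0 : Good (d - T.card) (link G T ∅) := by
      by_cases ha : ∃ a ∉ T, insert a T ∈ indepComplex G
      · obtain ⟨a, haT, haΔ⟩ := ha
        have hcard := Finset.card_insert_of_notMem haT
        have hle := h.card_le _ haΔ
        have hg := ih (insert a T) (by omega) (Finset.insert_nonempty _ _) haΔ ∅
          (by simp [indepComplex]) (Finset.disjoint_empty_left _) (by simp)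
        have hcone := good_cone_link haT (Finset.notMem_empty a) hg
        rw [show d - (insert a T).card + 1 = d - T.card by omega] at hcone
        by_cases hc : ∃ c, G.Adj c a ∧ insert c T ∈ indepComplex G
        · obtain ⟨c, hca, hcT⟩ := hc
          have hE := h.ess hT hca hcT
          have hga := h1 {a} (by simp [indepComplex]) (Finset.disjoint_singleton_left.2 haT)
            (by simpa using hE) a (by simp) haΔ
          have heq : link G T ∅ = link G T {a} ∪
              {F | (∀ x ∈ F, x ∉ T ∧ x ∉ (∅ : Finset V)) ∧
                insert a (F ∪ T) ∈ indepComplex G} := by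
            ext F
            constructor
            · rintro ⟨hF1, hF2⟩
              by_cases haF : a ∈ F
              · refine Or.inr ⟨hF1, ?_⟩
                rwa [Finset.insert_eq_of_mem (Finset.mem_union_left _ haF)]
              · exact Or.inl ⟨fun x hx => ⟨(hF1 x hx).1, fun hxa =>
                  haF (Finset.mem_singleton.1 hxa ▸ hx)⟩, hF2⟩
            · rintro (⟨hF1, hF2⟩ | ⟨hF1, hF2⟩)
              · exact ⟨fun x hx => ⟨(hF1 x hx).1, Finset.notMem_empty _⟩, hF2⟩
              · exact ⟨hF1, indepComplex_subset hF2 (Finset.subset_insert _ _)⟩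
          obtain ⟨r, hr⟩ : ∃ r, d - T.card = r + 1 := ⟨d - T.card - 1, by omega⟩
          rw [hr] at hga hcone ⊢
          rw [heq]
          refine .union hga hcone ?_
          rw [show d - (insert a T).card = r by omega] at hg
          convert hg using 1
          ext F
          constructor
          · rintro ⟨⟨hF1, -⟩, -, hF2⟩
            refine ⟨fun x hx => ⟨fun hx' => ?_, Finset.notMem_empty _⟩, ?_⟩
            · rcases Finset.mem_insert.1 hx' with rfl | hx'
              · exact (hF1 _ hx).2 (Finset.mem_singleton_self _)
              · exact (hF1 _ hx).1 hx'
            · rwa [Finset.union_insert]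
          · rintro ⟨hF1, hF2⟩
            rw [Finset.union_insert] at hF2
            have hxT : ∀ x ∈ F, x ∉ T := fun x hx hx' =>
              (hF1 x hx).1 (Finset.mem_insert_of_mem hx')
            refine ⟨⟨fun x hx => ⟨hxT x hx, fun hxa => ?_⟩,
              indepComplex_subset hF2 (Finset.subset_insert _ _)⟩,
              fun x hx => ⟨hxT x hx, Finset.notMem_empty _⟩, hF2⟩
            exact (hF1 x hx).1 (Finset.mem_insert.2 (Or.inl (Finset.mem_singleton.1 hxa)))
        · convert hcone using 1
          ext F
          refine and_congr_right fun hF1 => ⟨fun hF => ?_, fun hF =>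
            indepComplex_subset hF (Finset.subset_insert _ _)⟩
          refine insert_mem_indepComplex.2 ⟨hF, fun x hx hax => hc ⟨x, hax.symm, ?_⟩⟩
          exact indepComplex_subset hF (Finset.insert_subset hx Finset.subset_union_right)
      · have : ¬ T.card < d := fun hlt => ha (h.exists_insert T hTΔ hlt)
        rw [show d - T.card = 0 by omega]
        exact .base (link_isSimplicialComplex _ _)
    intro B hB hBT hE
    by_cases hb : ∃ b ∈ B, insert b T ∈ indepComplex G
    · obtain ⟨b, hb, hbT⟩ := hb
      exact h1 B hB hBT hE b hb hbT
    · convert h0 using 1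
      ext F
      refine and_congr_left fun hF => ⟨fun hF1 x hx => ⟨(hF1 x hx).1, Finset.notMem_empty _⟩,
        fun hF1 x hx => ⟨(hF1 x hx).1, fun hxB => hb ⟨x, hxB, ?_⟩⟩⟩
      exact indepComplex_subset hF (Finset.insert_subset (Finset.mem_union_left _ hx)
        Finset.subset_union_right)

end Links

section KrullDim

variable {k : Type} [Field k] {V : Type} [Finite V]

lemma ringKrullDim_facePrime_le (F : Finset V) :
    ringKrullDim (MvPolynomial V k ⧸ facePrime k F) ≤ F.card := by
  let φ : MvPolynomial F k →ₐ[k] MvPolynomial V k ⧸ facePrime k F :=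
    (Ideal.Quotient.mkₐ k (facePrime k F)).comp (rename Subtype.val)
  have hφ : Function.Surjective φ := by
    rw [← AlgHom.range_eq_top, eq_top_iff]
    rintro y -
    obtain ⟨p, rfl⟩ := Ideal.Quotient.mkₐ_surjective k (facePrime k F) y
    induction p using MvPolynomial.induction_on with
    | C a => exact Subalgebra.algebraMap_mem φ.range a
    | add p q hp hq =>
      rw [map_add]
      exact add_mem hp hq
    | mul_X p v hp =>
      rw [map_mul]
      refine mul_mem hp ?_
      by_cases hv : v ∈ F
      · exact ⟨X ⟨v, hv⟩, by simp [φ]⟩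
      · have : (Ideal.Quotient.mkₐ k (facePrime k F)) (X v) = 0 :=
          Ideal.Quotient.eq_zero_iff_mem.2 (Ideal.subset_span ⟨v, hv, rfl⟩)
        rw [this]
        exact zero_mem _
  refine (ringKrullDim_le_of_surjective φ.toRingHom hφ).trans ?_
  rw [MvPolynomial.ringKrullDim_of_isNoetherianRing, ringKrullDim_eq_zero_of_field]
  simp

lemma ringKrullDim_quotient_le_of_primes {I : Ideal (MvPolynomial V k)} {r : ℕ}
    (h : ∀ P : Ideal (MvPolynomial V k), P.IsPrime → I ≤ P →
      ∃ F : Finset V, F.card ≤ r ∧ ∀ v ∉ F, X v ∈ P) :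
    ringKrullDim (MvPolynomial V k ⧸ I) ≤ r := by
  rw [ringKrullDim_quotient]
  refine iSup_le fun p => ?_
  obtain ⟨F, hF, hP⟩ := h p.head.1.asIdeal p.head.1.2 p.head.2
  have hle : facePrime k F ≤ p.head.1.asIdeal := by
    rw [facePrime, Ideal.span_le]
    rintro _ ⟨v, hv, rfl⟩
    exact hP v hv
  let q : LTSeries (PrimeSpectrum.zeroLocus (facePrime k F : Set (MvPolynomial V k))) :=
    { length := p.length
      toFun := fun i => ⟨(p i).1, hle.trans (LTSeries.head_le p i)⟩
      step := fun i => p.step i }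
  calc (p.length : WithBot ℕ∞) ≤ Order.krullDim
        (PrimeSpectrum.zeroLocus (facePrime k F : Set (MvPolynomial V k))) :=
        Order.LTSeries.length_le_krullDim q
    _ = ringKrullDim (MvPolynomial V k ⧸ facePrime k F) := (ringKrullDim_quotient _).symm
    _ ≤ F.card := ringKrullDim_facePrime_le F
    _ ≤ r := by exact_mod_cast hF

open Classical in
lemma le_ringKrullDim_quotient {I : Ideal (MvPolynomial V k)} (F : Finset V)
    (h : ∀ p ∈ I, aeval (fun v => if hv : v ∈ F then (X ⟨v, hv⟩ : MvPolynomial F k) else 0) p = 0) :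
    (F.card : WithBot ℕ∞) ≤ ringKrullDim (MvPolynomial V k ⧸ I) := by
  let φ : MvPolynomial V k →ₐ[k] MvPolynomial F k :=
    aeval (fun v => if hv : v ∈ F then (X ⟨v, hv⟩ : MvPolynomial F k) else 0)
  have hφ : Function.Surjective (Ideal.Quotient.lift I φ.toRingHom h) := by
    refine Ideal.Quotient.lift_surjective_of_surjective _ _ fun p => ⟨rename Subtype.val p, ?_⟩
    change φ _ = p
    simp only [φ, aeval_rename]
    conv_rhs => rw [← aeval_X_left_apply p]
    congr 1
    congr 1
    funext v
    simp
  have := ringKrullDim_le_of_surjective _ hφ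
  rwa [MvPolynomial.ringKrullDim_of_isNoetherianRing, ringKrullDim_eq_zero_of_field, zero_add,
    Nat.card_eq_fintype_card, Fintype.card_coe] at this

end KrullDim

section MonomialIdeals

variable {k : Type} [Field k] {V : Type}

lemma mem_span_monomial_iff {B : Set (V →₀ ℕ)} {J : Set (V → ℤ)}
    (hJ : ∀ a, a ∈ J ↔ ∃ b ∈ B, expZ b ≤ a) (p : MvPolynomial V k) :
    p ∈ Ideal.span ((fun s => monomial s (1 : k)) '' B) ↔ ∀ b ∈ p.support, expZ b ∈ J := by
  rw [MvPolynomial.mem_ideal_span_monomial_image]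
  refine forall₂_congr fun b _ => ?_
  rw [hJ]
  refine exists_congr fun c => and_congr_right fun _ => ?_
  rw [Finsupp.le_def]
  exact forall_congr' fun v => Int.ofNat_le.symm

variable [DecidableEq V]

/-- Exponents of the Stanley-Reisner ideal. -/
def srExp (Δ : Set (Finset V)) : Set (V → ℤ) := {a | ∃ F, F ∉ Δ ∧ tvec F 1 ≤ a}

lemma isUpperSet_srExp (Δ : Set (Finset V)) : IsUpperSet (srExp Δ) := by
  rintro a b hab ⟨F, hF, h⟩
  exact ⟨F, hF, h.trans hab⟩

lemma mem_srIdeal {Δ : Set (Finset V)} (p : MvPolynomial V k) :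
    p ∈ srIdeal k Δ ↔ ∀ b ∈ p.support, expZ b ∈ srExp Δ := by
  have hF : ∀ F : Finset V, expZ (∑ v ∈ F, Finsupp.single v 1) = tvec F 1 := fun F => by
    funext v
    simp [expZ, tvec, Finsupp.single_apply]
  rw [← mem_span_monomial_iff (B := {b | ∃ F, F ∉ Δ ∧ b = ∑ v ∈ F, Finsupp.single v 1})]
  · rw [srIdeal]
    refine Iff.of_eq (congrArg (fun s => p ∈ Ideal.span s) ?_)
    ext m
    constructor
    · rintro ⟨F, hF, rfl⟩
      exact ⟨_, ⟨F, hF, rfl⟩, monomial_sum_one _ _⟩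
    · rintro ⟨_, ⟨F, hF, rfl⟩, rfl⟩
      exact ⟨F, hF, monomial_sum_one _ _⟩
  · intro a
    constructor
    · rintro ⟨F, h, hFa⟩
      exact ⟨_, ⟨F, h, rfl⟩, (hF F).trans_le hFa⟩
    · rintro ⟨_, ⟨F, h, rfl⟩, hFa⟩
      exact ⟨F, h, (hF F).symm.trans_le hFa⟩

/-- The exponent of a variable. -/
abbrev ev (v : V) : V → ℤ := Pi.single v 1

/-- Exponents of the second power of the edge ideal. -/
def sqExp (G : SimpleGraph V) : Set (V → ℤ) :=
  {a | ∃ p q p' q', G.Adj p q ∧ G.Adj p' q' ∧ ev p + ev q + (ev p' + ev q') ≤ a}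

lemma isUpperSet_sqExp (G : SimpleGraph V) : IsUpperSet (sqExp G) := by
  rintro a b hab ⟨p, q, p', q', h, h', hle⟩
  exact ⟨p, q, p', q', h, h', hle.trans hab⟩

lemma mem_edgeIdeal_sq {G : SimpleGraph V} (p : MvPolynomial V k) :
    p ∈ edgeIdeal k G ^ 2 ↔ ∀ b ∈ p.support, expZ b ∈ sqExp G := by
  have hv : ∀ v : V, expZ (Finsupp.single v 1) = ev v := fun v => by
    funext w
    simp [expZ, Finsupp.single_apply, Pi.single_apply, eq_comm]
  rw [← mem_span_monomial_iff (B := {b | ∃ p q p' q', G.Adj p q ∧ G.Adj p' q' ∧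
    b = Finsupp.single p 1 + Finsupp.single q 1 + (Finsupp.single p' 1 + Finsupp.single q' 1)})]
  · rw [edgeIdeal, pow_two, Ideal.span_mul_span']
    refine Iff.of_eq (congrArg (fun s => p ∈ Ideal.span s) ?_)
    have hm : ∀ p q p' q' : V, (X p * X q * (X p' * X q') : MvPolynomial V k) =
      monomial (Finsupp.single p 1 + Finsupp.single q 1 +
        (Finsupp.single p' 1 + Finsupp.single q' 1)) 1 := fun p q p' q' => by
      simp [X, monomial_mul]
    ext m
    rw [Set.mem_mul]
    constructor
    · rintro ⟨_, ⟨p, q, h, rfl⟩, _, ⟨p', q', h', rfl⟩, rfl⟩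
      exact ⟨_, ⟨p, q, p', q', h, h', rfl⟩, (hm _ _ _ _).symm⟩
    · rintro ⟨_, ⟨p, q, p', q', h, h', rfl⟩, rfl⟩
      exact ⟨_, ⟨p, q, h, rfl⟩, _, ⟨p', q', h', rfl⟩, hm _ _ _ _⟩
  · intro a
    constructor
    · rintro ⟨p, q, p', q', h, h', hle⟩
      refine ⟨_, ⟨p, q, p', q', h, h', rfl⟩, ?_⟩
      simpa only [expZ_add, hv] using hle
    · rintro ⟨_, ⟨p, q, p', q', h, h', rfl⟩, hle⟩
      exact ⟨p, q, p', q', h, h', by simpa only [expZ_add, hv] using hle⟩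

variable [Finite V]

omit [DecidableEq V] in
lemma ringKrullDim_srIdeal_le {Δ : Set (Finset V)} {r : ℕ} (h : ∀ F ∈ Δ, F.card ≤ r) :
    ringKrullDim (MvPolynomial V k ⧸ srIdeal k Δ) ≤ r := by
  classical
  have := Fintype.ofFinite V
  refine ringKrullDim_quotient_le_of_primes fun P hP hI => ⟨Finset.univ.filter fun v => X v ∉ P, h _ ?_, ?_⟩
  · by_contra hF
    have := hI (Ideal.subset_span ⟨_, hF, rfl⟩)
    obtain ⟨v, hv, hvP⟩ := (hP.prod_mem_iff).1 this
    exact (Finset.mem_filter.1 hv).2 hvP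
  · intro v hv
    by_contra h'
    exact hv (Finset.mem_filter.2 ⟨Finset.mem_univ _, h'⟩)

omit [DecidableEq V] in
lemma le_ringKrullDim_srIdeal {Δ : Set (Finset V)} (hΔ : IsSimplicialComplex Δ) {F : Finset V}
    (hF : F ∈ Δ) : (F.card : WithBot ℕ∞) ≤ ringKrullDim (MvPolynomial V k ⧸ srIdeal k Δ) := by
  classical
  refine le_ringKrullDim_quotient F fun p hp => ?_
  rw [← AlgHom.coe_toRingHom, ← RingHom.mem_ker]
  revert p
  change srIdeal k Δ ≤ _
  rw [srIdeal, Ideal.span_le]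
  rintro _ ⟨F', hF', rfl⟩
  obtain ⟨v, hv, hvF⟩ := Finset.not_subset.1 fun h => hF' (hΔ F hF F' h)
  change (aeval _) (∏ i ∈ F', X i) = 0
  rw [map_prod]
  exact Finset.prod_eq_zero hv (by simp [hvF])

omit [DecidableEq V] in
lemma ringKrullDim_edgeIdeal_sq_le {G : SimpleGraph V} {r : ℕ}
    (h : ∀ F ∈ indepComplex G, F.card ≤ r) :
    ringKrullDim (MvPolynomial V k ⧸ edgeIdeal k G ^ 2) ≤ r := by
  classical
  have := Fintype.ofFinite V
  refine ringKrullDim_quotient_le_of_primes fun P hP hI => ⟨Finset.univ.filter fun v => X v ∉ P, h _ ?_, ?_⟩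
  · intro i hi j hj hij
    have hI' : edgeIdeal k G ≤ P := hP.le_of_pow_le hI
    rcases hP.mem_or_mem (hI' (Ideal.subset_span ⟨i, j, hij, rfl⟩)) with h | h
    · exact (Finset.mem_filter.1 hi).2 h
    · exact (Finset.mem_filter.1 hj).2 h
  · intro v hv
    by_contra h'
    exact hv (Finset.mem_filter.2 ⟨Finset.mem_univ _, h'⟩)

omit [DecidableEq V] in
lemma le_ringKrullDim_edgeIdeal_sq {G : SimpleGraph V} {F : Finset V} (hF : F ∈ indepComplex G) :
    (F.card : WithBot ℕ∞) ≤ ringKrullDim (MvPolynomial V k ⧸ edgeIdeal k G ^ 2) := by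
  classical
  refine le_ringKrullDim_quotient F fun p hp => ?_
  rw [← AlgHom.coe_toRingHom, ← RingHom.mem_ker]
  revert p
  change edgeIdeal k G ^ 2 ≤ _
  refine (Ideal.pow_le_self two_ne_zero).trans ?_
  rw [edgeIdeal, Ideal.span_le]
  rintro _ ⟨i, j, hij, rfl⟩
  change (aeval _) (X i * X j) = 0
  rw [map_mul, aeval_X, aeval_X]
  by_cases hi : i ∈ F
  · rw [dif_neg (fun hj => hF i hi j hj hij), mul_zero]
  · rw [dif_neg hi, zero_mul]

end MonomialIdeals

section Factor

variable {k : Type} [Field k] {V : Type} [DecidableEq V]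
  {E E' : {E : Set (V → ℤ) // E.OrdConnected}}

/-- Multiplication by a monomial factors through a large lower piece of a degree module. -/
lemma DM.exists_factor (hsub : ∀ a ∈ E'.1, a ∈ E.1)
    (hdown : ∀ a ∈ E'.1, ∀ b ∈ E.1, b ≤ a → b ∈ E'.1) (T : Finset V) (r : ℕ)
    (hsh : ∀ a ∈ E.1, a - tvec T r ∈ E.1 → a - tvec T r ∈ E'.1) :
    ∃ (α : DM k E →ₗ[MvPolynomial V k] DM k E') (β : DM k E' →ₗ[MvPolynomial V k] DM k E),
      β ∘ₗ α = xT k T r • LinearMap.id ∧ α ∘ₗ β = xT k T r • LinearMap.id := by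
  have h1 : ∀ a ∈ E'.1, ∀ b, 0 ≤ b → a - b - 0 ∈ E.1 → (a - 0 ∈ E.1 ↔ a - b ∈ E'.1) := by
    intro a ha b hb h
    rw [sub_zero] at h ⊢
    exact ⟨fun _ => hdown a ha _ h (sub_le_self a hb), fun _ => hsub a ha⟩
  have h2 : ∀ a ∈ E.1, ∀ b, 0 ≤ b → a - b - tvec T r ∈ E'.1 →
      (a - tvec T r ∈ E'.1 ↔ a - b ∈ E.1) := by
    intro a ha b hb h
    have hc := tvec_nonneg T r
    have hab : a - b - tvec T r ≤ a - tvec T r := sub_le_sub_right (sub_le_self a hb) _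
    refine ⟨fun _ => E.2.out (hsub _ h) ha ⟨sub_le_self _ hc, sub_le_self _ hb⟩, fun _ => ?_⟩
    exact hsh a ha (E.2.out (hsub _ h) ha ⟨hab, sub_le_self _ hc⟩)
  refine ⟨DM.hom E E' 0 h1, DM.hom E' E (tvec T r) h2, ?_, ?_⟩
  · apply LinearMap.ext
    intro x
    ext a
    simp only [LinearMap.comp_apply, DM.co_hom, LinearMap.smul_apply, LinearMap.id_apply,
      DM.co_xT_smul, sub_zero]
    by_cases ha : a ∈ E.1
    · rw [if_pos ha, if_pos ha]
      by_cases hc : a - tvec T r ∈ E.1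
      · rw [if_pos (hsh a ha hc)]
      · rw [x.co_of_notMem hc, ite_self]
    · rw [if_neg ha, if_neg ha]
  · apply LinearMap.ext
    intro x
    ext a
    simp only [LinearMap.comp_apply, DM.co_hom, LinearMap.smul_apply, LinearMap.id_apply,
      DM.co_xT_smul, sub_zero]
    by_cases ha : a ∈ E'.1
    · rw [if_pos ha, if_pos ha, if_pos (hsub a ha)]
    · rw [if_neg ha, if_neg ha]

end Factor

lemma LC.smul_eq_zero_of_factor {R : Type} [CommRing R] {J : Ideal R} {A B : Type}
    [AddCommGroup A] [Module R A] [AddCommGroup B] [Module R B] {α : A →ₗ[R] B} {β : B →ₗ[R] A}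
    {x y : R} (hβα : β ∘ₗ α = x • LinearMap.id) {i : ℕ} (hB : ∀ h : LC J i B, y • h = 0)
    (h : LC J i A) : (x * y) • h = 0 := by
  have key : x • h = LC.map J i β (LC.map J i α h) := by
    have := congrArg (fun f => f h) (LC.map_comp (J := J) (i := i) α β)
    simp only [hβα, LC.map_smul_id, LC.map_id] at this
    exact this
  have h2 : (y * x) • h = y • (x • h) := mul_smul y x h
  rw [mul_comm, h2, key, ← map_smul]
  rw [show y • LC.map J i α h = 0 from hB _, map_zero]

section MaxIdeal

variable {k : Type} [Field k] {V : Type}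

lemma maxIdeal_isMaximal : (maxIdeal k V).IsMaximal := by
  have h : maxIdeal k V = RingHom.ker (constantCoeff : MvPolynomial V k →+* k) := by
    ext p
    rw [maxIdeal, ← Set.image_univ, MvPolynomial.mem_ideal_span_X_image, RingHom.mem_ker]
    constructor
    · intro h
      by_contra h0
      obtain ⟨i, -, hi⟩ := h 0 (mem_support_iff.2 h0)
      exact hi rfl
    · intro h m hm
      by_contra! hcon
      have : m = 0 := Finsupp.ext fun i => hcon i trivial
      exact mem_support_iff.1 hm (this ▸ h)
  rw [h]
  exact RingHom.ker_isMaximal_of_surjective _ fun a => ⟨C a, constantCoeff_C _ a⟩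

lemma maxIdeal_pow_le [Finite V] {A : Ideal (MvPolynomial V k)} {r : ℕ}
    (h : ∀ v, X v ^ r ∈ A) : ∃ N, maxIdeal k V ^ N ≤ A := by
  refine Ideal.exists_pow_le_of_le_radical_of_fg ?_ (IsNoetherian.noetherian _)
  rw [maxIdeal, Ideal.span_le]
  rintro _ ⟨v, rfl⟩
  exact ⟨r, h v⟩

end MaxIdeal

section Exponents

variable {V : Type} [DecidableEq V]

lemma ev_nonneg (v : V) : 0 ≤ ev v := by
  intro w
  by_cases h : w = v
  · simp [h]
  · simp [h]

lemma ev_self (v : V) : ev v v = 1 := by simp [ev]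

lemma ev_of_ne {v w : V} (h : w ≠ v) : ev v w = 0 := by simp [ev, h]

lemma ev_le_iff {a : V → ℤ} (ha : 0 ≤ a) {v : V} : ev v ≤ a ↔ 0 < a v := by
  constructor
  · intro h
    have : (1 : ℤ) ≤ a v := ev_self v ▸ h v
    omega
  · intro h w
    by_cases hw : w = v
    · rw [hw, ev_self]
      exact Int.add_one_le_iff.2 h
    · rw [ev_of_ne hw]
      exact ha w

lemma ev_add_ev_le_iff {a : V → ℤ} (ha : 0 ≤ a) {v w : V} (hvw : v ≠ w) :
    ev v + ev w ≤ a ↔ 0 < a v ∧ 0 < a w := by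
  constructor
  · intro h
    exact ⟨(ev_le_iff ha).1 ((le_add_of_nonneg_right (ev_nonneg w)).trans h),
      (ev_le_iff ha).1 ((le_add_of_nonneg_left (ev_nonneg v)).trans h)⟩
  · rintro ⟨hv, hw⟩ u
    rw [Pi.add_apply]
    by_cases huv : u = v
    · rw [huv, ev_self, ev_of_ne hvw]
      exact Int.add_one_le_iff.2 hv
    · rw [ev_of_ne huv, zero_add]
      exact (ev_le_iff ha).2 hw u

variable [Fintype V]

/-- The support of an exponent vector. -/
def supp (a : V → ℤ) : Finset V := Finset.univ.filter fun v => 0 < a v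

omit [DecidableEq V] in
@[simp] lemma mem_supp {a : V → ℤ} {v : V} : v ∈ supp a ↔ 0 < a v := by simp [supp]

omit [DecidableEq V] in
lemma mem_cs {X : Set (Finset V)} (hX : IsSimplicialComplex X) {a : V → ℤ} :
    a ∈ (cs X).1 ↔ 0 ≤ a ∧ supp a ∈ X := by
  refine and_congr_right fun _ => ⟨?_, fun h => ⟨_, h, fun v hv => mem_supp.2 hv⟩⟩
  rintro ⟨F, hF, h⟩
  exact hX F hF _ fun v hv => h v (mem_supp.1 hv)

end Exponents

section Star

variable {V : Type} [DecidableEq V] {G : SimpleGraph V} {d : ℕ}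

/-- Exponents of the generators of the localization of the edge ideal at a variable. -/
def locGen (G : SimpleGraph V) (v : V) : Set (V → ℤ) :=
  {g | (∃ j, G.Adj v j ∧ g = ev j) ∨
    ∃ p q, G.Adj p q ∧ ¬ G.Adj v p ∧ ¬ G.Adj v q ∧ g = ev p + ev q}

lemma locGen_nonneg {v : V} {g : V → ℤ} (hg : g ∈ locGen G v) : 0 ≤ g := by
  rcases hg with ⟨j, -, rfl⟩ | ⟨p, q, -, -, -, rfl⟩
  · exact ev_nonneg j
  · exact add_nonneg (ev_nonneg p) (ev_nonneg q)

lemma locGen_finite [Finite V] (v : V) : (locGen G v).Finite := by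
  refine ((Set.finite_range (ev : V → V → ℤ)).union
    (Set.finite_range fun x : V × V => ev x.1 + ev x.2)).subset ?_
  rintro g (⟨j, -, rfl⟩ | ⟨p, q, -, -, -, rfl⟩)
  · exact Or.inl ⟨j, rfl⟩
  · exact Or.inr ⟨(p, q), rfl⟩

lemma forall_locGen_not_le [Fintype V] {v : V} {b : V → ℤ} (hb : 0 ≤ b) :
    (∀ g ∈ locGen G v, ¬ g ≤ b) ↔ insert v (supp b) ∈ indepComplex G := by
  rw [insert_mem_indepComplex]
  constructor
  · intro h
    have hv : ∀ x ∈ supp b, ¬ G.Adj v x := fun x hx hvx =>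
      h (ev x) (Or.inl ⟨x, hvx, rfl⟩) ((ev_le_iff hb).2 (mem_supp.1 hx))
    exact ⟨fun x hx y hy hxy => h _ (Or.inr ⟨x, y, hxy, hv x hx, hv y hy, rfl⟩)
      ((ev_add_ev_le_iff hb hxy.ne).2 ⟨mem_supp.1 hx, mem_supp.1 hy⟩), hv⟩
  · rintro ⟨h1, h2⟩ g (⟨j, hj, rfl⟩ | ⟨p, q, hpq, -, -, rfl⟩) hg
    · exact h2 j (mem_supp.2 ((ev_le_iff hb).1 hg)) hj
    · have := (ev_add_ev_le_iff hb hpq.ne).1 hg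
      exact h1 p (mem_supp.2 this.1) q (mem_supp.2 this.2) hpq

/-- Faces compatible with `v`. -/
def vertexStar (G : SimpleGraph V) (v : V) : Set (Finset V) := {F | insert v F ∈ indepComplex G}

/-- Faces compatible with `v` and `p` and avoiding `B`. -/
def edgeStar (G : SimpleGraph V) (v p : V) (B : Finset V) : Set (Finset V) :=
  {F | (∀ x ∈ F, x ∉ B) ∧ insert p (insert v F) ∈ indepComplex G}

variable [Fintype V]

omit [DecidableEq V] [Fintype V] in
lemma singleton_mem_indepComplex (v : V) : ({v} : Finset V) ∈ indepComplex G := by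
  simp [indepComplex]

lemma LocallySpecial.good_star (h : LocallySpecial G d) (v : V) : Good d (vertexStar G v) := by
  have hd := h.card_le _ (singleton_mem_indepComplex v)
  rw [Finset.card_singleton] at hd
  have := h.good_link (d + 1) {v} (by omega) (Finset.singleton_nonempty v)
    (singleton_mem_indepComplex v) ∅ (by simp [indepComplex]) (Finset.disjoint_empty_left _)
    (by simp)
  have := good_cone_link (T := ∅) (c := v) (Finset.notMem_empty v) (Finset.notMem_empty v)
    (r := d - 1) (by simpa using this)
  rw [show d - 1 + 1 = d by omega] at this
  convert this using 1
  ext F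
  simp [vertexStar]

omit [Fintype V] in
/-- The neighbours of `q` compatible with `v` are essential after localizing at an edge `pq`. -/
lemma LocallySpecial.ess_edge (h : LocallySpecial G d) {v p q b : V} (hpq : G.Adj p q)
    (hvp : ¬ G.Adj v p) (hvq : ¬ G.Adj v q) (hbq : G.Adj b q) (hvb : ¬ G.Adj v b) (hbp : b ≠ p) :
    Ess G {p, v} b := by
  have hpair : ∀ x, ¬ G.Adj v x → insert x {v} ∈ indepComplex G := fun x hx =>
    insert_mem_indepComplex.2 ⟨singleton_mem_indepComplex v, by simpa using fun h => hx h.symm⟩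
  obtain ⟨U, hvU, hU, hpU, hqU⟩ := h.edge {v} (Finset.singleton_nonempty v) p q hpq
    (hpair p hvp) (hpair q hvq)
  have hv : v ∈ U := hvU (Finset.mem_singleton_self v)
  have hpU' := insert_mem_indepComplex.1 hpU
  have hqU' := insert_mem_indepComplex.1 hqU
  have hpb : ¬ G.Adj p b := fun hpb => h.no_triangle v p b q hpb hbq hpq hvp hvb hvq
  obtain ⟨c, hcU, hcb⟩ : ∃ c ∈ U, G.Adj c b := by
    by_contra! hcon
    have : insert b (insert p U) ∈ indepComplex G := by
      refine insert_mem_indepComplex.2 ⟨hpU, fun x hx hbx => ?_⟩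
      rcases Finset.mem_insert.1 hx with rfl | hx
      · exact hpb hbx.symm
      · exact hcon x hx hbx.symm
    have hle := h.card_le _ this
    rw [Finset.card_insert_of_notMem, Finset.card_insert_of_notMem] at hle
    · omega
    · exact fun hp => hqU'.2 p hp hpq.symm
    · intro hb
      rcases Finset.mem_insert.1 hb with rfl | hb
      · exact hbp rfl
      · exact hqU'.2 b hb hbq.symm
  refine h.ess (Finset.insert_nonempty _ _) hcb (indepComplex_subset hpU ?_)
  intro x hx
  simp only [Finset.mem_insert, Finset.mem_singleton] at hx ⊢
  rcases hx with rfl | rfl | rfl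
  · exact Or.inr hcU
  · exact Or.inl rfl
  · exact Or.inr hv

lemma LocallySpecial.good_edgeLink (h : LocallySpecial G d) {v p q : V} (hpq : G.Adj p q)
    (hvp : ¬ G.Adj v p) (hvq : ¬ G.Adj v q) (hne : p ≠ v) {B : Finset V}
    (hB : ∀ b ∈ B, G.Adj b q ∧ ¬ G.Adj v b ∧ b ≠ p) :
    2 ≤ d ∧ p ∉ B ∧ v ∉ B ∧ Good (d - 2) (link G {p, v} B) := by
  have hpv : insert p {v} ∈ indepComplex G :=
    insert_mem_indepComplex.2 ⟨singleton_mem_indepComplex v, by simpa using fun h => hvp h.symm⟩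
  have hcard : (insert p ({v} : Finset V)).card = 2 := Finset.card_pair hne
  have hd := h.card_le _ hpv
  rw [hcard] at hd
  have hpB : p ∉ B := fun hp => (hB p hp).2.2 rfl
  have hvB : v ∉ B := fun hv => hvq (hB v hv).1
  have := h.good_link (d + 1) {p, v} (by omega) (Finset.insert_nonempty _ _) hpv B
    (fun x hx y hy hxy => h.no_triangle v x y q hxy (hB y hy).1 (hB x hx).1 (hB x hx).2.1
      (hB y hy).2.1 hvq)
    (by simp [hpB, hvB])
    (fun b hb => h.ess_edge hpq hvp hvq (hB b hb).1 (hB b hb).2.1 (hB b hb).2.2)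
  rw [hcard] at this
  exact ⟨hd, hpB, hvB, this⟩

lemma LocallySpecial.good_edgeStar (h : LocallySpecial G d) {v p q : V} (hpq : G.Adj p q)
    (hvp : ¬ G.Adj v p) (hvq : ¬ G.Adj v q) (hne : p ≠ v) {B : Finset V}
    (hB : ∀ b ∈ B, G.Adj b q ∧ ¬ G.Adj v b ∧ b ≠ p) : Good d (edgeStar G v p B) := by
  obtain ⟨hd, hpB, hvB, hg⟩ := h.good_edgeLink hpq hvp hvq hne hB
  have h1 := good_cone_link (T := {v}) (c := p) (by simpa using hne) hpB hg
  have h2 := Good.cone v (fun F hF hv => (hF.1 v hv).1 (Finset.mem_singleton_self v)) h1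
  rw [show d - 2 + 1 + 1 = d by omega] at h2
  convert h2 using 1
  ext F
  have heq : F.erase v ∪ {v} = insert v F := by
    ext x
    simp only [Finset.mem_union, Finset.mem_erase, Finset.mem_singleton, Finset.mem_insert]
    tauto
  change _ ↔ (∀ x ∈ F.erase v, x ∉ ({v} : Finset V) ∧ x ∉ B) ∧ insert p (F.erase v ∪ {v}) ∈ _
  rw [heq]
  refine and_congr_left fun _ => ⟨fun hF x hx => ?_, fun hF x hx => ?_⟩
  · obtain ⟨hxv, hx⟩ := Finset.mem_erase.1 hx
    exact ⟨by simpa using hxv, hF x hx⟩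
  · by_cases hxv : x = v
    · exact hxv ▸ hvB
    · exact (hF x (Finset.mem_erase.2 ⟨hxv, hx⟩)).2

/-- The union of the two stars at an edge. -/
lemma LocallySpecial.good_edgeStar_union (h : LocallySpecial G d) {v p q : V} (hpq : G.Adj p q)
    (hvp : ¬ G.Adj v p) (hvq : ¬ G.Adj v q) (hpv : p ≠ v) (hqv : q ≠ v) {B B' : Finset V}
    (hB : ∀ b ∈ B, G.Adj b q ∧ ¬ G.Adj v b ∧ b ≠ p)
    (hB' : ∀ b ∈ B', G.Adj b p ∧ ¬ G.Adj v b ∧ b ≠ q) :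
    Good d (edgeStar G v p B ∪ edgeStar G v q B') := by
  classical
  let N : Finset V := Finset.univ.filter fun b => G.Adj b q ∧ ¬ G.Adj v b ∧ b ≠ p
  have hN : ∀ b, b ∈ N ↔ G.Adj b q ∧ ¬ G.Adj v b ∧ b ≠ p := fun b => by simp [N]
  obtain ⟨hd, hpN, hvN, hg⟩ := h.good_edgeLink hpq hvp hvq hpv (B := N) fun b hb => (hN b).1 hb
  have h1 := h.good_edgeStar hpq hvp hvq hpv hB
  have h2 := h.good_edgeStar hpq.symm hvq hvp hqv hB'
  have h3 := Good.cone v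
    (fun F hF hv => (hF.1 v hv).1 (Finset.mem_insert_of_mem (Finset.mem_singleton_self v))) hg
  obtain ⟨r, hr⟩ : ∃ r, d = r + 1 := ⟨d - 1, by omega⟩
  rw [hr] at h1 h2 ⊢
  refine .union h1 h2 ?_
  rw [show d - 2 + 1 = r by omega] at h3
  convert h3 using 1
  ext F
  have heq : F.erase v ∪ {p, v} = insert p (insert v F) := by
    ext x
    simp only [Finset.mem_union, Finset.mem_erase, Finset.mem_singleton, Finset.mem_insert]
    tauto
  change _ ↔ (∀ x ∈ F.erase v, x ∉ ({p, v} : Finset V) ∧ x ∉ N) ∧ F.erase v ∪ {p, v} ∈ _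
  rw [heq]
  constructor
  · rintro ⟨⟨-, hF1⟩, -, hF2⟩
    refine ⟨fun x hx => ?_, hF1⟩
    obtain ⟨hxv, hx⟩ := Finset.mem_erase.1 hx
    have hqx := (insert_mem_indepComplex.1 hF2).2 x (Finset.mem_insert_of_mem hx)
    refine ⟨?_, fun hxN => hqx ((hN x).1 hxN).1.symm⟩
    simp only [Finset.mem_insert, Finset.mem_singleton, not_or]
    exact ⟨fun hxp => hqx (hxp ▸ hpq.symm), hxv⟩
  · rintro ⟨hF1, hF2⟩
    have hvF := (insert_mem_indepComplex.1 hF2).1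
    have hpF := (insert_mem_indepComplex.1 hF2).2
    have hqF : ∀ x ∈ insert v F, ¬ G.Adj q x := by
      intro x hx hqx
      have hxv : x ≠ v := fun h => hvq (h ▸ hqx.symm)
      have hxF := (Finset.mem_insert.1 hx).resolve_left hxv
      have hvx := (insert_mem_indepComplex.1 hvF).2 x hxF
      have := hF1 x (Finset.mem_erase.2 ⟨hxv, hxF⟩)
      exact this.2 ((hN x).2 ⟨hqx.symm, hvx, fun hxp => this.1 (by simp [hxp])⟩)
    refine ⟨⟨fun x hx hxB => ?_, hF2⟩, fun x hx hxB => ?_, insert_mem_indepComplex.2 ⟨hvF, hqF⟩⟩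
    · exact hqF x (Finset.mem_insert_of_mem hx) (hB x hxB).1.symm
    · exact hpF x (Finset.mem_insert_of_mem hx) (hB' x hxB).1.symm

end Star

section Partial

variable {V : Type} [DecidableEq V] [Fintype V] {G : SimpleGraph V} {d : ℕ}

/-- Exponents outside the square of the localized edge ideal, all of whose generators dividing
lie in `H`. -/
def partStd (G : SimpleGraph V) (v : V) (H : Set (V → ℤ)) :
    {E : Set (V → ℤ) // E.OrdConnected} :=
  ⟨{a | 0 ≤ a ∧ (∀ g ∈ locGen G v, ∀ g' ∈ locGen G v, ¬ g + g' ≤ a) ∧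
    ∀ g ∈ locGen G v, g ≤ a → g ∈ H},
    ⟨fun _ ha _ hb _ hc => ⟨ha.1.trans hc.1, fun g hg g' hg' h => hb.2.1 g hg g' hg' (h.trans hc.2),
      fun g hg h => hb.2.2 g hg (h.trans hc.2)⟩⟩⟩

/-- The part of `partStd` above `g`. -/
def partAbove (G : SimpleGraph V) (v : V) (H : Set (V → ℤ)) (g : V → ℤ) :
    {E : Set (V → ℤ) // E.OrdConnected} :=
  ⟨{a | a ∈ (partStd G v H).1 ∧ g ≤ a},
    ⟨fun _ ha _ hb _ hc => ⟨(partStd G v H).2.out ha.1 hb.1 hc, ha.2.trans hc.1⟩⟩⟩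

/-- Condition on `b` for `b + g₀` to be in `partStd`. -/
def ShiftCond (G : SimpleGraph V) (v : V) (H : Set (V → ℤ)) (g₀ b : V → ℤ) : Prop :=
  (∀ g ∈ locGen G v, ∀ g' ∈ locGen G v, ¬ g + g' ≤ b + g₀) ∧
    ∀ g ∈ locGen G v, g ≤ b + g₀ → g ∈ insert g₀ H

lemma ShiftCond.insert_mem {v : V} {H : Set (V → ℤ)} {g₀ b : V → ℤ} (hb : 0 ≤ b)
    (hg₀ : g₀ ∈ locGen G v) (h : ShiftCond G v H g₀ b) : insert v (supp b) ∈ indepComplex G :=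
  (forall_locGen_not_le hb).1 fun g hg hgb => h.1 g hg g₀ hg₀ (add_le_add_left hgb g₀)

omit [Fintype V] in
lemma pos_of_ev_le {a : V → ℤ} {v : V} (h : ev v ≤ a) : 0 < a v := by
  have : (1 : ℤ) ≤ a v := ev_self v ▸ h v
  omega

lemma shiftCond_vertex_iff {v j : V} (hj : G.Adj v j) {H : Set (V → ℤ)} {b : V → ℤ}
    (hb : 0 ≤ b) : ShiftCond G v H (ev j) b ↔ supp b ∈ vertexStar G v := by
  refine ⟨fun h => h.insert_mem hb (Or.inl ⟨j, hj, rfl⟩), fun h => ?_⟩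
  have h2 := (insert_mem_indepComplex.1 h).2
  have h1 := (insert_mem_indepComplex.1 h).1
  have hpos : ∀ x, ev x ≤ b + ev j → x ≠ j → x ∈ supp b := fun x hx hne => by
    have := pos_of_ev_le hx
    rw [Pi.add_apply, ev_of_ne hne, add_zero] at this
    exact mem_supp.2 this
  have key : ∀ g ∈ locGen G v, g ≤ b + ev j → g = ev j := by
    rintro g (⟨j', hj', rfl⟩ | ⟨p, q, hpq, hp, hq, rfl⟩) hg
    · by_contra hne
      exact h2 j' (hpos j' hg fun h => hne (by rw [h])) hj'
    · refine absurd hpq (h1 p (hpos p ?_ ?_) q (hpos q ?_ ?_))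
      · exact (le_add_of_nonneg_right (ev_nonneg q)).trans hg
      · rintro rfl; exact hp hj
      · exact (le_add_of_nonneg_left (ev_nonneg p)).trans hg
      · rintro rfl; exact hq hj
  refine ⟨fun g hg g' hg' hle => ?_, fun g hg hle => Or.inl (key g hg hle)⟩
  have e1 := key g hg ((le_add_of_nonneg_right (locGen_nonneg hg')).trans hle)
  have e2 := key g' hg' ((le_add_of_nonneg_left (locGen_nonneg hg)).trans hle)
  rw [e1, e2] at hle
  exact h2 j (mem_supp.2 (pos_of_ev_le (le_of_add_le_add_right hle))) hj

open Classical in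
/-- The neighbours of `q` compatible with `v`, other than `p`, not recorded in `H`. -/
noncomputable def edgeBlock (G : SimpleGraph V) (v p q : V) (H : Set (V → ℤ)) : Finset V :=
  Finset.univ.filter fun w => G.Adj w q ∧ ¬ G.Adj v w ∧ w ≠ p ∧ ev q + ev w ∉ H

omit [DecidableEq V] in
lemma mem_edgeBlock [DecidableEq V] {v p q w : V} {H : Set (V → ℤ)} :
    w ∈ edgeBlock G v p q H ↔ G.Adj w q ∧ ¬ G.Adj v w ∧ w ≠ p ∧ ev q + ev w ∉ H := by
  simp [edgeBlock]

lemma shiftCond_of_mem_edgeStar {v p q : V} (hpq : G.Adj p q) (hvp : ¬ G.Adj v p)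
    (hvq : ¬ G.Adj v q) {H : Set (V → ℤ)} {b : V → ℤ}
    (h : supp b ∈ edgeStar G v p (edgeBlock G v p q (insert (ev p + ev q) H))) :
    ShiftCond G v H (ev p + ev q) b := by
  have hp := (insert_mem_indepComplex.1 h.2).2
  have h' := insert_mem_indepComplex.1 (insert_mem_indepComplex.1 h.2).1
  have hpos : ∀ x, ev x ≤ b + (ev p + ev q) → x ≠ p → x ≠ q → x ∈ supp b := fun x hx hne hne' => by
    have := pos_of_ev_le hx
    rw [Pi.add_apply, Pi.add_apply, ev_of_ne hne, ev_of_ne hne', add_zero, add_zero] at this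
    exact mem_supp.2 this
  have hqw : ∀ w, G.Adj q w → ¬ G.Adj v w → ev w ≤ b + (ev p + ev q) →
      ev q + ev w ∈ insert (ev p + ev q) H := by
    intro w hqw hvw hw
    by_cases hwp : w = p
    · rw [hwp, add_comm]
      exact Or.inl rfl
    · by_contra hcon
      exact h.1 w (hpos w hw hwp hqw.ne') (mem_edgeBlock.2 ⟨hqw.symm, hvw, hwp, hcon⟩)
  have key : ∀ g ∈ locGen G v, g ≤ b + (ev p + ev q) →
      ev q ≤ g ∧ g ∈ insert (ev p + ev q) H := by
    rintro g (⟨j, hj, rfl⟩ | ⟨x, y, hxy, hx, hy, rfl⟩) hg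
    · exact absurd hj (h'.2 j (hpos j hg (fun h => hvp (h ▸ hj)) fun h => hvq (h ▸ hj)))
    · have hxb : ev x ≤ b + (ev p + ev q) := (le_add_of_nonneg_right (ev_nonneg y)).trans hg
      have hyb : ev y ≤ b + (ev p + ev q) := (le_add_of_nonneg_left (ev_nonneg x)).trans hg
      by_cases hxq : x = q
      · subst hxq
        exact ⟨le_add_of_nonneg_right (ev_nonneg y), hqw y hxy hy hyb⟩
      by_cases hyq : y = q
      · subst hyq
        rw [add_comm (ev x)]
        exact ⟨le_add_of_nonneg_right (ev_nonneg x), hqw x hxy.symm hx hxb⟩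
      exfalso
      by_cases hxp : x = p
      · subst hxp
        exact hp y (Finset.mem_insert_of_mem (hpos y hyb hxy.ne' hyq)) hxy
      by_cases hyp : y = p
      · subst hyp
        exact hp x (Finset.mem_insert_of_mem (hpos x hxb hxy.ne hxq)) hxy.symm
      exact h'.1 x (hpos x hxb hxp hxq) y (hpos y hyb hyp hyq) hxy
  refine ⟨fun g hg g' hg' hle => ?_, fun g hg hle => (key g hg hle).2⟩
  have e1 := (key g hg ((le_add_of_nonneg_right (locGen_nonneg hg')).trans hle)).1
  have e2 := (key g' hg' ((le_add_of_nonneg_left (locGen_nonneg hg)).trans hle)).1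
  have := ((add_le_add e1 e2).trans hle) q
  simp only [Pi.add_apply, ev_self, ev_of_ne hpq.ne'] at this
  exact hp q (Finset.mem_insert_of_mem (mem_supp.2 (by omega))) hpq

lemma mem_edgeStar_of_shiftCond {v p q : V} (hvq : ¬ G.Adj v q) {H : Set (V → ℤ)} {b : V → ℤ}
    (hb : 0 ≤ b) (h : ShiftCond G v H (ev p + ev q) b) (hs : insert v (supp b) ∈ indepComplex G)
    (hp : ∀ x ∈ supp b, ¬ G.Adj p x) (hvp : ¬ G.Adj v p) :
    supp b ∈ edgeStar G v p (edgeBlock G v p q (insert (ev p + ev q) H)) := by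
  refine ⟨fun x hx hxB => ?_, insert_mem_indepComplex.2 ⟨hs, fun x hx => ?_⟩⟩
  · obtain ⟨hxq, hvx, hxp, hn⟩ := mem_edgeBlock.1 hxB
    refine hn (h.2 _ (Or.inr ⟨q, x, hxq.symm, hvq, hvx, rfl⟩) ?_)
    rw [add_comm]
    exact add_le_add ((ev_le_iff hb).2 (mem_supp.1 hx)) (le_add_of_nonneg_left (ev_nonneg p))
  · rcases Finset.mem_insert.1 hx with rfl | hx
    · exact fun h => hvp h.symm
    · exact hp x hx

lemma LocallySpecial.shiftCond_edge_iff (hG : LocallySpecial G d) {v p q : V} (hpq : G.Adj p q)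
    (hvp : ¬ G.Adj v p) (hvq : ¬ G.Adj v q) {H : Set (V → ℤ)} {b : V → ℤ} (hb : 0 ≤ b) :
    ShiftCond G v H (ev p + ev q) b ↔
      supp b ∈ edgeStar G v p (edgeBlock G v p q (insert (ev p + ev q) H)) ∪
        edgeStar G v q (edgeBlock G v q p (insert (ev p + ev q) H)) := by
  constructor
  · intro h
    have hs := h.insert_mem hb (Or.inr ⟨p, q, hpq, hvp, hvq, rfl⟩)
    have hs' := insert_mem_indepComplex.1 hs
    by_cases hp : ∀ x ∈ supp b, ¬ G.Adj p x
    · exact Or.inl (mem_edgeStar_of_shiftCond hvq hb h hs hp hvp)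
    by_cases hq : ∀ x ∈ supp b, ¬ G.Adj q x
    · right
      rw [add_comm] at h ⊢
      exact mem_edgeStar_of_shiftCond hvp hb h hs hq hvq
    push Not at hp hq
    obtain ⟨u, hu, hpu⟩ := hp
    obtain ⟨w, hw, hqw⟩ := hq
    have huw : u ≠ w := by
      rintro rfl
      exact hG.no_triangle v p q u hpq hqw hpu hvp hvq (hs'.2 u hu)
    refine absurd ?_ (h.1 _ (Or.inr ⟨p, u, hpu, hvp, hs'.2 u hu, rfl⟩) _
      (Or.inr ⟨q, w, hqw, hvq, hs'.2 w hw, rfl⟩))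
    have : ev u + ev w ≤ b := (ev_add_ev_le_iff hb huw).2 ⟨mem_supp.1 hu, mem_supp.1 hw⟩
    calc ev p + ev u + (ev q + ev w) = (ev u + ev w) + (ev p + ev q) := by abel
      _ ≤ _ := add_le_add_left this _
  · rintro (h | h)
    · exact shiftCond_of_mem_edgeStar hpq hvp hvq h
    · rw [add_comm] at h ⊢
      exact shiftCond_of_mem_edgeStar hpq.symm hvq hvp h

omit [Fintype V] in
lemma vertexStar_isSimplicialComplex (v : V) : IsSimplicialComplex (vertexStar G v) :=
  fun _ hF _ hsub => indepComplex_subset hF (Finset.insert_subset_insert v hsub)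

omit [Fintype V] in
lemma edgeStar_isSimplicialComplex (v p : V) (B : Finset V) :
    IsSimplicialComplex (edgeStar G v p B) :=
  fun _ hF _ hsub => ⟨fun x hx => hF.1 x (hsub hx),
    indepComplex_subset hF.2 (Finset.insert_subset_insert p (Finset.insert_subset_insert v hsub))⟩

lemma LocallySpecial.exists_shiftCond_complex (hG : LocallySpecial G d) {v : V} {g : V → ℤ}
    (hg : g ∈ locGen G v) (H : Set (V → ℤ)) :
    ∃ X : Set (Finset V), IsSimplicialComplex X ∧ Good d X ∧
      ∀ b, 0 ≤ b → (ShiftCond G v H g b ↔ supp b ∈ X) := by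
  obtain ⟨j, hj, rfl⟩ | ⟨p, q, hpq, hp, hq, rfl⟩ := hg
  · exact ⟨_, vertexStar_isSimplicialComplex v, hG.good_star v,
      fun b hb => shiftCond_vertex_iff hj hb⟩
  · refine ⟨_, ?_, ?_, fun b hb => hG.shiftCond_edge_iff hpq hp hq hb⟩
    · rintro F (hF | hF) F' hsub
      · exact Or.inl (edgeStar_isSimplicialComplex _ _ _ F hF F' hsub)
      · exact Or.inr (edgeStar_isSimplicialComplex _ _ _ F hF F' hsub)
    · refine hG.good_edgeStar_union hpq hp hq ?_ ?_ ?_ ?_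
      · rintro rfl; exact hq hpq
      · rintro rfl; exact hp hpq.symm
      · exact fun b hb => let h := mem_edgeBlock.1 hb; ⟨h.1, h.2.1, h.2.2.1⟩
      · exact fun b hb => let h := mem_edgeBlock.1 hb; ⟨h.1, h.2.1, h.2.2.1⟩

variable {k : Type} [Field k]

lemma LocallySpecial.van_partStd (hG : LocallySpecial G d) (v : V) {H : Set (V → ℤ)}
    (hH : H.Finite) : Van (maxIdeal k V) d (DM k (partStd G v H)) := by
  induction H, hH using Set.Finite.induction_on with
  | empty =>
    obtain ⟨e⟩ := DM.nonempty_equiv (k := k) (E := cs (vertexStar G v)) (E' := partStd G v ∅) 0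
      (fun a => by
        rw [sub_zero, mem_cs (vertexStar_isSimplicialComplex v)]
        refine and_congr_right fun ha => ?_
        change _ ↔ insert v (supp a) ∈ indepComplex G
        rw [← forall_locGen_not_le ha]
        exact ⟨fun h g hg hga => h.2 g hg hga, fun h => ⟨fun g hg g' hg' hle =>
          h g hg ((le_add_of_nonneg_right (locGen_nonneg hg')).trans hle),
          fun g hg hga => h g hg hga⟩⟩)
    exact (hG.good_star v).van.congr e
  | @insert g H hgH _ ih =>
    by_cases hg : g ∈ locGen G v
    · refine Van.of_ses (E₁ := partStd G v H) (E₂ := partAbove G v (insert g H) g)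
        (fun a => ?_) (fun a h1 h2 => hgH (h1.2.2 g hg h2.2))
        (fun a ha b hb hab => hgH (hb.2.2 g hg (ha.2.trans hab))) ih ?_
      · constructor
        · intro ha
          by_cases hga : g ≤ a
          · exact Or.inr ⟨ha, hga⟩
          · refine Or.inl ⟨ha.1, ha.2.1, fun g' hg' hle => (ha.2.2 g' hg' hle).resolve_left ?_⟩
            rintro rfl
            exact hga hle
        · rintro (ha | ha)
          · exact ⟨ha.1, ha.2.1, fun g' hg' hle => Or.inr (ha.2.2 g' hg' hle)⟩
          · exact ha.1
      · obtain ⟨X, hX, hgood, hiff⟩ := hG.exists_shiftCond_complex hg H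
        obtain ⟨e⟩ := DM.nonempty_equiv (k := k) (E := cs X)
          (E' := partAbove G v (insert g H) g) g (fun a => by
            rw [mem_cs hX, sub_nonneg]
            constructor
            · intro ha
              refine ⟨ha.2, (hiff _ (sub_nonneg.2 ha.2)).1 ?_⟩
              rw [ShiftCond, sub_add_cancel]
              exact ha.1.2
            · intro ha
              have := (hiff _ (sub_nonneg.2 ha.1)).2 ha.2
              rw [ShiftCond, sub_add_cancel] at this
              exact ⟨⟨(locGen_nonneg hg).trans ha.1, this⟩, ha.1⟩)
        exact hgood.van.congr e
    · have : partStd G v (insert g H) = partStd G v H := by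
        refine Subtype.ext (Set.ext fun a => and_congr_right fun _ => and_congr_right fun _ =>
          forall₂_congr fun g' hg' => imp_congr_right fun _ => ?_)
        refine ⟨fun h => h.resolve_left ?_, Or.inr⟩
        rintro rfl
        exact hg hg'
      rwa [this]

end Partial

section SquareOfSpecial

variable {V : Type} [DecidableEq V] [Fintype V] {G : SimpleGraph V} {d : ℕ} {k : Type} [Field k]

omit [Fintype V] in
lemma tvec_singleton (v : V) (s : ℕ) : tvec {v} s = s • ev v := by
  funext w
  by_cases h : w = v
  · simp [tvec, h]
  · simp [tvec, h]

omit [Fintype V] in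
lemma exists_locGen_le (v : V) {p q : V} (hpq : G.Adj p q) :
    ∃ g ∈ locGen G v, g ≤ ev p + ev q := by
  by_cases hp : G.Adj v p
  · exact ⟨_, Or.inl ⟨p, hp, rfl⟩, le_add_of_nonneg_right (ev_nonneg q)⟩
  by_cases hq : G.Adj v q
  · exact ⟨_, Or.inl ⟨q, hq, rfl⟩, le_add_of_nonneg_left (ev_nonneg p)⟩
  exact ⟨_, Or.inr ⟨p, q, hpq, hp, hq, rfl⟩, le_rfl⟩

omit [Fintype V] in
lemma exists_edge_le {v : V} {g : V → ℤ} (hg : g ∈ locGen G v) :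
    ∃ p q, G.Adj p q ∧ ev p + ev q ≤ g + ev v := by
  obtain ⟨j, hj, rfl⟩ | ⟨p, q, hpq, -, -, rfl⟩ := hg
  · exact ⟨j, v, hj.symm, le_rfl⟩
  · exact ⟨p, q, hpq, le_add_of_nonneg_right (ev_nonneg v)⟩

lemma LocallySpecial.sq_smul_eq_zero (hG : LocallySpecial G d) (v : V) {i : ℕ} (hi : i < d)
    (h : LC (maxIdeal k V) i (DM k (outside (isUpperSet_sqExp G)))) :
    (X v ^ 2 : MvPolynomial V k) • h = 0 := by
  have hsub : ∀ a ∈ (partStd G v (locGen G v)).1, a ∈ (outside (isUpperSet_sqExp G)).1 := by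
    refine fun a ha => ⟨ha.1, ?_⟩
    rintro ⟨p, q, p', q', hpq, hpq', hle⟩
    obtain ⟨g, hg, hgle⟩ := exists_locGen_le v hpq
    obtain ⟨g', hg', hgle'⟩ := exists_locGen_le v hpq'
    exact ha.2.1 g hg g' hg' ((add_le_add hgle hgle').trans hle)
  have hsh : ∀ a ∈ (outside (isUpperSet_sqExp G)).1,
      a - tvec {v} 2 ∈ (outside (isUpperSet_sqExp G)).1 →
      a - tvec {v} 2 ∈ (partStd G v (locGen G v)).1 := by
    refine fun a ha ha' => ⟨ha'.1, fun g hg g' hg' hle => ha.2 ?_, fun g hg _ => hg⟩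
    obtain ⟨p, q, hpq, h1⟩ := exists_edge_le hg
    obtain ⟨p', q', hpq', h2⟩ := exists_edge_le hg'
    refine ⟨p, q, p', q', hpq, hpq', (add_le_add h1 h2).trans ?_⟩
    rw [tvec_singleton, le_sub_iff_add_le] at hle
    refine le_trans (le_of_eq ?_) hle
    abel
  obtain ⟨α, β, hβα, -⟩ := DM.exists_factor (k := k) hsub
    (fun a ha b hb hba => ⟨hb.1, fun g hg g' hg' h => ha.2.1 g hg g' hg' (h.trans hba),
      fun g hg _ => hg⟩) {v} 2 hsh
  have := hG.van_partStd (k := k) v (locGen_finite (G := G) v) i hi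
  have := LC.smul_eq_zero_of_factor (y := 1) hβα (fun h => Subsingleton.elim _ _) h
  rwa [mul_one, xT, Finset.prod_singleton] at this

theorem LocallySpecial.quotGCM_sq (hG : LocallySpecial G d) :
    quotGCM k V (edgeIdeal k G ^ 2) := by
  intro i hi
  have hid : i < d := by
    have := lt_of_lt_of_le hi (ringKrullDim_edgeIdeal_sq_le hG.card_le)
    exact Nat.cast_lt.1 this
  obtain ⟨e⟩ := nonempty_quotient_equiv (k := k) (isUpperSet_sqExp G) mem_edgeIdeal_sq
  let A : Ideal (MvPolynomial V k) := ⨅ j : Fin (i + 1), Module.annihilator (MvPolynomial V k)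
    (LC (maxIdeal k V) j (MvPolynomial V k ⧸ edgeIdeal k G ^ 2))
  obtain ⟨N, hN⟩ := maxIdeal_pow_le (A := A) (r := 2) (fun v => by
    refine (Submodule.mem_iInf _).2 fun j => Module.mem_annihilator.2 fun h => ?_
    refine (LC.congr (J := maxIdeal k V) (i := j) e).injective ?_
    rw [map_smul, map_zero]
    exact hG.sq_smul_eq_zero v (by omega) _)
  refine LC.isFiniteLength maxIdeal_isMaximal i N _ fun j hj r hr h => ?_
  exact Module.mem_annihilator.1 ((Submodule.mem_iInf _).1 (hN hr) ⟨j, by omega⟩) h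

end SquareOfSpecial

section ReisnerSide

variable {V : Type} [DecidableEq V] {k : Type} [Field k]

lemma notMem_srExp_iff [Fintype V] {Δ : Set (Finset V)} (hΔ : IsSimplicialComplex Δ) {a : V → ℤ}
    (ha : 0 ≤ a) : a ∉ srExp Δ ↔ supp a ∈ Δ := by
  have key : ∀ F : Finset V, tvec F 1 ≤ a ↔ F ⊆ supp a := by
    refine fun F => ⟨fun h v hv => mem_supp.2 ?_, fun h v => ?_⟩
    · have := h v
      simp only [tvec, if_pos hv] at this
      exact_mod_cast this
    · by_cases hv : v ∈ F
      · simp only [tvec, if_pos hv]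
        exact_mod_cast mem_supp.1 (h hv)
      · simp only [tvec, if_neg hv]
        exact ha v
  constructor
  · intro h
    by_contra hs
    exact h ⟨_, hs, (key _).2 subset_rfl⟩
  · rintro h ⟨F, hF, hle⟩
    exact hF (hΔ _ h F ((key F).1 hle))

lemma Good.quotCM [Fintype V] {r : ℕ} {Δ : Set (Finset V)} (h : Good r Δ)
    (hcard : ∀ F ∈ Δ, F.card ≤ r) : quotCM k V (srIdeal k Δ) := by
  intro i hi
  have hir : i < r := by
    have := lt_of_lt_of_le hi (ringKrullDim_srIdeal_le hcard)
    exact Nat.cast_lt.1 this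
  obtain ⟨e⟩ := nonempty_quotient_equiv (k := k) (isUpperSet_srExp Δ) mem_srIdeal
  obtain ⟨e'⟩ := DM.nonempty_equiv (k := k) (E := outside (isUpperSet_srExp Δ)) (E' := cs Δ) 0
    (fun a => by
      rw [sub_zero, mem_cs h.isSimplicialComplex]
      exact and_congr_right fun ha => (notMem_srExp_iff h.isSimplicialComplex ha).symm)
  exact h.van.congr (e.trans e').symm i hir

omit [DecidableEq V] in
lemma empty_mem_indepComplex (G : SimpleGraph V) : (∅ : Finset V) ∈ indepComplex G := by
  simp [indepComplex]

omit [DecidableEq V] in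
lemma indepNumber_eq {G : SimpleGraph V} {r : ℕ} (h : ∀ F ∈ indepComplex G, F.card ≤ r)
    (h' : ∃ F ∈ indepComplex G, r ≤ F.card) : indepNumber G = r := by
  obtain ⟨F, hF, hr⟩ := h'
  refine IsGreatest.csSup_eq ⟨⟨F, hF, le_antisymm (h F hF) hr⟩, ?_⟩
  rintro c ⟨F, hF, rfl⟩
  exact h F hF

lemma Good.indepNumber_eq {G : SimpleGraph V} {r : ℕ} (hG : Good r (indepComplex G))
    (h : ∀ F ∈ indepComplex G, F.card ≤ r) : indepNumber G = r :=
  _root_.indepNumber_eq h (hG.exists_face (empty_mem_indepComplex G))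

variable [Fintype V] {G : SimpleGraph V} {d : ℕ}

omit [Fintype V] in
lemma LocallySpecial.graphUnmixed (h : LocallySpecial G d) : graphUnmixed G := by
  have key : ∀ F ∈ facets (indepComplex G), F.card = d := by
    intro F hF
    refine le_antisymm (h.card_le F hF.1) ?_
    by_contra! hlt
    obtain ⟨a, ha, hins⟩ := h.exists_insert F hF.1 hlt
    exact ha (hF.2 _ hins (Finset.subset_insert a F) ▸ Finset.mem_insert_self a F)
  exact fun F hF F' hF' => (key F hF).trans (key F' hF').symm

omit [Fintype V] in
lemma mem_indepComplex_vertexLoc {i : V} (F : Finset (vertexLocSet G i)) :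
    F ∈ indepComplex (vertexLoc G i) ↔
      F.map (Function.Embedding.subtype _) ∈ link G {i} ∅ := by
  have : F.map (Function.Embedding.subtype _) ∪ {i} =
      insert i (F.map (Function.Embedding.subtype _)) := by
    rw [Finset.union_comm]; rfl
  change _ ↔ _ ∧ F.map (Function.Embedding.subtype _) ∪ {i} ∈ _
  rw [this, insert_mem_indepComplex]
  constructor
  · intro h
    refine ⟨fun x hx => ?_, fun x hx y hy => ?_, fun x hx => ?_⟩
    · obtain ⟨x, -, rfl⟩ := Finset.mem_map.1 hx
      exact ⟨by simpa using x.2.1, Finset.notMem_empty _⟩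
    · obtain ⟨x, hx', rfl⟩ := Finset.mem_map.1 hx
      obtain ⟨y, hy', rfl⟩ := Finset.mem_map.1 hy
      exact h x hx' y hy'
    · obtain ⟨x, hx, rfl⟩ := Finset.mem_map.1 hx
      exact x.2.2
  · rintro ⟨-, h, -⟩ x hx y hy
    exact h x (Finset.mem_map_of_mem _ hx) y (Finset.mem_map_of_mem _ hy)

lemma LocallySpecial.good_vertexLoc (h : LocallySpecial G d) (i : V) :
    Good (d - 1) (indepComplex (vertexLoc G i)) := by
  have hd := h.card_le _ (singleton_mem_indepComplex i)
  rw [Finset.card_singleton] at hd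
  have := h.good_link (d + 1) {i} (by omega) (Finset.singleton_nonempty i)
    (singleton_mem_indepComplex i) ∅ (empty_mem_indepComplex G) (Finset.disjoint_empty_left _)
    (by simp)
  rw [Finset.card_singleton] at this
  convert this.preimage (Function.Embedding.subtype (· ∈ vertexLocSet G i)) ?_ using 1
  · ext F
    exact mem_indepComplex_vertexLoc F
  · intro F hF v hv
    refine ⟨⟨v, ?_, ?_⟩, rfl⟩
    · exact fun hvi => (hF.1 v hv).1 (by simp [hvi])
    · exact hF.2 i (by simp) v (Finset.mem_union_left _ hv)

omit [Fintype V] in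
lemma LocallySpecial.card_vertexLoc (h : LocallySpecial G d) (i : V) :
    ∀ F ∈ indepComplex (vertexLoc G i), F.card ≤ d - 1 := by
  intro F hF
  have h1 := (mem_indepComplex_vertexLoc F).1 hF
  have h2 := h.card_le _ h1.2
  rw [Finset.card_union_of_disjoint, Finset.card_map, Finset.card_singleton] at h2
  · omega
  · exact Finset.disjoint_left.2 fun x hx => (h1.1 x hx).1

/-- The inclusion of the vertices of an edge localization of a vertex localization. -/
def edgeLocEmb (G : SimpleGraph V) (i : V) (p q : vertexLocSet G i) :
    edgeLocSet (vertexLoc G i) p q ↪ V :=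
  (Function.Embedding.subtype _).trans (Function.Embedding.subtype _)

omit [Fintype V] in
lemma mem_indepComplex_edgeLoc {i : V} {p q : vertexLocSet G i} (hpq : (vertexLoc G i).Adj p q)
    {B : Finset V} (hB : ∀ b, b ∈ B ↔ G.Adj b q ∧ ¬ G.Adj i b ∧ b ≠ p)
    (F : Finset (edgeLocSet (vertexLoc G i) p q)) :
    F ∈ indepComplex (edgeLoc (vertexLoc G i) p q) ↔
      F.map (edgeLocEmb G i p q) ∈ link G {p.1, i} B := by
  have : F.map (edgeLocEmb G i p q) ∪ {p.1, i} =
      insert p.1 (insert i (F.map (edgeLocEmb G i p q))) := by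
    rw [Finset.union_comm, Finset.insert_union, Finset.singleton_union]
  change _ ↔ _ ∧ F.map (edgeLocEmb G i p q) ∪ {p.1, i} ∈ _
  rw [this, insert_mem_indepComplex, insert_mem_indepComplex]
  constructor
  · intro h
    refine ⟨fun x hx => ?_, ⟨fun x hx y hy => ?_, fun x hx => ?_⟩, fun x hx => ?_⟩
    · obtain ⟨x, -, rfl⟩ := Finset.mem_map.1 hx
      refine ⟨?_, fun hxB => x.2 (Or.inr ((hB _).1 hxB).1.symm)⟩
      simp only [Finset.mem_insert, Finset.mem_singleton, not_or]
      refine ⟨fun hxp => x.2 (Or.inr ?_), x.1.2.1⟩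
      rw [show x.1 = p from Subtype.ext hxp]
      exact hpq.symm
    · obtain ⟨x, hx', rfl⟩ := Finset.mem_map.1 hx
      obtain ⟨y, hy', rfl⟩ := Finset.mem_map.1 hy
      exact h x hx' y hy'
    · obtain ⟨x, hx, rfl⟩ := Finset.mem_map.1 hx
      exact x.1.2.2
    · rcases Finset.mem_insert.1 hx with rfl | hx
      · exact fun h => p.2.2 h.symm
      · obtain ⟨x, hx, rfl⟩ := Finset.mem_map.1 hx
        exact fun h => x.2 (Or.inl h)
  · rintro ⟨-, ⟨h, -⟩, -⟩ x hx y hy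
    exact h _ (Finset.mem_map_of_mem _ hx) _ (Finset.mem_map_of_mem _ hy)

lemma LocallySpecial.specialCM_edgeLoc (h : LocallySpecial G d) {i : V} {p q : vertexLocSet G i}
    (hpq : (vertexLoc G i).Adj p q) :
    2 ≤ d ∧ Good (d - 2) (indepComplex (edgeLoc (vertexLoc G i) p q)) ∧
      ∀ F ∈ indepComplex (edgeLoc (vertexLoc G i) p q), F.card ≤ d - 2 := by
  classical
  let B : Finset V := Finset.univ.filter fun b => G.Adj b q ∧ ¬ G.Adj i b ∧ b ≠ p
  have hB : ∀ b, b ∈ B ↔ G.Adj b q ∧ ¬ G.Adj i b ∧ b ≠ p := fun b => by simp [B]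
  obtain ⟨hd, -, -, hg⟩ := h.good_edgeLink (v := i) hpq p.2.2 q.2.2 p.2.1 (B := B)
    fun b hb => (hB b).1 hb
  refine ⟨hd, ?_, fun F hF => ?_⟩
  · convert hg.preimage (edgeLocEmb G i p q) ?_ using 1
    · ext F
      exact mem_indepComplex_edgeLoc hpq hB F
    · intro F hF v hv
      have h1 := hF.1 v hv
      simp only [Finset.mem_insert, Finset.mem_singleton, not_or] at h1
      have hiv : ¬ G.Adj i v := hF.2 i (by simp) v (Finset.mem_union_left _ hv)
      refine ⟨⟨⟨v, h1.1.2, hiv⟩, ?_⟩, rfl⟩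
      rintro (hpv | hqv)
      · exact hF.2 p.1 (by simp) v (Finset.mem_union_left _ hv) hpv
      · exact h1.2 ((hB v).2 ⟨SimpleGraph.Adj.symm hqv, hiv, h1.1.1⟩)
  · have h1 := (mem_indepComplex_edgeLoc hpq hB F).1 hF
    have h2 := h.card_le _ h1.2
    rw [Finset.card_union_of_disjoint, Finset.card_map, Finset.card_pair p.2.1] at h2
    · omega
    · exact Finset.disjoint_left.2 fun x hx => (h1.1 x hx).1

theorem LocallySpecial.specialCM_vertexLoc (h : LocallySpecial G d) (i : V) :
    specialCM (vertexLoc G i) := by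
  classical
  refine ⟨fun k _ => (h.good_vertexLoc i).quotCM (h.card_vertexLoc i), fun p q hpq => ?_⟩
  obtain ⟨hd, hgood, hcard⟩ := h.specialCM_edgeLoc hpq
  refine ⟨fun k _ => hgood.quotCM hcard, ?_⟩
  rw [hgood.indepNumber_eq hcard, (h.good_vertexLoc i).indepNumber_eq (h.card_vertexLoc i)]
  omega

omit [Fintype V] in
theorem LocallySpecial.cliqueFree_vertexLoc (h : LocallySpecial G d) (i : V) :
    (vertexLoc G i).CliqueFree 3 := by
  intro s hs
  obtain ⟨a, b, c, hab, hac, hbc, -⟩ := SimpleGraph.is3Clique_iff.1 hs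
  exact h.no_triangle i a b c hab hbc hac a.2.2 b.2.2 c.2.2

end ReisnerSide

section Annihilation

variable {R : Type} [CommRing R] {J : Ideal R} {A B C : Type} [AddCommGroup A] [Module R A]
  [AddCommGroup B] [Module R B] [AddCommGroup C] [Module R C]

/-- The element `y` annihilates the local cohomology of `M` in degree `i`. -/
def Kills (J : Ideal R) (i : ℕ) (y : R) (M : Type) [AddCommGroup M] [Module R M] : Prop :=
  ∀ h : LC J i M, y • h = 0

lemma Kills.smul_eq_zero {y : R} (h : Kills J 0 y A) {x : A} (hx : x ∈ powTorsion J A) :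
    y • x = 0 := by
  obtain ⟨z, rfl⟩ := LC.exists_toModule_eq hx
  rw [← map_smul, show y • z = 0 from h z, map_zero]

lemma Kills.of_ses {f : A →ₗ[R] B} {g : B →ₗ[R] C} (hf : Function.Injective f)
    (hg : Function.Surjective g) (hfg : Function.Exact f g) {i : ℕ} {y : R}
    (hB : Subsingleton (LC J i B)) (h : Kills J (i + 1) y A) : Kills J i y C := by
  obtain ⟨-, δ, h1, -⟩ := LC.exists_delta (J := J) hf hg hfg i
  intro z
  have : δ (y • z) = 0 := by rw [map_smul]; exact h _
  obtain ⟨u, hu⟩ := (h1 _).1 this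
  rw [← hu, Subsingleton.elim u 0, map_zero]

lemma Kills.smul_mem_range {f : A →ₗ[R] B} (hf : Function.Injective f) {y : R}
    (hB : Subsingleton (LC J 0 B)) (h : Kills J 1 y A) {N : ℕ} {e : B}
    (he : ∀ r ∈ J ^ N, r • e ∈ LinearMap.range f) : ∃ w, f w = y • e := by
  have hk := Kills.of_ses hf (LinearMap.range f).mkQ_surjective
    (LinearMap.exact_map_mkQ_range f) hB h
  have : y • (LinearMap.range f).mkQ e = 0 := by
    refine hk.smul_eq_zero ⟨N, fun r hr => ?_⟩
    rw [← map_smul, Submodule.mkQ_apply, Submodule.Quotient.mk_eq_zero]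
    exact he r hr
  rw [← map_smul, Submodule.mkQ_apply, Submodule.Quotient.mk_eq_zero] at this
  exact this

end Annihilation

section Localized

variable {V : Type} [DecidableEq V] {k : Type} [Field k] {J : Set (V → ℤ)}

/-- Exponents outside the localization of an upper set at the variables of `T`. -/
def locStd (J : Set (V → ℤ)) (T : Finset V) : Set (V → ℤ) :=
  {a | (∀ v ∉ T, 0 ≤ a v) ∧ ∀ N : ℕ, a + tvec T N ∉ J}

lemma locStd_ordConnected (hJ : IsUpperSet J) (T : Finset V) : (locStd J T).OrdConnected :=
  ⟨fun _ ha _ hb _ hc => ⟨fun v hv => (ha.1 v hv).trans (hc.1 v),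
    fun N h => hb.2 N (hJ (add_le_add_left hc.2 _) h)⟩⟩

lemma locStd_congr (hJ : IsUpperSet J) {T : Finset V} {a c : V → ℤ} (h : ∀ v ∉ T, a v = c v)
    (ha : a ∈ locStd J T) : c ∈ locStd J T := by
  refine ⟨fun v hv => h v hv ▸ ha.1 v hv, fun N hN => ?_⟩
  let M : ℕ := ∑ v ∈ T, (c v - a v).natAbs
  refine ha.2 (N + M) (hJ (fun v => ?_) hN)
  simp only [Pi.add_apply, tvec]
  by_cases hv : v ∈ T
  · have : (c v - a v).natAbs ≤ M :=
      Finset.single_le_sum (f := fun v => (c v - a v).natAbs) (fun _ _ => Nat.zero_le _) hv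
    simp only [if_pos hv]
    push_cast
    omega
  · simp only [if_neg hv]
    rw [h v hv]

/-- The part of `locStd` negative on `U` and nonnegative elsewhere. -/
def negPart (hJ : IsUpperSet J) (T U : Finset V) : {E : Set (V → ℤ) // E.OrdConnected} :=
  ⟨{a | a ∈ locStd J T ∧ (∀ v ∈ U, a v < 0) ∧ ∀ v ∉ U, 0 ≤ a v},
    ⟨fun _ ha _ hb _ hc => ⟨(locStd_ordConnected hJ T).out ha.1 hb.1 hc,
      fun v hv => (hc.2 v).trans_lt (hb.2.1 v hv), fun v hv => (ha.2.2 v hv).trans (hc.1 v)⟩⟩⟩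

/-- The part of `locStd` negative on `U`, arbitrary at `v` and nonnegative elsewhere. -/
def negPartFree (hJ : IsUpperSet J) (T U : Finset V) (v : V) :
    {E : Set (V → ℤ) // E.OrdConnected} :=
  ⟨{a | a ∈ locStd J T ∧ (∀ u ∈ U, a u < 0) ∧ ∀ u ∉ U, u ≠ v → 0 ≤ a u},
    ⟨fun _ ha _ hb _ hc => ⟨(locStd_ordConnected hJ T).out ha.1 hb.1 hc,
      fun u hu => (hc.2 u).trans_lt (hb.2.1 u hu),
      fun u hu huv => (ha.2.2 u hu huv).trans (hc.1 u)⟩⟩⟩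

lemma Kills.negPart_insert (hJ : IsUpperSet J) {T U : Finset V} {v : V} (hvT : v ∈ T)
    (hvU : v ∉ U) {i : ℕ} {y : MvPolynomial V k}
    (h : Kills (maxIdeal k V) (i + 1) y (DM k (negPart hJ T U))) :
    Kills (maxIdeal k V) i y (DM k (negPart hJ T (insert v U))) := by
  have hE : ∀ a, a ∈ (negPartFree hJ T U v).1 ↔
      a ∈ (negPart hJ T (insert v U)).1 ∨ a ∈ (negPart hJ T U).1 := by
    intro a
    constructor
    · intro ha
      by_cases hv : 0 ≤ a v
      · refine Or.inr ⟨ha.1, ha.2.1, fun u hu => ?_⟩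
        by_cases huv : u = v
        · exact huv ▸ hv
        · exact ha.2.2 u hu huv
      · refine Or.inl ⟨ha.1, fun u hu => ?_, fun u hu => ?_⟩
        · rcases Finset.mem_insert.1 hu with rfl | hu
          · exact not_le.1 hv
          · exact ha.2.1 u hu
        · rw [Finset.mem_insert, not_or] at hu
          exact ha.2.2 u hu.2 hu.1
    · rintro (ha | ha)
      · exact ⟨ha.1, fun u hu => ha.2.1 u (Finset.mem_insert_of_mem hu),
          fun u hu huv => ha.2.2 u (by simp [hu, huv])⟩
      · exact ⟨ha.1, ha.2.1, fun u hu _ => ha.2.2 u hu⟩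
  obtain ⟨f, g, hf, hg, hfg, -⟩ := DM.exists_ses (k := k) (E := negPartFree hJ T U v)
    (E₁ := negPart hJ T (insert v U)) (E₂ := negPart hJ T U) hE
    (fun a h1 h2 => (h1.2.1 v (Finset.mem_insert_self v U)).not_ge (h2.2.2 v hvU))
    (fun a ha b hb hab => (hb.2.1 v (Finset.mem_insert_self v U)).not_ge
      ((ha.2.2 v hvU).trans (hab v)))
  refine Kills.of_ses hf hg hfg (LC.subsingleton_of_invariant v (fun a => ?_) i) h
  have hne : ∀ u, u ≠ v → (a - tvec {v} 1) u = a u := fun u hu => by simp [tvec, hu]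
  have hU : ∀ u ∈ U, u ≠ v := fun u hu huv => hvU (huv ▸ hu)
  refine and_congr ⟨locStd_congr hJ fun u hu => (hne u fun h => hu (h ▸ hvT)).symm,
    locStd_congr hJ fun u hu => hne u fun h => hu (h ▸ hvT)⟩ (and_congr ?_ ?_)
  · exact forall₂_congr fun u hu => by rw [hne u (hU u hu)]
  · exact forall₃_congr fun u _ huv => by rw [hne u huv]

lemma Kills.negPart_of_empty (hJ : IsUpperSet J) {T : Finset V} {y : MvPolynomial V k}
    (U : Finset V) : ∀ i, U ⊆ T →
    Kills (maxIdeal k V) (i + U.card) y (DM k (negPart hJ T ∅)) →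
    Kills (maxIdeal k V) i y (DM k (negPart hJ T U)) := by
  induction U using Finset.induction_on with
  | empty => exact fun i _ h => h
  | insert v U hv ih =>
    intro i hU h
    rw [Finset.card_insert_of_notMem hv, add_comm U.card, ← add_assoc] at h
    exact .negPart_insert hJ (hU (Finset.mem_insert_self v U)) hv
      (ih (i + 1) ((Finset.subset_insert v U).trans hU) h)

lemma Kills.negPart_self (hJ : IsUpperSet J) {T : Finset V} {r s i : ℕ}
    (hr : ∀ a, 0 ≤ a → (∃ N : ℕ, a + tvec T N ∈ J) → a + tvec T r ∈ J)
    (h : Kills (maxIdeal k V) (i + T.card) (xT k T s) (DM k (outside hJ))) :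
    Kills (maxIdeal k V) i (xT k T (r + s)) (DM k (negPart hJ T T)) := by
  refine .negPart_of_empty hJ T i subset_rfl ?_
  obtain ⟨α, β, -, hαβ⟩ := DM.exists_factor (k := k) (E := outside hJ) (E' := negPart hJ T ∅)
    (fun a ha => ⟨fun v => ha.2.2 v (Finset.notMem_empty v), fun haJ => ha.1.2 0 (by
      rwa [show tvec T 0 = 0 from funext fun v => by simp [tvec], add_zero])⟩)
    (fun a ha b hb hba => ⟨⟨fun v _ => hb.1 v, fun N hN => ha.1.2 N
      (hJ (add_le_add_left hba _) hN)⟩, by simp, fun v _ => hb.1 v⟩) T r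
    (fun a ha ha' => ⟨⟨fun v _ => ha'.1 v, fun N hN => ha.2 (by
      simpa using hr _ ha'.1 ⟨N, hN⟩)⟩, by simp, fun v _ => ha'.1 v⟩)
  rw [xT, pow_add]
  exact fun z => LC.smul_eq_zero_of_factor hαβ h z

end Localized

section Nonvanishing

variable {V : Type} [DecidableEq V] {k : Type} [Field k] {J : Set (V → ℤ)}

/-- Replace the coordinates in `T` by a constant. -/
def setOn (T : Finset V) (z : ℤ) (c : V → ℤ) : V → ℤ := fun v => if v ∈ T then z else c v

lemma setOn_of_mem {T : Finset V} {v : V} (hv : v ∈ T) (z : ℤ) (c : V → ℤ) :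
    setOn T z c v = z := if_pos hv

lemma setOn_of_notMem {T : Finset V} {v : V} (hv : v ∉ T) (z : ℤ) (c : V → ℤ) :
    setOn T z c v = c v := if_neg hv

lemma setOn_mem_locStd (hJ : IsUpperSet J) {T : Finset V} {c : V → ℤ} (z : ℤ) :
    setOn T z c ∈ locStd J T ↔ c ∈ locStd J T :=
  ⟨locStd_congr hJ fun _ hv => setOn_of_notMem hv z c,
    locStd_congr hJ fun _ hv => (setOn_of_notMem hv z c).symm⟩

lemma setOn_mem_negPart (hJ : IsUpperSet J) {T : Finset V} {c : V → ℤ} {z : ℤ} (hz : z < 0) :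
    setOn T z c ∈ (negPart hJ T T).1 ↔ c ∈ locStd J T := by
  refine ⟨fun h => (setOn_mem_locStd hJ z).1 h.1, fun h => ⟨(setOn_mem_locStd hJ z).2 h, ?_, ?_⟩⟩
  · exact fun v hv => by rwa [setOn_of_mem hv]
  · exact fun v hv => by rw [setOn_of_notMem hv]; exact h.1 v hv

lemma setOn_add_ev {T : Finset V} {c : V → ℤ} {z : ℤ} {j : V} (hj : j ∉ T) (n : ℕ) :
    setOn T z c + n • ev j = setOn T z (c + n • ev j) := by
  funext v
  by_cases hv : v ∈ T
  · have : v ≠ j := fun h => hj (h ▸ hv)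
    simp [setOn_of_mem hv, this]
  · simp [setOn_of_notMem hv]

lemma setOn_add_tvec {T : Finset V} {c : V → ℤ} {s : ℕ} (n : ℕ) :
    setOn T (-(s + n : ℤ)) c + tvec T n = setOn T (-s) c := by
  funext v
  by_cases hv : v ∈ T
  · simp [setOn_of_mem hv, tvec, hv]
  · simp [setOn_of_notMem hv, tvec, hv]

omit [DecidableEq V] in
lemma xT_singleton (v : V) (s : ℕ) : (xT k {v} s) = X v ^ s := by rw [xT, Finset.prod_singleton]

open Classical in
lemma DM.co_X_smul {E : {E : Set (V → ℤ) // E.OrdConnected}} (v : V) (s : ℕ) (x : DM k E)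
    (a : V → ℤ) : ((X v ^ s : MvPolynomial V k) • x).co a =
      if a ∈ E.1 then x.co (a - s • ev v) else 0 := by
  rw [← xT_singleton, DM.co_xT_smul, tvec_singleton]

variable [Fintype V]

/-- No element of the localization is a socle element. -/
lemma Kills.exists_add_ev_mem (hJ : IsUpperSet J) {T : Finset V} {s : ℕ}
    (h : Kills (maxIdeal k V) 0 (xT k T s) (DM k (negPart hJ T T))) {c : V → ℤ}
    (hc : c ∈ locStd J T) : ∃ j ∉ T, c + ev j ∈ locStd J T := by
  by_contra! hmax
  let c' := setOn T (-(1 + s : ℤ)) c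
  have hc' : c' ∈ (negPart hJ T T).1 := (setOn_mem_negPart hJ (by omega)).2 hc
  let e : DM k (negPart hJ T T) := DM.single _ c'
  have he : e ∈ powTorsion (maxIdeal k V) (DM k (negPart hJ T T)) := by
    obtain ⟨N, hN⟩ := maxIdeal_pow_le (k := k)
      (A := LinearMap.ker (LinearMap.toSpanSingleton (MvPolynomial V k) _ e)) (r := s + 1)
      (fun v => by
        rw [LinearMap.mem_ker, LinearMap.toSpanSingleton_apply]
        ext a
        rw [DM.co_X_smul, DM.co_zero]
        split_ifs with ha
        · rw [DM.co_single, if_neg]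
          rintro ⟨hac, -⟩
          rw [sub_eq_iff_eq_add] at hac
          by_cases hv : v ∈ T
          · have := ha.2.1 v hv
            simp [hac, c', setOn_of_mem hv] at this
            omega
          · rw [hac, setOn_add_ev hv, setOn_mem_negPart hJ (by omega)] at ha
            refine hmax v hv ((locStd_ordConnected hJ T).out hc ha ⟨?_, ?_⟩)
            · exact le_add_of_nonneg_right (ev_nonneg v)
            · rw [add_smul, one_smul, add_le_add_iff_left]
              exact le_add_of_nonneg_left (nsmul_nonneg (ev_nonneg v) s)
        · rfl)
    exact ⟨N, fun r hr => hN hr⟩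
  have hzero := congrArg (fun x => DM.co x (setOn T (-1) c)) (h.smul_eq_zero he)
  have hmem : setOn T (-1) c ∈ (negPart hJ T T).1 := (setOn_mem_negPart hJ (by omega)).2 hc
  have hshift : c' + tvec T s = setOn T (-1) c := by
    have := setOn_add_tvec (T := T) (c := c) (s := 1) s
    rwa [Nat.cast_one] at this
  simp only [DM.co_xT_smul, if_pos hmem, DM.co_zero, e, DM.co_single] at hzero
  rw [if_pos ⟨by rw [← hshift, add_sub_cancel_right], hc'⟩] at hzero
  exact one_ne_zero hzero

/-- Exponents that lie in `E` after adding a large multiple of a unit vector. -/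
def eventual (E : {E : Set (V → ℤ) // E.OrdConnected}) (j : V) :
    {E : Set (V → ℤ) // E.OrdConnected} :=
  ⟨{a | ∃ N₀ : ℕ, ∀ N ≥ N₀, a + N • ev j ∈ E.1},
    ⟨fun _ ⟨N₁, h₁⟩ _ ⟨N₂, h₂⟩ _ hc => ⟨max N₁ N₂, fun N hN =>
      E.2.out (h₁ N ((le_max_left _ _).trans hN)) (h₂ N ((le_max_right _ _).trans hN))
        ⟨add_le_add_left hc.1 _, add_le_add_left hc.2 _⟩⟩⟩⟩

end Nonvanishing

section Disconnected

variable {V : Type} [DecidableEq V] {k : Type} [Field k] {J : Set (V → ℤ)}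
  {E : {E : Set (V → ℤ) // E.OrdConnected}}

lemma le_add_nsmul_ev (a : V → ℤ) (j : V) (N : ℕ) : a ≤ a + N • ev j :=
  le_add_of_nonneg_right (nsmul_nonneg (ev_nonneg j) N)

lemma mem_of_mem_eventual {j : V} {a c : V → ℤ} (hc : c ∈ E.1) (ha : a ∈ (eventual E j).1)
 {b : V → ℤ} (hcb : c ≤ b) {n : ℕ} (hba : b ≤ a + n • ev j) : b ∈ E.1 := by
  obtain ⟨N₀, h⟩ := ha
  refine E.2.out hc (h _ (le_max_left N₀ n)) ⟨hcb, hba.trans ?_⟩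
  exact add_le_add_right (nsmul_le_nsmul_left (ev_nonneg j) (le_max_right N₀ n)) a

lemma mem_eventual_of_le {j : V} {a c : V → ℤ} (hc : c ∈ E.1) (ha : a ∈ (eventual E j).1)
    (hca : c ≤ a) : c ∈ (eventual E j).1 :=
  ⟨0, fun N _ => mem_of_mem_eventual hc ha (le_add_nsmul_ev c j N)
    (add_le_add_left hca (N • ev j))⟩

lemma add_mem_eventual {j : V} {a : V → ℤ} (ha : a ∈ (eventual E j).1) (n : ℕ) :
    a + n • ev j ∈ (eventual E j).1 := by
  obtain ⟨N₀, h⟩ := ha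
  refine ⟨N₀, fun N hN => ?_⟩
  rw [add_assoc, ← add_smul]
  exact h _ (by omega)

/-- The projection of a degree module to its localization. -/
noncomputable def DM.toEventual (k : Type) [Field k] (E : {E : Set (V → ℤ) // E.OrdConnected})
    (j : V) : DM k E →ₗ[MvPolynomial V k] DM k (eventual E j) :=
  DM.hom E (eventual E j) 0 fun a ha b hb hab => by
    rw [sub_zero] at hab ⊢
    have hba : a - b ≤ a := sub_le_self a hb
    exact ⟨fun _ => mem_eventual_of_le hab ha hba,
      fun _ => mem_of_mem_eventual hab ha hba (le_add_nsmul_ev a j 0)⟩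

open Classical in
lemma DM.co_toEventual (j : V) (x : DM k E) (a : V → ℤ) :
    (DM.toEventual k E j x).co a = if a ∈ (eventual E j).1 then x.co a else 0 := by
  rw [DM.toEventual, DM.co_hom, sub_zero]

/-- The projection of a degree module to the product of its localizations at variables
outside `T`. -/
noncomputable def DM.toEventuals (k : Type) [Field k] (E : {E : Set (V → ℤ) // E.OrdConnected})
    (T : Finset V) :
    DM k E →ₗ[MvPolynomial V k] ((j : {j // j ∉ T}) → DM k (eventual E j.1)) :=
  LinearMap.pi fun j => DM.toEventual k E j.1

lemma subsingleton_LC_eventuals (E : {E : Set (V → ℤ) // E.OrdConnected}) (T : Finset V) :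
    Subsingleton (LC (maxIdeal k V) 0 ((j : {j // j ∉ T}) → DM k (eventual E j.1))) := by
  refine ⟨fun h h' => LC.toModule_injective ?_⟩
  have key : ∀ h, LC.toModule (J := maxIdeal k V)
      (M := (j : {j // j ∉ T}) → DM k (eventual E j.1)) h = 0 := by
    intro h
    obtain ⟨N, hN⟩ := LC.toModule_mem h
    funext j
    ext a
    by_cases ha : a ∈ (eventual E j.1).1
    · have := congrFun (hN _ (by simpa using xT_mem (k := k) (Finset.singleton_nonempty j.1) N)) j
      have := congrArg (fun x => DM.co x (a + N • ev j.1)) this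
      simp only [Pi.smul_apply, DM.co_xT_smul, tvec_singleton, add_sub_cancel_right,
        if_pos (add_mem_eventual ha N)] at this
      exact this
    · rw [DM.co_of_notMem _ ha]
      rfl
  rw [key, key]

lemma Kills.toEventuals_injective [Fintype V] (hJ : IsUpperSet J) {T : Finset V} {s : ℕ}
    (h : Kills (maxIdeal k V) 0 (xT k T s) (DM k (negPart hJ T T))) :
    Function.Injective (DM.toEventuals k (negPart hJ T T) T) := by
  rw [← LinearMap.ker_eq_bot, LinearMap.ker_eq_bot']
  intro x hx
  ext a
  by_contra hxa
  have ha : a ∈ (negPart hJ T T).1 := DM.mem_of_co hxa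
  have hL : ∀ j ∉ T, a ∉ (eventual (negPart hJ T T) j).1 := by
    intro j hj haj
    have := congrArg (fun y => DM.co y a) (congrFun hx ⟨j, hj⟩)
    simp only [DM.toEventuals, LinearMap.pi_apply, DM.co_toEventual, if_pos haj] at this
    exact hxa this
  have hB : ∀ j, ∃ N : ℤ, ∀ b ∈ (negPart hJ T T).1, a ≤ b → b j ≤ N := by
    intro j
    by_cases hj : j ∈ T
    · exact ⟨0, fun b hb _ => (hb.2.1 j hj).le⟩
    · have := hL j hj
      simp only [eventual, Set.mem_ofPred_eq, not_exists, not_forall] at this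
      obtain ⟨N, -, hN⟩ := this 0
      refine ⟨a j + N, fun b hb hab => ?_⟩
      by_contra! hlt
      refine hN ((negPart hJ T T).2.out ha hb ⟨le_add_nsmul_ev a j N, fun v => ?_⟩)
      by_cases hv : v = j
      · subst hv
        simpa using hlt.le
      · simpa [hv] using hab v
  choose N hN using hB
  have hgrow : ∀ n : ℕ, ∃ b ∈ (negPart hJ T T).1, a ≤ b ∧ ∑ v, b v = ∑ v, a v + n := by
    intro n
    induction n with
    | zero => exact ⟨a, ha, le_rfl, by simp⟩
    | succ n ih =>
      obtain ⟨b, hb, hab, hsum⟩ := ih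
      obtain ⟨j, hj, hbj⟩ := h.exists_add_ev_mem hJ hb.1
      have hbj' : b ≤ b + ev j := le_add_of_nonneg_right (ev_nonneg j)
      refine ⟨b + ev j, ⟨hbj, fun v hv => ?_, fun v hv => (hb.2.2 v hv).trans (hbj' v)⟩,
        hab.trans hbj', ?_⟩
      · rw [Pi.add_apply, ev_of_ne (fun h : v = j => hj (h ▸ hv)), add_zero]
        exact hb.2.1 v hv
      · simp only [Pi.add_apply, Finset.sum_add_distrib, hsum, Finset.sum_pi_single',
          Finset.mem_univ, if_true]
        simp
        ring
  obtain ⟨b, hb, hab, hsum⟩ := hgrow (∑ v, N v - ∑ v, a v + 1).toNat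
  have : ∑ v, b v ≤ ∑ v, N v := Finset.sum_le_sum fun v _ => hN v b hb hab
  omega

/-- A finite set of directions out of `c` cannot be disconnected if the second local cohomology
is annihilated. -/
lemma Kills.false_of_disconnected [Fintype V] (hJ : IsUpperSet J) {T : Finset V} {s : ℕ}
    (h₀ : Kills (maxIdeal k V) 0 (xT k T s) (DM k (negPart hJ T T)))
    (h₁ : Kills (maxIdeal k V) 1 (xT k T s) (DM k (negPart hJ T T))) {c : V → ℤ}
    {A : Set V} (hA : ∀ i ∈ A, i ∉ T → ∀ j ∉ A, j ∉ T → c + ev i + ev j ∉ locStd J T) {w f : V}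
    (hwT : w ∉ T) (hfT : f ∉ T) (hwA : w ∈ A) (hfA : f ∉ A)
    (hw : ∀ N : ℕ, c + N • ev w ∈ locStd J T) (hf : ∀ N : ℕ, c + N • ev f ∈ locStd J T) :
    False := by
  classical
  have hc : c ∈ locStd J T := by simpa using hw 0
  set E := negPart hJ T T with hE
  let c' := setOn T (-(1 + s : ℤ)) c
  have hmem : ∀ z : ℤ, z < 0 → setOn T z c ∈ E.1 := fun z hz => (setOn_mem_negPart hJ hz).2 hc
  have hc' : c' ∈ E.1 := hmem _ (by omega)
  have hshift : c' + tvec T s = setOn T (-1) c := by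
    have := setOn_add_tvec (T := T) (c := c) (s := 1) s
    rwa [Nat.cast_one] at this
  have hev : ∀ z : ℤ, z < 0 → ∀ j ∉ T, (∀ N : ℕ, c + N • ev j ∈ locStd J T) →
      setOn T z c ∈ (eventual E j).1 := fun z hz j hj h => ⟨0, fun N _ => by
    rw [setOn_add_ev hj]
    exact (setOn_mem_negPart hJ hz).2 (h N)⟩
  have hno : ∀ i ∉ T, ∀ j ∉ T, c + ev i + ev j ∉ locStd J T →
      c' + (s + 1) • ev i ∉ (eventual E j).1 := by
    intro i hi j hj hij hmem
    have h1 : c' + ev i + ev j ∈ E.1 := by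
      refine mem_of_mem_eventual (n := 1) hc' hmem ?_ ?_
      · exact (le_add_of_nonneg_right (ev_nonneg i)).trans (le_add_of_nonneg_right (ev_nonneg j))
      · rw [one_smul, add_smul, one_smul]
        refine add_le_add_left (add_le_add_right ?_ _) _
        exact le_add_of_nonneg_left (nsmul_nonneg (ev_nonneg i) s)
    have h2 := setOn_add_ev (T := T) (c := c) (z := -(1 + s : ℤ)) hi 1
    have h3 := setOn_add_ev (T := T) (c := c + ev i) (z := -(1 + s : ℤ)) hj 1
    rw [one_smul] at h2 h3
    rw [show c' + ev i = _ from h2, h3] at h1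
    exact hij ((setOn_mem_negPart hJ (by omega)).1 h1)
  let e : (j : {j // j ∉ T}) → DM k (eventual E j.1) :=
    fun j => if j.1 ∈ A then DM.single _ c' else 0
  obtain ⟨N, hN⟩ := maxIdeal_pow_le (k := k)
    (A := (LinearMap.range (DM.toEventuals k E T)).comap
      (LinearMap.toSpanSingleton (MvPolynomial V k) _ e)) (r := s + 1) (fun v => by
    rw [Submodule.mem_comap, LinearMap.toSpanSingleton_apply, LinearMap.mem_range]
    refine ⟨if v ∈ A ∧ v ∉ T then DM.single E (c' + (s + 1) • ev v) else 0, ?_⟩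
    funext j
    ext a
    simp only [DM.toEventuals, LinearMap.pi_apply, DM.co_toEventual, Pi.smul_apply,
      DM.co_X_smul]
    split_ifs with haj hv
    · rw [DM.co_single]
      by_cases had : a = c' + (s + 1) • ev v
      · subst had
        by_cases hjA : j.1 ∈ A
        · have hle : c' ≤ c' + (s + 1) • ev v := le_add_nsmul_ev _ _ _
          simp only [e, if_pos hjA, DM.co_single, add_sub_cancel_right]
          rw [if_pos ⟨trivial, mem_of_mem_eventual hc' haj hle (le_add_nsmul_ev _ _ 0)⟩,
            if_pos ⟨trivial, mem_eventual_of_le hc' haj hle⟩]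
        · exact absurd haj (hno v hv.2 j.1 j.2 (hA v hv.1 hv.2 j.1 hjA j.2))
      · rw [if_neg (fun h => had h.1)]
        by_cases hjA : j.1 ∈ A
        · simp only [e, if_pos hjA, DM.co_single]
          rw [if_neg]
          exact fun h => had (sub_eq_iff_eq_add.1 h.1)
        · simp only [e, if_neg hjA, DM.co_zero]
    · rw [DM.co_zero]
      by_cases hjA : j.1 ∈ A
      · simp only [e, if_pos hjA, DM.co_single]
        rw [if_neg]
        rintro ⟨h, -⟩
        rw [sub_eq_iff_eq_add] at h
        subst h
        by_cases hvT : v ∈ T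
        · obtain ⟨N, hN⟩ := haj
          have := (hN N le_rfl).2.1 v hvT
          have hvj : v ≠ j.1 := fun h => j.2 (h ▸ hvT)
          simp [c', setOn_of_mem hvT, hvj] at this
          omega
        · refine hno v hvT j.1 j.2 ?_ haj
          rw [add_right_comm]
          exact hA j.1 hjA j.2 v (fun h => hv ⟨h, hvT⟩) hvT
      · simp only [e, if_neg hjA, DM.co_zero]
    · rfl)
  obtain ⟨x : DM k E, hx : DM.toEventuals k E T x = xT k T s • e⟩ := h₁.smul_mem_range (h₀.toEventuals_injective hJ)
    (subsingleton_LC_eventuals E T) (fun r hr => hN hr)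
  have hcoord : ∀ j (hj : j ∉ T), (∀ N : ℕ, c + N • ev j ∈ locStd J T) →
      x.co (setOn T (-1) c) = if j ∈ A then 1 else 0 := by
    intro j hj hjN
    have := congrArg (fun y => DM.co y (setOn T (-1) c)) (congrFun hx ⟨j, hj⟩)
    simp only [DM.toEventuals, LinearMap.pi_apply, DM.co_toEventual, Pi.smul_apply,
      DM.co_xT_smul, if_pos (hev (-1) (by omega) j hj hjN)] at this
    rw [this]
    by_cases hjA : j ∈ A
    · simp only [e, if_pos hjA, DM.co_single]
      rw [if_pos ⟨by rw [← hshift, add_sub_cancel_right], hev _ (by omega) j hj hjN⟩]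
    · simp only [e, if_neg hjA, DM.co_zero]
  have h1 := hcoord w hwT hw
  rw [if_pos hwA, hcoord f hfT hf, if_neg hfA] at h1
  exact zero_ne_one h1

end Disconnected

section Necessity

variable {V : Type} [DecidableEq V] {k : Type} [Field k]

lemma add_tvec_mem_of_bounded {J : Set (V → ℤ)} (hJ : IsUpperSet J) {r : ℕ}
    (hb : ∀ a ∈ J, ∃ g ∈ J, g ≤ a ∧ ∀ v, g v ≤ r) (T : Finset V) (a : V → ℤ) (ha : 0 ≤ a)
    (h : ∃ N : ℕ, a + tvec T N ∈ J) : a + tvec T r ∈ J := by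
  obtain ⟨N, hN⟩ := h
  obtain ⟨g, hg, hle, hgr⟩ := hb _ hN
  refine hJ (fun v => ?_) hg
  have h1 := hle v
  have h2 := hgr v
  have h3 := ha v
  simp only [Pi.add_apply, tvec, Pi.zero_apply] at h1 h3 ⊢
  split_ifs at h1 ⊢ with hv <;> omega

lemma exists_bounded_srExp (Δ : Set (Finset V)) :
    ∀ a ∈ srExp Δ, ∃ g ∈ srExp Δ, g ≤ a ∧ ∀ v, g v ≤ (1 : ℕ) := by
  rintro a ⟨F, hF, hle⟩
  refine ⟨tvec F 1, ⟨F, hF, le_rfl⟩, hle, fun v => ?_⟩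
  simp only [tvec]
  split_ifs <;> simp

lemma exists_bounded_sqExp (G : SimpleGraph V) :
    ∀ a ∈ sqExp G, ∃ g ∈ sqExp G, g ≤ a ∧ ∀ v, g v ≤ (4 : ℕ) := by
  rintro a ⟨p, q, p', q', h, h', hle⟩
  refine ⟨_, ⟨p, q, p', q', h, h', le_rfl⟩, hle, fun v => ?_⟩
  have key : ∀ u : V, ev u v ≤ 1 := fun u => by
    rw [ev, Pi.single_apply]
    split_ifs <;> simp
  have := key p
  have := key q
  have := key p'
  have := key q'
  simp only [Pi.add_apply]
  push_cast
  omega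

variable [Fintype V]

lemma quotCM.exists_insert {Δ : Set (Finset V)} (h : quotCM k V (srIdeal k Δ))
    (hΔ : IsSimplicialComplex Δ) {F F' : Finset V} (hF : F ∈ Δ) (hF' : F' ∈ Δ)
    (hlt : F.card < F'.card) : ∃ a ∉ F, insert a F ∈ Δ := by
  obtain ⟨e⟩ := nonempty_quotient_equiv (k := k) (isUpperSet_srExp Δ) mem_srIdeal
  have hsub : Subsingleton (LC (maxIdeal k V) F.card (MvPolynomial V k ⧸ srIdeal k Δ)) :=
    h _ (lt_of_lt_of_le (Nat.cast_lt.2 hlt) (le_ringKrullDim_srIdeal hΔ hF'))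
  have hk : Kills (maxIdeal k V) (0 + F.card) (xT k F 0)
      (DM k (outside (isUpperSet_srExp Δ))) := by
    rw [zero_add]
    have := (LC.congr (J := maxIdeal k V) (i := F.card) e).symm.toEquiv.subsingleton
    exact fun _ => Subsingleton.elim _ _
  have hk' := Kills.negPart_self (isUpperSet_srExp Δ)
    (add_tvec_mem_of_bounded (isUpperSet_srExp Δ) (exists_bounded_srExp Δ) F) hk
  obtain ⟨j, hj, hjF⟩ := hk'.exists_add_ev_mem (c := 0) (isUpperSet_srExp Δ)
    ⟨fun v _ => le_rfl, fun N => by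
      rw [zero_add]
      rintro ⟨H, hH, hle⟩
      refine hH (hΔ F hF H fun v hv => ?_)
      by_contra hvF
      have := hle v
      simp [tvec, hv, hvF] at this⟩
  refine ⟨j, hj, ?_⟩
  by_contra hins
  refine hjF.2 1 ⟨insert j F, hins, le_of_eq ?_⟩
  funext v
  by_cases hv : v = j
  · subst hv
    simp [tvec, hj]
  · simp [tvec, hv]

lemma quotGCM.exists_kills {G : SimpleGraph V} (h : quotGCM k V (edgeIdeal k G ^ 2))
    {F T : Finset V} (hF : F ∈ indepComplex G) (hT : T.Nonempty) {i : ℕ}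
    (hlt : i + T.card < F.card) : ∃ s₀, ∀ s ≥ s₀, Kills (maxIdeal k V) i (xT k T s)
      (DM k (negPart (isUpperSet_sqExp G) T T)) := by
  obtain ⟨e⟩ := nonempty_quotient_equiv (k := k) (isUpperSet_sqExp G) mem_edgeIdeal_sq
  have hfin : IsFiniteLength (MvPolynomial V k)
      (LC (maxIdeal k V) (i + T.card) (MvPolynomial V k ⧸ edgeIdeal k G ^ 2)) :=
    h _ (lt_of_lt_of_le (Nat.cast_lt.2 hlt) (le_ringKrullDim_edgeIdeal_sq hF))
  obtain ⟨N, hN⟩ := LC.exists_pow_smul_eq_zero hfin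
  refine ⟨4 + N, fun s hs => ?_⟩
  obtain ⟨t, rfl⟩ := Nat.exists_eq_add_of_le hs
  rw [add_assoc]
  refine Kills.negPart_self (isUpperSet_sqExp G)
    (add_tvec_mem_of_bounded (isUpperSet_sqExp G) (exists_bounded_sqExp G) T) fun z => ?_
  refine (LC.congr (J := maxIdeal k V) (i := i + T.card) e).symm.injective ?_
  rw [map_smul, map_zero]
  exact hN _ (Ideal.pow_le_pow_right (by omega) (xT_mem hT _)) _

omit [Fintype V] in
lemma mem_locStd_sqExp {G : SimpleGraph V} {T W : Finset V} (hW : Disjoint W T) {c : V → ℤ}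
    (hc : 0 ≤ c) {m : ℤ} (h : ∀ p q, G.Adj p q → (p ∈ T ∨ 0 < c p) → (q ∈ T ∨ 0 < c q) →
      m ≤ (if p ∈ W then 1 else 0) + if q ∈ W then 1 else 0)
    (hlt : ∑ v ∈ W, c v < 2 * m) : c ∈ locStd (sqExp G) T := by
  refine ⟨fun v _ => hc v, ?_⟩
  rintro N ⟨p, q, p', q', hpq, hpq', hle⟩
  have hnn : ∀ u v : V, 0 ≤ ev u v := fun u v => ev_nonneg u v
  have hpos : ∀ u, 0 < (ev p + ev q + (ev p' + ev q')) u → u ∈ T ∨ 0 < c u := by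
    intro u hu
    by_cases huT : u ∈ T
    · exact .inl huT
    · have := hu.trans_le (hle u)
      simp only [Pi.add_apply, tvec, if_neg huT, add_zero] at this
      exact .inr this
  have hmem : ∀ u, u = p ∨ u = q ∨ u = p' ∨ u = q' → u ∈ T ∨ 0 < c u := by
    intro u hu
    refine hpos u ?_
    have h1 := hnn p u
    have h2 := hnn q u
    have h3 := hnn p' u
    have h4 := hnn q' u
    simp only [Pi.add_apply]
    rcases hu with rfl | rfl | rfl | rfl
    all_goals have := ev_self u; omega
  have h1 := h p q hpq (hmem p (by simp)) (hmem q (by simp))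
  have h2 := h p' q' hpq' (hmem p' (by simp)) (hmem q' (by simp))
  have hsum := Finset.sum_le_sum fun v (_ : v ∈ W) => hle v
  have hW0 : ∑ v ∈ W, tvec T N v = 0 := Finset.sum_eq_zero fun v hv => by
    simp [tvec, Finset.disjoint_left.1 hW hv]
  have hev : ∀ u, ∑ v ∈ W, ev u v = if u ∈ W then 1 else 0 := fun u => by
    simp [Pi.single_apply]
  simp only [Pi.add_apply, Finset.sum_add_distrib, hW0, hev] at hsum
  omega

omit [Fintype V] in
lemma ev_le_tvec {T : Finset V} {x : V} (hx : x ∈ T) : ev x ≤ tvec T 1 := by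
  intro v
  by_cases hv : v = x
  · subst hv
    simp [tvec, hx]
  · rw [ev_of_ne hv]
    exact tvec_nonneg T 1 v

omit [DecidableEq V] in
lemma exists_subset_maximal {P : Finset V → Prop} {T : Finset V} (h : P T) :
    ∃ U, T ⊆ U ∧ P U ∧ ∀ U', U ⊆ U' → P U' → U' ⊆ U := by
  obtain ⟨U, hTU, hU⟩ := Finite.exists_le_maximal h
  exact ⟨U, hTU, hU.1, fun U' h h' => hU.2 h' h⟩

omit [DecidableEq V] in
lemma exists_max_card {Δ : Set (Finset V)} (h : ∅ ∈ Δ) :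
    ∃ F ∈ Δ, ∀ F' ∈ Δ, F'.card ≤ F.card := by
  obtain ⟨F, hF, hmax⟩ := Set.exists_max_image Δ Finset.card (Set.toFinite _) ⟨∅, h⟩
  exact ⟨F, hF, hmax⟩

variable {G : SimpleGraph V}

lemma quotGCM.exists_insert (h : quotGCM k V (edgeIdeal k G ^ 2)) (hiso : noIsolated G)
    {F F' : Finset V} (hF : F ∈ indepComplex G) (hF' : F' ∈ indepComplex G)
    (hlt : F.card < F'.card) : ∃ a ∉ F, insert a F ∈ indepComplex G := by
  rcases F.eq_empty_or_nonempty with rfl | hne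
  · obtain ⟨a, -⟩ := Finset.card_pos.1 (lt_of_le_of_lt (Nat.zero_le _) hlt)
    exact ⟨a, Finset.notMem_empty a, singleton_mem_indepComplex a⟩
  by_contra! hmax
  have hadj : ∀ j ∉ F, ∃ x ∈ F, G.Adj j x := by
    intro j hj
    by_contra! hno
    exact hmax j hj (insert_mem_indepComplex.2 ⟨hF, hno⟩)
  obtain ⟨s, hs⟩ := h.exists_kills hF' hne (i := 0) (by omega)
  obtain ⟨i, hi⟩ := id hne
  obtain ⟨j, hij⟩ := hiso i
  have hjF : j ∉ F := fun hj => hF i hi j hj hij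
  obtain ⟨j', hj', hmem⟩ := (hs s le_rfl).exists_add_ev_mem (c := ev j) (isUpperSet_sqExp G)
    (mem_locStd_sqExp (W := {j}) (m := 1) (Finset.disjoint_singleton_left.2 hjF) (ev_nonneg j)
      (fun p q hpq hp hq => by
        have hcases : ∀ u, u ∈ F ∨ 0 < ev j u → u ∈ F ∨ u = j := by
          rintro u (hu | hu)
          · exact .inl hu
          · by_contra! hne
            rw [ev_of_ne hne.2] at hu
            exact hu.false
        rcases hcases p hp with hp | rfl
        · rcases hcases q hq with hq | rfl
          · exact absurd hpq (hF p hp q hq)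
          · simp only [Finset.mem_singleton, if_true]
            split_ifs <;> simp
        · simp only [Finset.mem_singleton, if_true]
          split_ifs <;> simp)
      (by simp))
  obtain ⟨x, hx, hjx⟩ := hadj j hjF
  obtain ⟨x', hx', hjx'⟩ := hadj j' hj'
  refine hmem.2 2 ⟨j, x, j', x', hjx, hjx', ?_⟩
  have := add_le_add (ev_le_tvec hx) (ev_le_tvec hx')
  calc ev j + ev x + (ev j' + ev x') = ev j + ev j' + (ev x + ev x') := by abel
    _ ≤ ev j + ev j' + (tvec F 1 + tvec F 1) := add_le_add_right this _
    _ = ev j + ev j' + tvec F 2 := by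
      congr 1
      funext v
      simp only [tvec, Pi.add_apply]
      split_ifs <;> simp

lemma quotGCM.no_triangle (h : quotGCM k V (edgeIdeal k G ^ 2)) {F : Finset V}
    (hF : F ∈ indepComplex G) (hmaxF : ∀ F' ∈ indepComplex G, F'.card ≤ F.card) {i p q r : V}
    (hpq : G.Adj p q) (hqr : G.Adj q r) (hpr : G.Adj p r) (hip : ¬ G.Adj i p)
    (hiq : ¬ G.Adj i q) (hir : ¬ G.Adj i r) : False := by
  obtain ⟨U, hiU, ⟨hUp, hUq, hUr⟩, hmax⟩ := exists_subset_maximal (T := {i})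
    (P := fun U => insert p U ∈ indepComplex G ∧ insert q U ∈ indepComplex G ∧
      insert r U ∈ indepComplex G) (by
        simp only [insert_mem_indepComplex, singleton_mem_indepComplex, Finset.mem_singleton,
          forall_eq, true_and]
        exact ⟨fun h => hip h.symm, fun h => hiq h.symm, fun h => hir h.symm⟩)
  have hp := (insert_mem_indepComplex.1 hUp).2
  have hq := (insert_mem_indepComplex.1 hUq).2
  have hr := (insert_mem_indepComplex.1 hUr).2
  have hU := (insert_mem_indepComplex.1 hUp).1
  have hpU : p ∉ U := fun h => hq p h hpq.symm
  have hqU : q ∉ U := fun h => hp q h hpq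
  have hrU : r ∉ U := fun h => hp r h hpr
  have hcard := hmaxF _ hUp
  rw [Finset.card_insert_of_notMem hpU] at hcard
  obtain ⟨s, hs⟩ := h.exists_kills hF (Finset.Nonempty.mono hiU (Finset.singleton_nonempty i))
    (i := 0) (by omega)
  have hc0 : 0 ≤ ev p + ev q + ev r :=
    add_nonneg (add_nonneg (ev_nonneg p) (ev_nonneg q)) (ev_nonneg r)
  obtain ⟨j, hj, hmem⟩ := (hs s le_rfl).exists_add_ev_mem (c := ev p + ev q + ev r)
    (isUpperSet_sqExp G) (mem_locStd_sqExp (W := {p, q, r}) (m := 2) (by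
      simp [hpU, hqU, hrU]) hc0 (fun x y hxy hx hy => by
        have hcases : ∀ u, u ∈ U ∨ 0 < (ev p + ev q + ev r) u → u ∈ U ∨ u ∈ ({p, q, r} : Finset V) := by
          rintro u (hu | hu)
          · exact .inl hu
          · by_contra! hne
            simp only [Finset.mem_insert, Finset.mem_singleton, not_or] at hne
            rw [Pi.add_apply, Pi.add_apply, ev_of_ne hne.2.1, ev_of_ne hne.2.2.1,
              ev_of_ne hne.2.2.2] at hu
            exact hu.false
        have hno : ∀ u ∈ U, ∀ z ∈ ({p, q, r} : Finset V), ¬ G.Adj z u := by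
          intro u hu z hz
          simp only [Finset.mem_insert, Finset.mem_singleton] at hz
          rcases hz with rfl | rfl | rfl
          exacts [hp u hu, hq u hu, hr u hu]
        rcases hcases x hx with hx | hx <;> rcases hcases y hy with hy | hy
        · exact absurd hxy (hU x hx y hy)
        · exact absurd hxy.symm (hno x hx y hy)
        · exact absurd hxy (hno y hy x hx)
        · rw [if_pos hx, if_pos hy]; norm_num) (by
      simp [Finset.sum_insert, hpq.ne, hqr.ne, hpr.ne, hpq.ne.symm, hqr.ne.symm, hpr.ne.symm]))
  by_cases hx : ∃ x ∈ U, G.Adj j x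
  · obtain ⟨x, hx, hjx⟩ := hx
    refine hmem.2 1 ⟨p, q, j, x, hpq, hjx, ?_⟩
    calc ev p + ev q + (ev j + ev x) = ev p + ev q + 0 + ev j + ev x := by abel
      _ ≤ ev p + ev q + ev r + ev j + tvec U 1 := by
        gcongr
        · exact ev_nonneg r
        · exact ev_le_tvec hx
  · push Not at hx
    have hjU : insert j U ∈ indepComplex G := insert_mem_indepComplex.2 ⟨hU, hx⟩
    have key : G.Adj p j ∨ G.Adj q j ∨ G.Adj r j := by
      by_contra! hno
      refine hj (hmax (insert j U) (Finset.subset_insert j U) ?_ (Finset.mem_insert_self j U))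
      simp only [insert_mem_indepComplex (F := insert j U), Finset.forall_mem_insert]
      exact ⟨⟨hjU, hno.1, hp⟩, ⟨hjU, hno.2.1, hq⟩, ⟨hjU, hno.2.2, hr⟩⟩
    have hz := tvec_nonneg U 0
    rcases key with hj | hj | hj
    · refine hmem.2 0 ⟨p, j, q, r, hj, hqr, le_trans (le_of_eq ?_) (le_add_of_nonneg_right hz)⟩
      abel
    · refine hmem.2 0 ⟨q, j, p, r, hj, hpr, le_trans (le_of_eq ?_) (le_add_of_nonneg_right hz)⟩
      abel
    · refine hmem.2 0 ⟨r, j, p, q, hj, hpq, le_trans (le_of_eq ?_) (le_add_of_nonneg_right hz)⟩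
      abel

omit [Fintype V] in
lemma add_nsmul_ev_mem_locStd {U : Finset V} {w f : V} (hU : insert w U ∈ indepComplex G)
    (hfU : f ∉ U) (hwf : w ≠ f) (N : ℕ) :
    ev w + ev f + N • ev w ∈ locStd (sqExp G) U := by
  refine mem_locStd_sqExp (W := {f}) (m := 1) (Finset.disjoint_singleton_left.2 hfU)
    (add_nonneg (add_nonneg (ev_nonneg w) (ev_nonneg f)) (nsmul_nonneg (ev_nonneg w) N))
    (fun p q hpq hp hq => ?_) (by simp [hwf.symm])
  have hcases : ∀ u, u ∈ U ∨ 0 < (ev w + ev f + N • ev w) u → u ∈ insert w U ∨ u = f := by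
    rintro u (hu | hu)
    · exact .inl (Finset.mem_insert_of_mem hu)
    · by_contra! hne
      have hw : u ≠ w := fun h => hne.1 (h ▸ Finset.mem_insert_self u U)
      simp [hw, hne.2] at hu
  rcases hcases p hp with hp | rfl
  · rcases hcases q hq with hq | rfl
    · exact absurd hpq (hU p hp q hq)
    · simp only [Finset.mem_singleton, if_true]
      split_ifs <;> simp
  · simp only [Finset.mem_singleton, if_true]
    split_ifs <;> simp

lemma quotGCM.edge (h : quotGCM k V (edgeIdeal k G ^ 2)) {F : Finset V}
    (hF : F ∈ indepComplex G) (hmaxF : ∀ F' ∈ indepComplex G, F'.card ≤ F.card) {T : Finset V}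
    (hT : T.Nonempty) {w f : V} (hwf : G.Adj w f) (hwT : insert w T ∈ indepComplex G)
    (hfT : insert f T ∈ indepComplex G) : ∃ U, T ⊆ U ∧ U.card + 1 = F.card ∧
      insert w U ∈ indepComplex G ∧ insert f U ∈ indepComplex G := by
  obtain ⟨U, hTU, ⟨hUw, hUf⟩, hmax⟩ := exists_subset_maximal
    (P := fun U => insert w U ∈ indepComplex G ∧ insert f U ∈ indepComplex G) ⟨hwT, hfT⟩
  refine ⟨U, hTU, ?_, hUw, hUf⟩
  have hw := (insert_mem_indepComplex.1 hUw).2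
  have hf := (insert_mem_indepComplex.1 hUf).2
  have hU := (insert_mem_indepComplex.1 hUw).1
  have hwU : w ∉ U := fun h => hf w h hwf.symm
  have hfU : f ∉ U := fun h => hw f h hwf
  have hcard := hmaxF _ hUw
  rw [Finset.card_insert_of_notMem hwU] at hcard
  by_contra hne
  obtain ⟨s₀, hs₀⟩ := h.exists_kills hF (hT.mono hTU) (i := 0) (by omega)
  obtain ⟨s₁, hs₁⟩ := h.exists_kills hF (hT.mono hTU) (i := 1) (by omega)
  refine Kills.false_of_disconnected (c := ev w + ev f)
    (A := {i | ¬ G.Adj w i ∧ ∀ x ∈ U, ¬ G.Adj i x}) (isUpperSet_sqExp G)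
    (hs₀ (max s₀ s₁) (le_max_left _ _)) (hs₁ (max s₀ s₁) (le_max_right _ _)) ?_ hwU hfU
    ⟨G.irrefl, hw⟩ (fun h => h.1 hwf) (add_nsmul_ev_mem_locStd hUw hfU hwf.ne)
    (fun N => by
      rw [add_comm (ev w)]
      exact add_nsmul_ev_mem_locStd hUf hwU hwf.ne.symm N)
  rintro i ⟨hwi, hi⟩ hiU j hj hjU hmem
  have hfi : G.Adj f i := by
    by_contra hfi
    have hiU' : insert i U ∈ indepComplex G := insert_mem_indepComplex.2 ⟨hU, hi⟩
    refine hiU (hmax (insert i U) (Finset.subset_insert i U) ?_ (Finset.mem_insert_self i U))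
    simp only [insert_mem_indepComplex (F := insert i U), Finset.forall_mem_insert]
    exact ⟨⟨hiU', hwi, hw⟩, hiU', hfi, hf⟩
  by_cases hwj : G.Adj w j
  · refine hmem.2 0 ⟨f, i, w, j, hfi, hwj, le_trans (le_of_eq ?_)
      (le_add_of_nonneg_right (tvec_nonneg U 0))⟩
    abel
  · have : ∃ x ∈ U, G.Adj j x := by
      by_contra! hno
      exact hj ⟨hwj, hno⟩
    obtain ⟨x, hx, hjx⟩ := this
    refine hmem.2 1 ⟨f, i, j, x, hfi, hjx, ?_⟩
    calc ev f + ev i + (ev j + ev x) = 0 + ev f + ev i + ev j + ev x := by abel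
      _ ≤ ev w + ev f + ev i + ev j + tvec U 1 := by
        gcongr
        · exact ev_nonneg w
        · exact ev_le_tvec hx

theorem quotGCM.exists_locallySpecial (h : quotGCM k V (edgeIdeal k G ^ 2))
    (hiso : noIsolated G) : ∃ d, LocallySpecial G d := by
  obtain ⟨F, hF, hmax⟩ := exists_max_card (empty_mem_indepComplex G)
  exact ⟨F.card, hmax, fun F' hF' hlt => h.exists_insert hiso hF' hF hlt,
    fun _ _ _ _ => h.no_triangle hF hmax, fun _ hT _ _ => h.edge hF hmax hT⟩

end Necessity

section Sufficiency

variable {V : Type} [DecidableEq V] [Fintype V] {G : SimpleGraph V} {d : ℕ}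

omit [DecidableEq V] [Fintype V] in
lemma isSimplicialComplex_indepComplex (G : SimpleGraph V) : IsSimplicialComplex (indepComplex G) :=
  fun _ h _ hsub => indepComplex_subset h hsub

omit [DecidableEq V] in
lemma exists_indepNumber (G : SimpleGraph V) :
    ∃ F ∈ indepComplex G, F.card = indepNumber G := by
  obtain ⟨F, hF, hmax⟩ := exists_max_card (empty_mem_indepComplex G)
  exact ⟨F, hF, (indepNumber_eq hmax ⟨F, hF, le_rfl⟩).symm⟩

lemma graphCM.exists_superset (h : graphCM G) (k : Type) [Field k] {F : Finset V}
    (hF : F ∈ indepComplex G) :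
    ∃ F', F ⊆ F' ∧ F' ∈ indepComplex G ∧ indepNumber G ≤ F'.card := by
  obtain ⟨U, hFU, hU, hmax⟩ := exists_subset_maximal (P := (· ∈ indepComplex G)) hF
  refine ⟨U, hFU, hU, ?_⟩
  obtain ⟨F', hF', hcard⟩ := exists_indepNumber G
  rw [← hcard]
  by_contra! hlt
  obtain ⟨a, ha, hins⟩ := (h k).exists_insert (isSimplicialComplex_indepComplex G) hU hF' hlt
  exact ha (hmax _ (Finset.subset_insert a U) hins (Finset.mem_insert_self a U))

omit [DecidableEq V] [Fintype V] in
lemma graphUnmixed.le_card (h : graphUnmixed G) {F U : Finset V} (hF : F ∈ indepComplex G)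
    (hmaxF : ∀ F' ∈ indepComplex G, F'.card ≤ F.card) (hU : U ∈ indepComplex G)
    (hmax : ∀ U', U ⊆ U' → U' ∈ indepComplex G → U' ⊆ U) : F.card ≤ U.card :=
  (h F ⟨hF, fun H hH hFH => Finset.eq_of_subset_of_card_le hFH (hmaxF H hH)⟩ U
    ⟨hU, fun H hH hUH => hUH.antisymm (hmax H hUH hH)⟩).le

lemma indepNumber_vertexLoc (h : graphUnmixed G) {F : Finset V} (hF : F ∈ indepComplex G)
    (hmaxF : ∀ F' ∈ indepComplex G, F'.card ≤ F.card) (i : V) :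
    indepNumber (vertexLoc G i) + 1 = F.card := by
  classical
  obtain ⟨U, hiU, hU, hmax⟩ := exists_subset_maximal (P := (· ∈ indepComplex G))
    (singleton_mem_indepComplex (G := G) i)
  have hi : i ∈ U := hiU (Finset.mem_singleton_self i)
  have hcard := h.le_card hF hmaxF hU hmax
  have hUF := hmaxF U hU
  have hpos := Finset.card_pos.2 ⟨i, hi⟩
  have hsub : U.erase i ⊆ (Finset.univ : Finset (vertexLocSet G i)).map
      (Function.Embedding.subtype _) := by
    intro x hx
    obtain ⟨hxi, hxU⟩ := Finset.mem_erase.1 hx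
    exact Finset.mem_map.2 ⟨⟨x, hxi, hU i hi x hxU⟩, Finset.mem_univ _, rfl⟩
  obtain ⟨H, -, hH⟩ := Finset.subset_map_iff.1 hsub
  have hHcard : H.card = U.card - 1 := by
    rw [← Finset.card_erase_of_mem hi, hH, Finset.card_map]
  rw [indepNumber_eq (r := F.card - 1)]
  · omega
  · intro H hH
    have h1 := (mem_indepComplex_vertexLoc H).1 hH
    have h2 := hmaxF _ h1.2
    rw [Finset.card_union_of_disjoint, Finset.card_map, Finset.card_singleton] at h2
    · omega
    · exact Finset.disjoint_left.2 fun x hx => (h1.1 x hx).1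
  · refine ⟨H, fun x hx y hy => ?_, by omega⟩
    have hmem : ∀ x ∈ H, x.1 ∈ U := fun x hx =>
      Finset.erase_subset i U (hH ▸ Finset.mem_map_of_mem (Function.Embedding.subtype _) hx)
    exact hU x.1 (hmem x hx) y.1 (hmem y hy)

lemma graphUnmixed.edge (k : Type) [Field k] (h : graphUnmixed G)
    (hs : ∀ i, specialCM (vertexLoc G i)) {F : Finset V}
    (hF : F ∈ indepComplex G) (hmaxF : ∀ F' ∈ indepComplex G, F'.card ≤ F.card) {T : Finset V}
    (hT : T.Nonempty) {w f : V} (hwf : G.Adj w f) (hwT : insert w T ∈ indepComplex G)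
    (hfT : insert f T ∈ indepComplex G) : ∃ U, T ⊆ U ∧ U.card + 1 = F.card ∧
      insert w U ∈ indepComplex G ∧ insert f U ∈ indepComplex G := by
  classical
  obtain ⟨i, hi⟩ := hT
  have hw := (insert_mem_indepComplex.1 hwT).2
  have hf := (insert_mem_indepComplex.1 hfT).2
  have hTΔ := (insert_mem_indepComplex.1 hwT).1
  let p : vertexLocSet G i := ⟨w, fun h => hf i hi (h ▸ hwf.symm), fun h => hw i hi h.symm⟩
  let q : vertexLocSet G i := ⟨f, fun h => hw i hi (h ▸ hwf), fun h => hf i hi h.symm⟩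
  obtain ⟨hcm, hnum⟩ := (hs i).2 p q hwf
  have hnum' := indepNumber_vertexLoc h hF hmaxF i
  have hsub : T.erase i ⊆ (Finset.univ : Finset (edgeLocSet (vertexLoc G i) p q)).map
      (edgeLocEmb G i p q) := by
    intro x hx
    obtain ⟨hxi, hxT⟩ := Finset.mem_erase.1 hx
    refine Finset.mem_map.2 ⟨⟨⟨x, hxi, hTΔ i hi x hxT⟩, ?_⟩, Finset.mem_univ _, rfl⟩
    exact not_or.2 ⟨hw x hxT, hf x hxT⟩
  obtain ⟨H, -, hH⟩ := Finset.subset_map_iff.1 hsub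
  have hHT : ∀ x ∈ H, x.1.1 ∈ T := fun x hx =>
    Finset.erase_subset i T (hH ▸ Finset.mem_map_of_mem (edgeLocEmb G i p q) hx)
  obtain ⟨K, hHK, hK, hKcard⟩ := hcm.exists_superset k (F := H)
    (fun x hx y hy => hTΔ x.1.1 (hHT x hx) y.1.1 (hHT y hy))
  have hiK : i ∉ K.map (edgeLocEmb G i p q) := by
    intro h
    obtain ⟨x, -, hx⟩ := Finset.mem_map.1 h
    exact x.1.2.1 hx
  have hU : insert i (K.map (edgeLocEmb G i p q)) ∈ indepComplex G := by
    refine insert_mem_indepComplex.2 ⟨fun x hx y hy => ?_, fun x hx => ?_⟩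
    · obtain ⟨x, hx', rfl⟩ := Finset.mem_map.1 hx
      obtain ⟨y, hy', rfl⟩ := Finset.mem_map.1 hy
      exact hK x hx' y hy'
    · obtain ⟨x, hx, rfl⟩ := Finset.mem_map.1 hx
      exact x.1.2.2
  have hwU : insert w (insert i (K.map (edgeLocEmb G i p q))) ∈ indepComplex G := by
    refine insert_mem_indepComplex.2 ⟨hU, ?_⟩
    rw [Finset.forall_mem_insert]
    refine ⟨hw i hi, fun x hx => ?_⟩
    obtain ⟨x, hx, rfl⟩ := Finset.mem_map.1 hx
    exact fun h => x.2 (.inl h)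
  have hfU : insert f (insert i (K.map (edgeLocEmb G i p q))) ∈ indepComplex G := by
    refine insert_mem_indepComplex.2 ⟨hU, ?_⟩
    rw [Finset.forall_mem_insert]
    refine ⟨hf i hi, fun x hx => ?_⟩
    obtain ⟨x, hx, rfl⟩ := Finset.mem_map.1 hx
    exact fun h => x.2 (.inr h)
  refine ⟨_, fun x hx => ?_, ?_, hwU, hfU⟩
  · by_cases hxi : x = i
    · rw [hxi]
      exact Finset.mem_insert_self _ _
    · refine Finset.mem_insert_of_mem (Finset.map_subset_map.2 hHK ?_)
      rw [← hH]
      exact Finset.mem_erase.2 ⟨hxi, hx⟩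
  · have hle := hmaxF _ hwU
    have hwi : w ∉ insert i (K.map (edgeLocEmb G i p q)) := fun h =>
      (insert_mem_indepComplex.1 hfU).2 w h hwf.symm
    rw [Finset.card_insert_of_notMem hwi, Finset.card_insert_of_notMem hiK,
      Finset.card_map] at hle
    rw [Finset.card_insert_of_notMem hiK, Finset.card_map]
    omega

theorem graphUnmixed.exists_locallySpecial (k : Type) [Field k] (h : graphUnmixed G)
    (hs : ∀ i, specialCM (vertexLoc G i) ∧ (vertexLoc G i).CliqueFree 3) :
    ∃ d, LocallySpecial G d := by
  obtain ⟨F, hF, hmax⟩ := exists_max_card (empty_mem_indepComplex G)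
  refine ⟨F.card, hmax, fun F' hF' hlt => ?_, fun i p q r hpq hqr hpr hip hiq hir => ?_,
    fun _ hT _ _ => h.edge k (fun i => (hs i).1) hF hmax hT⟩
  · by_contra! hno
    refine hlt.not_ge (h.le_card hF hmax hF' fun U hU hUΔ => fun a ha => ?_)
    by_contra haF
    exact hno a haF (indepComplex_subset hUΔ (Finset.insert_subset ha hU))
  · let p' : vertexLocSet G i := ⟨p, fun h => hiq (h ▸ hpq), hip⟩
    let q' : vertexLocSet G i := ⟨q, fun h => hir (h ▸ hqr), hiq⟩
    let r' : vertexLocSet G i := ⟨r, fun h => hiq (h ▸ hqr.symm), hir⟩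
    exact (hs i).2 {p', q', r'} (SimpleGraph.is3Clique_triple_iff.2 ⟨hpq, hpr, hqr⟩)

end Sufficiency

/-- **Corollary 3.12.** `S/I(G)²` is generalized Cohen–Macaulay if and only if `G` is
unmixed and, for every vertex `i`, the graph `G_i = G \ ({i} ∪ N(i))` is special
Cohen–Macaulay and has no triangles. -/
theorem second_power_gCM_iff_graph {n : ℕ} (k : Type) [Field k]
    (G : SimpleGraph (Fin n)) (hiso : noIsolated G) :
    quotGCM k (Fin n) ((edgeIdeal k G) ^ 2) ↔
      (graphUnmixed G ∧ ∀ i : Fin n,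
        specialCM (vertexLoc G i) ∧ (vertexLoc G i).CliqueFree 3) := by
  constructor
  · intro h
    obtain ⟨d, hd⟩ := h.exists_locallySpecial hiso
    exact ⟨hd.graphUnmixed, fun i => ⟨hd.specialCM_vertexLoc i, hd.cliqueFree_vertexLoc i⟩⟩
  · rintro ⟨h, hs⟩
    obtain ⟨d, hd⟩ := h.exists_locallySpecial k hs
    exact hd.quotGCM_sq
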